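/- arXiv:2106.03354 — 3 statements merged into one kernel-verified Lean document; each statement's English description precedes it below -/
import Mathlib

section
/- Let d ≥ 1, let ρ be a probability density on ℝ^d with finite variance, fix x in the interior of the support of ρ with ρ continuous at x. Assume ∫ ρ(y)·f²(y)/(1+‖y‖^{2d}) d^d y < ∞ and the local Hölder condition with exponent α_x > 0 at x. If κ(x) = ∫ ρ(x+y)·(f(x+y)−f(x))/‖y‖^d d^d y = 0, then the bias term B(x) = E[(Σ_{i=0}^n w_i(x)·(f(X_i)−f(x)))²] satisfies: B(x) = O(n^{−2α_x/d}·(ln n)^{−1−2α_x/d}) if d > 2α_x; B(x) = O(n^{−1}·(ln n)^{−1}) if d = 2α_x; and B(x) = O(n^{−1}·(ln n)^{−2}) if d < 2α_x. -/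
open MeasureTheory Filter

noncomputable section

/-- Euclidean space `ℝ^d`. -/
abbrev Euc (d : ℕ) : Type := EuclideanSpace ℝ (Fin d)

/-- The Hilbert kernel weight `w_i(x) = ‖x−x_i‖^{−d} / Σ_j ‖x−x_j‖^{−d}`
for sample points `xs : Fin (n+1) → ℝ^d`. -/
def hilbertWeight (d n : ℕ) (x : Euc d) (xs : Fin (n + 1) → Euc d) (i : Fin (n + 1)) : ℝ :=
  ‖x - xs i‖ ^ (-(d : ℝ)) / ∑ j : Fin (n + 1), ‖x - xs j‖ ^ (-(d : ℝ))

/-- The volume `V_d = π^{d/2}/Γ(d/2+1)` of the unit ball in `ℝ^d`. -/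
def unitBallVol (d : ℕ) : ℝ := Real.pi ^ ((d : ℝ) / 2) / Real.Gamma ((d : ℝ) / 2 + 1)
/-- The bias term `B(x) = E[(Σ_i w_i(x)·(f(X_i)−f(x)))²]` of the Hilbert kernel regression
estimator, expressed as an integral against the product density `∏ ρ(x_i)`. -/
def hilbertBias (d n : ℕ) (x : Euc d) (ρ f : Euc d → ℝ) : ℝ :=
  ∫ xs : Fin (n + 1) → Euc d,
    (∑ i : Fin (n + 1), hilbertWeight d n x xs i * (f (xs i) - f x)) ^ 2 *
      ∏ i : Fin (n + 1), ρ (xs i)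

lemma hk_gamma_integrable {s r : ℝ} (hs : 0 < s) (hr : 0 < r) :
    IntegrableOn (fun t : ℝ => t ^ (s - 1) * Real.exp (-(r * t))) (Set.Ioi 0) := by
  have := integrableOn_rpow_mul_exp_neg_mul_rpow (p := 1) (s := s - 1) (b := r) (by linarith)
    one_pos hr
  simpa [Real.rpow_one, neg_mul] using this

lemma hk_gamma_lint {s r : ℝ} (hs : 0 < s) (hr : 0 < r) :
    ∫⁻ t in Set.Ioi (0:ℝ), ENNReal.ofReal (t ^ (s - 1) * Real.exp (-(r * t))) =
      ENNReal.ofReal ((1 / r) ^ s * Real.Gamma s) := by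
  rw [← Real.integral_rpow_mul_exp_neg_mul_Ioi hs hr]
  rw [ofReal_integral_eq_lintegral_ofReal (hk_gamma_integrable hs hr)]
  filter_upwards [self_mem_ae_restrict measurableSet_Ioi] with t ht
  have : (0:ℝ) < t := ht
  positivity

lemma hk_sq_div_le (N S : ℝ) (hS : 0 ≤ S) (P : ℝ) (hP : 0 ≤ P) :
    ENNReal.ofReal ((N / S) ^ 2 * P) ≤
      ∫⁻ t in Set.Ioi (0:ℝ), ENNReal.ofReal (t * (N ^ 2 * Real.exp (-(t * S)) * P)) := by
  rcases hS.eq_or_lt with h | h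
  · simp [← h]
  · have h2 := hk_gamma_lint (s := 2) (r := S) two_pos h
    have : ∀ t : ℝ, t * (N ^ 2 * Real.exp (-(t * S)) * P) =
        (N ^ 2 * P) * (t ^ ((2:ℝ) - 1) * Real.exp (-(S * t))) := by
      intro t
      rw [show (2:ℝ) - 1 = 1 by norm_num, Real.rpow_one, mul_comm t S]
      ring
    simp_rw [this, ENNReal.ofReal_mul (show 0 ≤ N ^ 2 * P by positivity)]
    rw [lintegral_const_mul' _ _ ENNReal.ofReal_ne_top, h2,
      ← ENNReal.ofReal_mul (by positivity)]
    apply ENNReal.ofReal_le_ofReal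
    have : Real.Gamma 2 = 1 := by
      simp
    rw [this, Real.rpow_two]
    apply le_of_eq
    field_simp

/-- Product expectation. -/
lemma hk_expect {E : Type*} [MeasureSpace E] [SigmaFinite (volume : Measure E)] (n : ℕ)
    (p u : E → ℝ) (hp : Integrable p) (hpu : Integrable (fun y => p y * u y))
    (hpuu : Integrable (fun y => p y * u y ^ 2))
    (hp0 : 0 ≤ ∫ y, p y) :
    Integrable (fun xs : Fin (n + 1) → E => (∑ i, u (xs i)) ^ 2 * ∏ i, p (xs i)) ∧
    ∫ xs : Fin (n + 1) → E, (∑ i, u (xs i)) ^ 2 * ∏ i, p (xs i) ≤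
      (n + 1) * ((∫ y, p y * u y ^ 2) * (∫ y, p y) ^ n) +
      (n + 1) ^ 2 * ((∫ y, p y * u y) ^ 2 * (∫ y, p y) ^ (n - 1)) := by
  let F : Fin (n+1) → Fin (n+1) → Fin (n+1) → E → ℝ := fun i j k y =>
    p y * ((if k = i then u y else 1) * (if k = j then u y else 1))
  have hexp : ∀ xs : Fin (n + 1) → E, (∑ i, u (xs i)) ^ 2 * ∏ i, p (xs i) =
      ∑ i, ∑ j, ∏ k, F i j k (xs k) := by
    intro xs
    rw [sq, Finset.sum_mul_sum, Finset.sum_mul]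
    refine Finset.sum_congr rfl fun i _ => ?_
    rw [Finset.sum_mul]
    refine Finset.sum_congr rfl fun j _ => ?_
    simp only [F, Finset.prod_mul_distrib]
    rw [Finset.prod_ite_eq' Finset.univ i (fun k => u (xs k)),
      Finset.prod_ite_eq' Finset.univ j (fun k => u (xs k))]
    simp [mul_comm]
  have hFi : ∀ i j k, Integrable (F i j k) := by
    intro i j k
    by_cases h1 : k = i <;> by_cases h2 : k = j
    · simpa [F, ← h1, ← h2, sq] using hpuu
    · simpa [F, ← h1, h2] using hpu
    · simpa [F, h1, ← h2] using hpu
    · simpa [F, h1, h2] using hp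
  have hprodI : ∀ i j, Integrable (fun xs : Fin (n+1) → E => ∏ k, F i j k (xs k)) := by
    intro i j
    exact Integrable.fintype_prod (hFi i j)
  simp_rw [hexp]
  refine ⟨integrable_finsetSum _ fun i _ => integrable_finsetSum _ fun j _ => hprodI i j, ?_⟩
  rw [integral_finsetSum _ (fun i _ => integrable_finsetSum _ fun j _ => hprodI i j)]
  set A := ∫ y, p y * u y ^ 2
  set h := ∫ y, p y * u y
  set φ := ∫ y, p y
  have hterm : ∀ i j, ∫ xs : Fin (n+1) → E, ∏ k, F i j k (xs k) =
      if i = j then A * φ ^ n else h ^ 2 * φ ^ (n - 1) := by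
    intro i j
    rw [integral_fintype_prod_volume_eq_prod]
    split_ifs with hij
    · subst hij
      rw [← Finset.mul_prod_erase Finset.univ _ (Finset.mem_univ i)]
      congr 1
      · simp only [F, if_true, A, sq]
      · rw [Finset.prod_eq_pow_card (b := φ)]
        · simp
        · intro k hk
          simp [F, Finset.ne_of_mem_erase hk, φ]
    · rw [← Finset.mul_prod_erase Finset.univ _ (Finset.mem_univ i),
        ← Finset.mul_prod_erase (Finset.univ.erase i) _
          (Finset.mem_erase.mpr ⟨Ne.symm hij, Finset.mem_univ j⟩), sq, mul_assoc]
      congr 1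
      · simp [F, hij, h]
      congr 1
      · simp [F, Ne.symm hij, h]
      · rw [Finset.prod_eq_pow_card (b := φ)]
        · rw [Finset.card_erase_of_mem (Finset.mem_erase.mpr ⟨Ne.symm hij, Finset.mem_univ j⟩)]
          simp
        · intro k hk
          have h1 := Finset.ne_of_mem_erase hk
          have h2 := Finset.ne_of_mem_erase (Finset.mem_of_mem_erase hk)
          simp [F, h1, h2, φ]
  have hle : ∀ i j, ∫ xs : Fin (n+1) → E, ∏ k, F i j k (xs k) ≤
      (if i = j then A * φ ^ n else 0) + h ^ 2 * φ ^ (n - 1) := by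
    intro i j
    rw [hterm]
    have : 0 ≤ h ^ 2 * φ ^ (n - 1) := by positivity
    split_ifs <;> linarith
  calc _ = ∑ i, ∑ j, ∫ xs : Fin (n+1) → E, ∏ k, F i j k (xs k) :=
        Finset.sum_congr rfl fun i _ => integral_finsetSum _ (fun j _ => hprodI i j)
    _ ≤ ∑ i : Fin (n+1), ∑ j : Fin (n+1),
        ((if i = j then A * φ ^ n else 0) + h ^ 2 * φ ^ (n - 1)) :=
        Finset.sum_le_sum fun i _ => Finset.sum_le_sum fun j _ => hle i j
    _ = _ := by
        simp only [Finset.sum_add_distrib, Finset.sum_ite_eq, Finset.mem_univ, if_true,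
          Finset.sum_const, Finset.card_univ, Fintype.card_fin, nsmul_eq_mul]
        push_cast
        ring

lemma hk_bias_le {E : Type*} [MeasureSpace E] [SigmaFinite (volume : Measure E)] (n : ℕ)
    (ρ Z g : E → ℝ) (hρm : Measurable ρ) (hZm : Measurable Z) (hgm : Measurable g)
    (hρ0 : ∀ y, 0 ≤ ρ y) (hZ0 : ∀ y, 0 ≤ Z y)
    (h0 : ∀ t : ℝ, 0 < t → Integrable (fun y => ρ y * Real.exp (-(t * Z y))))
    (h1 : ∀ t : ℝ, 0 < t → Integrable (fun y => ρ y * Real.exp (-(t * Z y)) * (Z y * g y)))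
    (h2 : ∀ t : ℝ, 0 < t → Integrable (fun y => ρ y * Real.exp (-(t * Z y)) * (Z y * g y) ^ 2)) :
    ENNReal.ofReal (∫ xs : Fin (n + 1) → E,
      ((∑ i, Z (xs i) * g (xs i)) / ∑ i, Z (xs i)) ^ 2 * ∏ i, ρ (xs i)) ≤
    ∫⁻ t in Set.Ioi (0:ℝ), ENNReal.ofReal (t *
      ((n + 1) * ((∫ y, ρ y * Real.exp (-(t * Z y)) * (Z y * g y) ^ 2) *
          (∫ y, ρ y * Real.exp (-(t * Z y))) ^ n) +
      (n + 1) ^ 2 * ((∫ y, ρ y * Real.exp (-(t * Z y)) * (Z y * g y)) ^ 2 *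
          (∫ y, ρ y * Real.exp (-(t * Z y))) ^ (n - 1)))) := by
  rw [integral_eq_lintegral_of_nonneg_ae
    (Eventually.of_forall fun xs => mul_nonneg (sq_nonneg _) (Finset.prod_nonneg fun i _ => hρ0 _))
    (Measurable.aestronglyMeasurable (by fun_prop))]
  refine ENNReal.ofReal_toReal_le.trans ?_
  calc _ ≤ ∫⁻ xs : Fin (n + 1) → E, ∫⁻ t in Set.Ioi (0:ℝ), ENNReal.ofReal
        (t * ((∑ i, Z (xs i) * g (xs i)) ^ 2 * Real.exp (-(t * ∑ i, Z (xs i))) *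
          ∏ i, ρ (xs i))) := by
        refine lintegral_mono fun xs => ?_
        exact hk_sq_div_le _ _ (Finset.sum_nonneg fun i _ => hZ0 _) _
          (Finset.prod_nonneg fun i _ => hρ0 _)
    _ = ∫⁻ t in Set.Ioi (0:ℝ), ∫⁻ xs : Fin (n + 1) → E, ENNReal.ofReal
        (t * ((∑ i, Z (xs i) * g (xs i)) ^ 2 * Real.exp (-(t * ∑ i, Z (xs i))) *
          ∏ i, ρ (xs i))) := by
        apply lintegral_lintegral_swap
        apply Measurable.aemeasurable
        simp only [Function.uncurry_def]
        fun_prop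
    _ ≤ _ := by
        refine setLIntegral_mono' measurableSet_Ioi fun t ht => ?_
        have ht : (0:ℝ) < t := ht
        obtain ⟨hI, hle⟩ := hk_expect n (fun y => ρ y * Real.exp (-(t * Z y)))
          (fun y => Z y * g y) (h0 t ht) (h1 t ht) (h2 t ht)
          (integral_nonneg fun y => mul_nonneg (hρ0 y) (Real.exp_nonneg _))
        have heq : ∀ xs : Fin (n + 1) → E,
          t * ((∑ i, Z (xs i) * g (xs i)) ^ 2 * Real.exp (-(t * ∑ i, Z (xs i))) * ∏ i, ρ (xs i))
          = t * ((∑ i, Z (xs i) * g (xs i)) ^ 2 * ∏ i, (ρ (xs i) * Real.exp (-(t * Z (xs i))))) := by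
          intro xs
          rw [Finset.prod_mul_distrib, ← Real.exp_sum, Finset.sum_neg_distrib, Finset.mul_sum]
          ring
        simp_rw [heq]
        rw [← ofReal_integral_eq_lintegral_ofReal (hI.const_mul t), integral_const_mul]
        · exact ENNReal.ofReal_le_ofReal (mul_le_mul_of_nonneg_left hle ht.le)
        · refine Eventually.of_forall fun xs => mul_nonneg ht.le (mul_nonneg (sq_nonneg _)
            (Finset.prod_nonneg fun i _ => mul_nonneg (hρ0 _) (Real.exp_nonneg _)))

lemma hk_tail_finite (φ : ℝ → ℝ) (h0 : ∀ t, 0 < t → 0 ≤ φ t) (h1 : ∀ t, 0 < t → φ t ≤ 1)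
    {C γ s : ℝ} (hγ : 0 < γ) (hs : 0 < s) (hC : ∀ t, 0 < t → φ t ≤ C * t ^ (-γ)) :
    ∃ k : ℕ, ∫⁻ t in Set.Ioi (0:ℝ), ENNReal.ofReal (t ^ (s - 1) * φ t ^ k) < ⊤ := by
  obtain ⟨k, hk⟩ := exists_nat_gt (s / γ)
  have hk' : s < k * γ := by rwa [div_lt_iff₀ hγ] at hk
  refine ⟨k, ?_⟩
  rw [← Set.Ioc_union_Ioi_eq_Ioi (zero_le_one' ℝ)]
  refine (lintegral_union_le _ _ _).trans_lt (ENNReal.add_lt_top.mpr ⟨?_, ?_⟩)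
  · have hI : IntegrableOn (fun t : ℝ => t ^ (s - 1)) (Set.Ioc 0 1) :=
      (intervalIntegrable_iff_integrableOn_Ioc_of_le zero_le_one).mp
        (intervalIntegral.intervalIntegrable_rpow' (by linarith))
    refine lt_of_le_of_lt ?_ hI.lintegral_lt_top
    refine setLIntegral_mono' measurableSet_Ioc fun t ht => ENNReal.ofReal_le_ofReal ?_
    have := Real.rpow_nonneg ht.1.le (s - 1)
    exact mul_le_of_le_one_right this (pow_le_one₀ (h0 t ht.1) (h1 t ht.1))
  · have hI : IntegrableOn (fun t : ℝ => C ^ k * t ^ (s - 1 - k * γ)) (Set.Ioi 1) :=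
      (integrableOn_Ioi_rpow_of_lt (by linarith) one_pos).const_mul _
    refine lt_of_le_of_lt ?_ hI.lintegral_lt_top
    refine setLIntegral_mono' measurableSet_Ioi fun t ht => ENNReal.ofReal_le_ofReal ?_
    have ht0 : (0:ℝ) < t := one_pos.trans ht
    have h2 : φ t ^ k ≤ (C * t ^ (-γ)) ^ k := pow_le_pow_left₀ (h0 t ht0) (hC t ht0) k
    have := Real.rpow_nonneg ht0.le (s - 1)
    calc t ^ (s - 1) * φ t ^ k ≤ t ^ (s - 1) * (C * t ^ (-γ)) ^ k :=
          mul_le_mul_of_nonneg_left h2 this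
      _ = C ^ k * t ^ (s - 1 - k * γ) := by
          rw [mul_pow, ← Real.rpow_natCast (t ^ (-γ)), ← Real.rpow_mul ht0.le, mul_left_comm,
            ← Real.rpow_add ht0]
          congr 2; ring

lemma hk_laplace (φ : ℝ → ℝ) (h0 : ∀ t, 0 < t → 0 ≤ φ t) (h1 : ∀ t, 0 < t → φ t ≤ 1)
    (hanti : ∀ a b, 0 < a → a ≤ b → φ b ≤ φ a)
    {C γ s c t0 : ℝ} (hγ : 0 < γ) (hs : 0 < s) (hC : ∀ t, 0 < t → φ t ≤ C * t ^ (-γ))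
    (hc : 0 < c) (ht0 : 0 < t0)
    (hφ : ∀ t, 0 < t → t ≤ t0 → φ t ≤ Real.exp (c * t * Real.log t)) :
    ∃ C' : ℝ, 0 ≤ C' ∧ ∀ᶠ n : ℕ in atTop,
      ∫⁻ t in Set.Ioi (0:ℝ), ENNReal.ofReal (t ^ (s - 1) * φ t ^ (n - 1)) ≤
        ENNReal.ofReal (C' * (n * Real.log n) ^ (-s)) := by
  obtain ⟨k, hJ⟩ := hk_tail_finite φ h0 h1 hγ hs hC
  set J := ∫⁻ t in Set.Ioi (0:ℝ), ENNReal.ofReal (t ^ (s - 1) * φ t ^ k) with hJdef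
  refine ⟨(4 / c) ^ s * Real.Gamma s + J.toReal, by positivity, ?_⟩
  have hsq : Tendsto (fun n : ℕ => Real.sqrt n) atTop atTop :=
    Real.tendsto_sqrt_atTop.comp tendsto_natCast_atTop_atTop
  have hlog : Tendsto (fun n : ℕ => Real.log n) atTop atTop :=
    Real.tendsto_log_atTop.comp tendsto_natCast_atTop_atTop
  have hexp : Tendsto (fun n : ℕ => Real.sqrt n ^ (4 * s) * Real.exp (-(c / 4) * Real.sqrt n))
      atTop (nhds 0) :=
    (tendsto_rpow_mul_exp_neg_mul_atTop_nhds_zero (4 * s) (c / 4) (by positivity)).comp hsq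
  filter_upwards [hexp.eventually_le_const one_pos, hlog.eventually_ge_atTop 1,
    hsq.eventually_ge_atTop (1 / t0), eventually_ge_atTop (2 * (k + 1) + 2)] with n hn1 hn2 hn3 hn4
  have hnpos : (0:ℝ) < n := by
    have : 0 < n := by omega
    exact_mod_cast this
  set q := Real.sqrt n with hq
  have hqpos : 0 < q := Real.sqrt_pos.mpr hnpos
  have hqq : q * q = n := Real.mul_self_sqrt hnpos.le
  have hn1' : ((n - 1 : ℕ) : ℝ) ≥ n / 2 := by
    rw [Nat.cast_sub (by omega)]
    have : (2:ℝ) ≤ n := by exact_mod_cast (by omega : 2 ≤ n)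
    push_cast; linarith
  have hn1k : ((n - 1 - k : ℕ) : ℝ) ≥ n / 2 := by
    rw [Nat.sub_sub, Nat.cast_sub (by omega)]
    have : ((2 * (k + 1) + 2 : ℕ) : ℝ) ≤ n := by exact_mod_cast hn4
    push_cast at this ⊢; linarith
  set L := (n:ℝ) * Real.log n with hL
  have hLpos : 0 < L := by positivity
  have hlogq : Real.log q = Real.log n / 2 := by
    rw [hq, Real.log_sqrt hnpos.le]
  have hτ : 1 / q ≤ t0 := by
    rw [div_le_iff₀ hqpos]; rw [div_le_iff₀ ht0] at hn3; linarith
  have hφτ : φ (1 / q) ≤ Real.exp (-(c / (2 * q))) := by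
    refine (hφ _ (by positivity) hτ).trans (Real.exp_le_exp.mpr ?_)
    rw [one_div, Real.log_inv, hlogq]
    have : c * q⁻¹ * -(Real.log n / 2) = -(c / (2 * q)) * Real.log n := by
      field_simp
    rw [this]
    have : 0 < c / (2 * q) := by positivity
    nlinarith
  have hpt : ∀ t ∈ Set.Ioi (0:ℝ), ENNReal.ofReal (t ^ (s - 1) * φ t ^ (n - 1)) ≤
      ENNReal.ofReal (t ^ (s - 1) * Real.exp (-((c / 4 * L) * t))) +
      ENNReal.ofReal (Real.exp (-(c / 4) * q)) * ENNReal.ofReal (t ^ (s - 1) * φ t ^ k) := by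
    intro t ht
    have ht : (0:ℝ) < t := ht
    have hts : 0 ≤ t ^ (s - 1) := Real.rpow_nonneg ht.le _
    rcases le_total t (1 / q) with h | h
    · refine le_trans (ENNReal.ofReal_le_ofReal ?_) le_self_add
      refine mul_le_mul_of_nonneg_left ?_ hts
      have h3 := pow_le_pow_left₀ (h0 t ht) (hφ t ht (h.trans hτ)) (n - 1)
      refine h3.trans ?_
      rw [← Real.exp_nat_mul]
      apply Real.exp_le_exp.mpr
      have hlt : Real.log t ≤ -(Real.log n / 2) := by
        have := Real.log_le_log ht h
        rwa [one_div, Real.log_inv, hlogq] at this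
      have h5 : (n:ℝ) / 2 * (Real.log n / 2) ≤ ((n - 1 : ℕ) : ℝ) * (-Real.log t) :=
        mul_le_mul hn1' (by linarith) (by positivity) (by positivity)
      have h6 := mul_le_mul_of_nonneg_left h5 (show 0 ≤ c * t by positivity)
      rw [hL]
      nlinarith
    · refine le_trans ?_ le_add_self
      rw [← ENNReal.ofReal_mul (Real.exp_nonneg _)]
      apply ENNReal.ofReal_le_ofReal
      have h3 : φ t ≤ Real.exp (-(c / (2 * q))) := (hanti _ _ (by positivity) h).trans hφτ
      have h4 := pow_le_pow_left₀ (h0 t ht) h3 (n - 1 - k)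
      rw [← Real.exp_nat_mul] at h4
      have h5 : ((n - 1 - k : ℕ) : ℝ) * (-(c / (2 * q))) ≤ -(c / 4) * q := by
        have h6 := mul_le_mul_of_nonneg_right hn1k (show 0 ≤ c / (2 * q) by positivity)
        have h7 : (n:ℝ) / 2 * (c / (2 * q)) = c / 4 * q := by
          rw [← hqq]; field_simp; ring
        linarith
      have h6 := h4.trans (Real.exp_le_exp.mpr h5)
      have h7 : φ t ^ (n - 1) = φ t ^ (n - 1 - k) * φ t ^ k := by
        rw [← pow_add]; congr 1; omega
      rw [h7]
      have := mul_le_mul_of_nonneg_right h6 (mul_nonneg hts (pow_nonneg (h0 t ht) k))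
      linarith
  refine (setLIntegral_mono' measurableSet_Ioi hpt).trans ?_
  rw [lintegral_add_left (by fun_prop), lintegral_const_mul' _ _ ENNReal.ofReal_ne_top, ← hJdef,
    hk_gamma_lint hs (by positivity), ← ENNReal.ofReal_toReal hJ.ne,
    ← ENNReal.ofReal_mul (Real.exp_nonneg _), ENNReal.toReal_ofReal ENNReal.toReal_nonneg,
    ← ENNReal.ofReal_add (by positivity) (by positivity)]
  apply ENNReal.ofReal_le_ofReal
  rw [add_mul]
  apply add_le_add
  · apply le_of_eq
    rw [show 1 / (c / 4 * L) = (4 / c) * L⁻¹ by field_simp,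
      Real.mul_rpow (by positivity) (by positivity), Real.inv_rpow hLpos.le,
      Real.rpow_neg hLpos.le]
    ring
  · rw [mul_comm]
    refine mul_le_mul_of_nonneg_left ?_ ENNReal.toReal_nonneg
    have hlogn : Real.log n ≤ n := (Real.log_le_sub_one_of_pos hnpos).trans (by linarith)
    have h8 : L ^ s ≤ q ^ (4 * s) := by
      rw [Real.rpow_mul hqpos.le]
      apply Real.rpow_le_rpow hLpos.le _ hs.le
      rw [show (4:ℝ) = ((4:ℕ):ℝ) by norm_num, Real.rpow_natCast,
        show q ^ 4 = (q * q) * (q * q) by ring, hqq]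
      exact mul_le_mul_of_nonneg_left hlogn hnpos.le
    rw [Real.rpow_neg hLpos.le, ← one_div, le_div_iff₀ (by positivity)]
    have := mul_le_mul_of_nonneg_right h8 (Real.exp_nonneg (-(c / 4) * q))
    linarith

/-- Surface constant. -/
def hkD (d : ℕ) : ℝ := d * (volume : Measure (Euc d)).real (Metric.ball 0 1)

lemma hkD_pos {d : ℕ} (hd : 1 ≤ d) : 0 < hkD d := by
  unfold hkD
  have h1 : (0:ℝ) < d := by exact_mod_cast hd
  have h2 : 0 < (volume : Measure (Euc d)).real (Metric.ball 0 1) :=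
    ENNReal.toReal_pos (Metric.measure_ball_pos _ _ one_pos).ne' measure_ball_lt_top.ne
  positivity

lemma hk_radial {d : ℕ} (hd : 1 ≤ d) (x : Euc d) (T : Set ℝ) (hT : MeasurableSet T)
    (hT0 : T ⊆ Set.Ioi 0) (p : ℝ) (hI : IntegrableOn (fun r : ℝ => r ^ (p - 1)) T) :
    Integrable (fun y : Euc d => T.indicator (fun r : ℝ => r ^ (p - d)) ‖x - y‖) ∧
    ∫ y : Euc d, T.indicator (fun r : ℝ => r ^ (p - d)) ‖x - y‖ =
      hkD d * ∫ r in T, r ^ (p - 1) := by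
  have : Nonempty (Fin d) := ⟨⟨0, hd⟩⟩
  set F : ℝ → ℝ := T.indicator (fun r : ℝ => r ^ (p - d)) with hF
  have heq : ∀ r ∈ Set.Ioi (0:ℝ), r ^ (Module.finrank ℝ (Euc d) - 1) • F r =
      T.indicator (fun r : ℝ => r ^ (p - 1)) r := by
    intro r hr
    by_cases h : r ∈ T
    · rw [hF, Set.indicator_of_mem h, Set.indicator_of_mem h, smul_eq_mul, ← Real.rpow_natCast,
        ← Real.rpow_add hr, finrank_euclideanSpace_fin, Nat.cast_sub hd]
      congr 1; push_cast; ring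
    · rw [hF, Set.indicator_of_notMem h, Set.indicator_of_notMem h, smul_zero]
  have h1 : Integrable (fun y : Euc d => F ‖y‖) := by
    rw [integrable_fun_norm_addHaar (volume : Measure (Euc d)),
      integrableOn_congr_fun heq measurableSet_Ioi]
    rw [IntegrableOn, integrable_indicator_iff hT]
    exact hI.mono_measure Measure.restrict_le_self
  refine ⟨h1.comp_sub_left x, ?_⟩
  rw [integral_sub_left_eq_self (fun y : Euc d => F ‖y‖) volume x,
    integral_fun_norm_addHaar (volume : Measure (Euc d)),
    setIntegral_congr_fun measurableSet_Ioi heq, setIntegral_indicator hT,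
    Set.inter_eq_right.mpr hT0, finrank_euclideanSpace_fin]
  simp [hkD, mul_assoc]

lemma hk_R1 {d : ℕ} (hd : 1 ≤ d) (x : Euc d) {R p : ℝ} (hR : 0 ≤ R) (hp : 0 < p) :
    Integrable (fun y : Euc d => (Set.Ioc 0 R).indicator (fun r : ℝ => r ^ (p - d)) ‖x - y‖) ∧
    ∫ y : Euc d, (Set.Ioc 0 R).indicator (fun r : ℝ => r ^ (p - d)) ‖x - y‖ =
      hkD d * (R ^ p / p) := by
  have h := hk_radial hd x (Set.Ioc 0 R) measurableSet_Ioc (fun r hr => hr.1) p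
    ((intervalIntegrable_iff_integrableOn_Ioc_of_le hR).mp
        (intervalIntegral.intervalIntegrable_rpow' (by linarith)))
  refine ⟨h.1, h.2.trans ?_⟩
  rw [← intervalIntegral.integral_of_le hR, integral_rpow (Or.inl (by linarith))]
  simp [Real.zero_rpow hp.ne']

lemma hk_R2 {d : ℕ} (hd : 1 ≤ d) (x : Euc d) {R p : ℝ} (hR : 0 < R) (hp : p < 0) :
    Integrable (fun y : Euc d => (Set.Ioi R).indicator (fun r : ℝ => r ^ (p - d)) ‖x - y‖) ∧
    ∫ y : Euc d, (Set.Ioi R).indicator (fun r : ℝ => r ^ (p - d)) ‖x - y‖ =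
      hkD d * (R ^ p / (-p)) := by
  have h := hk_radial hd x (Set.Ioi R) measurableSet_Ioi (fun r hr => hR.trans hr) p
    (integrableOn_Ioi_rpow_of_lt (by linarith) hR)
  refine ⟨h.1, h.2.trans ?_⟩
  rw [integral_Ioi_rpow_of_lt (by linarith) hR]
  simp [div_neg, neg_div]

lemma hk_R3 {d : ℕ} (hd : 1 ≤ d) (x : Euc d) {R R' : ℝ} (hR : 0 < R) (hR' : R ≤ R') :
    Integrable (fun y : Euc d => (Set.Ioc R R').indicator (fun r : ℝ => r ^ (-(d:ℝ))) ‖x - y‖) ∧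
    ∫ y : Euc d, (Set.Ioc R R').indicator (fun r : ℝ => r ^ (-(d:ℝ))) ‖x - y‖ =
      hkD d * Real.log (R' / R) := by
  have h := hk_radial hd x (Set.Ioc R R') measurableSet_Ioc (fun r hr => hR.trans hr.1) 0
    ((intervalIntegrable_iff_integrableOn_Ioc_of_le hR').mp
        (intervalIntegral.intervalIntegrable_rpow (Or.inr (by
          rw [Set.uIcc_of_le hR']; exact fun h => absurd h.1 (not_le.mpr hR)))))
  simp only [zero_sub] at h
  refine ⟨h.1, h.2.trans ?_⟩
  rw [← intervalIntegral.integral_of_le hR']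
  simp_rw [Real.rpow_neg_one]
  rw [integral_inv_of_pos hR (hR.trans_le hR')]

lemma hk_exp_le_half {u : ℝ} (h0 : 0 ≤ u) (h1 : u ≤ 1) : u / 2 ≤ 1 - Real.exp (-u) := by
  have h2 := Real.add_one_le_exp u
  have h3 : Real.exp (-u) * Real.exp u = 1 := by rw [← Real.exp_add]; simp
  have h4 := Real.exp_pos (-u)
  nlinarith [mul_le_mul_of_nonneg_left h2 h4.le]

lemma hk_exp_le_sq {u : ℝ} (h0 : 0 ≤ u) : u ^ 2 * Real.exp (-u) ≤ 2 := by
  have h2 := Real.quadratic_le_exp_of_nonneg h0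
  have h3 : Real.exp (-u) * Real.exp u = 1 := by rw [← Real.exp_add]; simp
  have h4 := Real.exp_pos (-u)
  nlinarith [mul_le_mul_of_nonneg_left h2 h4.le]

lemma hk_exp_le_rpow {u p : ℝ} (h0 : 0 < u) (hp : 0 ≤ p) (hp2 : p ≤ 2) :
    Real.exp (-u) ≤ 2 * u ^ (-p) := by
  have h1 : u ^ p ≤ 1 + u ^ 2 := by
    rcases le_total u 1 with h | h
    · have := Real.rpow_le_one h0.le h hp
      nlinarith [sq_nonneg u]
    · have := Real.rpow_le_rpow_of_exponent_le h hp2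
      rw [Real.rpow_two] at this
      linarith
  have h2 := Real.quadratic_le_exp_of_nonneg h0.le
  have h5 : u ^ p ≤ 2 * Real.exp u := by nlinarith
  rw [Real.rpow_neg h0.le, Real.exp_neg, ← div_eq_mul_inv, inv_eq_one_div,
    div_le_div_iff₀ (Real.exp_pos _) (by positivity)]
  linarith

lemma hk_ae_pos {d : ℕ} (hd : 1 ≤ d) (x : Euc d) : ∀ᵐ y : Euc d, 0 < ‖x - y‖ := by
  have : Nonempty (Fin d) := ⟨⟨0, hd⟩⟩
  have h : ∀ᵐ y : Euc d, y ≠ x := by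
    simp [ae_iff, measure_singleton]
  filter_upwards [h] with y hy
  exact norm_pos_iff.mpr (sub_ne_zero.mpr hy.symm)

lemma hk_phi_int {d : ℕ} (x : Euc d) (ρ : Euc d → ℝ) (hρ0 : ∀ y, 0 ≤ ρ y)
    (hρi : Integrable ρ) {t : ℝ} (ht : 0 < t) :
    Integrable (fun y => ρ y * Real.exp (-(t * ‖x - y‖ ^ (-(d:ℝ))))) := by
  refine hρi.mul_bdd (c := 1) (Measurable.aestronglyMeasurable (by fun_prop))
    (Eventually.of_forall fun y => ?_)
  rw [Real.norm_of_nonneg (Real.exp_nonneg _)]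
  apply Real.exp_le_one_iff.mpr
  have : 0 ≤ ‖x - y‖ ^ (-(d:ℝ)) := Real.rpow_nonneg (norm_nonneg _) _
  nlinarith

lemma hk_phi_decay {d : ℕ} (hd : 1 ≤ d) (x : Euc d) (ρ : Euc d → ℝ) (hρ0 : ∀ y, 0 ≤ ρ y)
    (hρi : Integrable ρ) (hv : Integrable (fun y => ρ y * ‖x - y‖ ^ 2)) {t : ℝ} (ht : 0 < t) :
    ∫ y, ρ y * Real.exp (-(t * ‖x - y‖ ^ (-(d:ℝ)))) ≤
      (2 * ∫ y, ρ y * ‖x - y‖ ^ 2) * t ^ (-(2 / (d:ℝ))) := by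
  have hd' : (1:ℝ) ≤ d := by exact_mod_cast hd
  calc _ ≤ ∫ y, (2 * t ^ (-(2 / (d:ℝ)))) * (ρ y * ‖x - y‖ ^ 2) := by
        refine integral_mono_ae (hk_phi_int x ρ hρ0 hρi ht) (hv.const_mul _) ?_
        filter_upwards [hk_ae_pos hd x] with y hy
        have h1 : 0 < ‖x - y‖ ^ (-(d:ℝ)) := Real.rpow_pos_of_pos hy _
        have h2 := hk_exp_le_rpow (u := t * ‖x - y‖ ^ (-(d:ℝ))) (p := 2 / d) (by positivity)
          (by positivity) (by rw [div_le_iff₀ (by linarith)]; linarith)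
        rw [Real.mul_rpow ht.le h1.le, ← Real.rpow_mul hy.le,
          show -(d:ℝ) * -(2 / d) = 2 by field_simp, Real.rpow_two] at h2
        have := mul_le_mul_of_nonneg_left h2 (hρ0 y)
        show ρ y * Real.exp (-(t * ‖x - y‖ ^ (-(d:ℝ)))) ≤ _
        linarith
    _ = _ := by rw [integral_const_mul]; ring

lemma hk_phi_small {d : ℕ} (hd : 1 ≤ d) (x : Euc d) (ρ : Euc d → ℝ) (hρ0 : ∀ y, 0 ≤ ρ y)
    (hρi : Integrable ρ) (hρ1 : ∫ y, ρ y = 1) {r0 m : ℝ} (hr0 : 0 < r0) (hr1 : r0 ≤ 1) (hm : 0 < m)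
    (hρm : ∀ y, ‖x - y‖ ≤ r0 → m ≤ ρ y) :
    ∃ c t0 : ℝ, 0 < c ∧ 0 < t0 ∧ ∀ t, 0 < t → t ≤ t0 →
      ∫ y, ρ y * Real.exp (-(t * ‖x - y‖ ^ (-(d:ℝ)))) ≤ Real.exp (c * t * Real.log t) := by
  have hd' : (1:ℝ) ≤ d := by exact_mod_cast hd
  have hD := hkD_pos hd
  refine ⟨m / 2 * hkD d / (2 * d), r0 ^ (2 * (d:ℝ)), by positivity, by positivity, ?_⟩
  intro t ht htt
  set R := t ^ (1 / (d:ℝ)) with hR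
  have hRpos : 0 < R := by positivity
  have hRd : R ^ (-(d:ℝ)) = t⁻¹ := by
    rw [hR, ← Real.rpow_mul ht.le, show 1 / (d:ℝ) * -d = -1 by field_simp, Real.rpow_neg_one]
  have hlogr : Real.log t ≤ 2 * d * Real.log r0 := by
    rw [← Real.log_rpow hr0]; exact Real.log_le_log ht htt
  have hlogR : Real.log R = 1 / d * Real.log t := Real.log_rpow ht _
  have hlogr0 : Real.log r0 ≤ 0 := Real.log_nonpos hr0.le hr1
  have hRr : R ≤ r0 := by
    rw [← Real.log_le_log_iff hRpos hr0, hlogR, one_div, inv_mul_le_iff₀ (by linarith)]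
    nlinarith
  obtain ⟨hI, hint⟩ := hk_R3 hd x hRpos hRr
  have hφi := hk_phi_int x ρ hρ0 hρi ht
  have hle : ∫ y, (m / 2 * t) * (Set.Ioc R r0).indicator (fun r : ℝ => r ^ (-(d:ℝ))) ‖x - y‖ ≤
      ∫ y, (ρ y - ρ y * Real.exp (-(t * ‖x - y‖ ^ (-(d:ℝ))))) := by
    refine integral_mono (hI.const_mul _) (hρi.sub hφi) fun y => ?_
    show (m / 2 * t) * (Set.Ioc R r0).indicator (fun r : ℝ => r ^ (-(d:ℝ))) ‖x - y‖ ≤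
      ρ y - ρ y * Real.exp (-(t * ‖x - y‖ ^ (-(d:ℝ))))
    have hZ0 : 0 ≤ ‖x - y‖ ^ (-(d:ℝ)) := Real.rpow_nonneg (norm_nonneg _) _
    by_cases h : ‖x - y‖ ∈ Set.Ioc R r0
    · rw [Set.indicator_of_mem h]
      have h1 : ‖x - y‖ ^ (-(d:ℝ)) ≤ t⁻¹ := by
        rw [← hRd]
        exact Real.rpow_le_rpow_of_nonpos hRpos h.1.le (by linarith)
      have h2 : t * ‖x - y‖ ^ (-(d:ℝ)) ≤ 1 := by
        calc _ ≤ t * t⁻¹ := mul_le_mul_of_nonneg_left h1 ht.le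
          _ = 1 := mul_inv_cancel₀ ht.ne'
      have h3 := hk_exp_le_half (by positivity) h2
      have h4 := mul_le_mul (hρm y h.2) h3 (by positivity) (hρ0 y)
      linarith
    · rw [Set.indicator_of_notMem h]
      have : Real.exp (-(t * ‖x - y‖ ^ (-(d:ℝ)))) ≤ 1 := by
        apply Real.exp_le_one_iff.mpr; nlinarith
      nlinarith [hρ0 y]
  rw [integral_sub hρi hφi, hρ1, integral_const_mul, hint] at hle
  refine le_trans ?_ (Real.add_one_le_exp _)
  have hlog2 : -(1 / (2 * d) * Real.log t) ≤ Real.log (r0 / R) := by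
    rw [Real.log_div hr0.ne' hRpos.ne', hlogR]
    have h5 : 1 / (2 * (d:ℝ)) * Real.log t ≤ Real.log r0 := by
      rw [one_div, inv_mul_le_iff₀ (by linarith)]; exact hlogr
    have h6 : 1 / (d:ℝ) * Real.log t = 2 * (1 / (2 * d) * Real.log t) := by field_simp
    linarith
  have h7 := mul_le_mul_of_nonneg_left hlog2 (show 0 ≤ m / 2 * t * hkD d by positivity)
  have h8 : m / 2 * hkD d / (2 * d) * t * Real.log t =
    -(m / 2 * t * hkD d * -(1 / (2 * d) * Real.log t)) := by field_simp
  rw [h8]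
  linarith

/-- The far part. -/
def hkG (d : ℕ) (x : Euc d) (ρ g : Euc d → ℝ) (r0 : ℝ) (y : Euc d) : ℝ :=
  if ‖x - y‖ ≤ r0 then 0 else ρ y * (‖x - y‖ ^ (-(d:ℝ)) * g y) ^ 2

lemma hkG_nonneg {d : ℕ} {x : Euc d} {ρ g : Euc d → ℝ} (hρ0 : ∀ y, 0 ≤ ρ y) (r0 : ℝ) (y : Euc d) :
    0 ≤ hkG d x ρ g r0 y := by
  unfold hkG
  split_ifs
  · exact le_rfl
  · exact mul_nonneg (hρ0 y) (sq_nonneg _)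

lemma hk_A {d : ℕ} (hd : 1 ≤ d) (x : Euc d) (ρ g : Euc d → ℝ) (hρm : Measurable ρ)
    (hgm : Measurable g) (hρ0 : ∀ y, 0 ≤ ρ y) {r0 M K α : ℝ} (hM : 0 < M) (hK : 0 < K)
    (hρM : ∀ y, ‖x - y‖ ≤ r0 → ρ y ≤ M) (hg : ∀ y, ‖x - y‖ ≤ r0 → |g y| ≤ K * ‖x - y‖ ^ α)
    (hG : Integrable (hkG d x ρ g r0)) {t : ℝ} (ht : 0 < t)
    (W : Euc d → ℝ) (hWi : Integrable W) (hW0 : ∀ y, 0 ≤ W y)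
    (hW : ∀ y, 0 < ‖x - y‖ → ‖x - y‖ ≤ r0 → ‖x - y‖ ^ (2 * α) *
      ((‖x - y‖ ^ (-(d:ℝ))) ^ 2 * Real.exp (-(t * ‖x - y‖ ^ (-(d:ℝ))))) ≤ W y) :
    Integrable (fun y => ρ y * Real.exp (-(t * ‖x - y‖ ^ (-(d:ℝ)))) *
      (‖x - y‖ ^ (-(d:ℝ)) * g y) ^ 2) ∧
    ∫ y, ρ y * Real.exp (-(t * ‖x - y‖ ^ (-(d:ℝ)))) * (‖x - y‖ ^ (-(d:ℝ)) * g y) ^ 2 ≤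
      M * K ^ 2 * (∫ y, W y) + ∫ y, hkG d x ρ g r0 y := by
  have hdom : Integrable (fun y => M * K ^ 2 * W y + hkG d x ρ g r0 y) := (hWi.const_mul _).add hG
  have hpt : ∀ᵐ y, ρ y * Real.exp (-(t * ‖x - y‖ ^ (-(d:ℝ)))) *
      (‖x - y‖ ^ (-(d:ℝ)) * g y) ^ 2 ≤ M * K ^ 2 * W y + hkG d x ρ g r0 y := by
    filter_upwards [hk_ae_pos hd x] with y hy
    have hZ0 : 0 ≤ ‖x - y‖ ^ (-(d:ℝ)) := Real.rpow_nonneg (norm_nonneg _) _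
    by_cases h : ‖x - y‖ ≤ r0
    · have hG0 := hkG_nonneg (x := x) (g := g) hρ0 r0 y
      have h1 : g y ^ 2 ≤ K ^ 2 * ‖x - y‖ ^ (2 * α) := by
        rw [← sq_abs, mul_comm 2 α, Real.rpow_mul (norm_nonneg _), Real.rpow_two, ← mul_pow]
        exact pow_le_pow_left₀ (abs_nonneg _) (hg y h) 2
      have h2 : ρ y * g y ^ 2 ≤ M * (K ^ 2 * ‖x - y‖ ^ (2 * α)) :=
        mul_le_mul (hρM y h) h1 (sq_nonneg _) hM.le
      have h3 := mul_le_mul_of_nonneg_right h2 (show 0 ≤ (‖x - y‖ ^ (-(d:ℝ))) ^ 2 *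
        Real.exp (-(t * ‖x - y‖ ^ (-(d:ℝ)))) by positivity)
      have h4 := mul_le_mul_of_nonneg_left (hW y hy h) (show 0 ≤ M * K ^ 2 by positivity)
      nlinarith
    · have h1 : Real.exp (-(t * ‖x - y‖ ^ (-(d:ℝ)))) ≤ 1 := by
        apply Real.exp_le_one_iff.mpr; nlinarith
      have h2 : 0 ≤ M * K ^ 2 * W y := mul_nonneg (by positivity) (hW0 y)
      rw [hkG, if_neg h]
      have h3 := mul_le_mul_of_nonneg_left h1 (mul_nonneg (hρ0 y)
        (sq_nonneg (‖x - y‖ ^ (-(d:ℝ)) * g y)))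
      nlinarith
  have hI : Integrable (fun y => ρ y * Real.exp (-(t * ‖x - y‖ ^ (-(d:ℝ)))) *
      (‖x - y‖ ^ (-(d:ℝ)) * g y) ^ 2) := by
    refine hdom.mono' (Measurable.aestronglyMeasurable (by fun_prop)) ?_
    filter_upwards [hpt] with y hy
    rwa [Real.norm_of_nonneg (mul_nonneg (mul_nonneg (hρ0 y) (Real.exp_nonneg _)) (sq_nonneg _))]
  refine ⟨hI, (integral_mono_ae hI hdom hpt).trans (le_of_eq ?_)⟩
  rw [integral_add (hWi.const_mul _) hG, integral_const_mul]

lemma hk_inner {r t α : ℝ} {d : ℕ} (hr : 0 < r) (ht : 0 < t) :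
    r ^ (2 * α) * ((r ^ (-(d:ℝ))) ^ 2 * Real.exp (-(t * r ^ (-(d:ℝ))))) ≤
      2 / t ^ 2 * r ^ (2 * α + d - d) := by
  have hZ : 0 < r ^ (-(d:ℝ)) := Real.rpow_pos_of_pos hr _
  have h1 := hk_exp_le_sq (u := t * r ^ (-(d:ℝ))) (by positivity)
  rw [add_sub_cancel_right, mul_comm (2 / t ^ 2)]
  refine mul_le_mul_of_nonneg_left ?_ (by positivity)
  rw [le_div_iff₀ (by positivity)]
  nlinarith

lemma hk_outer {r t α : ℝ} {d : ℕ} (hr : 0 < r) (ht : 0 < t) :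
    r ^ (2 * α) * ((r ^ (-(d:ℝ))) ^ 2 * Real.exp (-(t * r ^ (-(d:ℝ))))) ≤
      r ^ (2 * α - d - d) := by
  have hZ : 0 < r ^ (-(d:ℝ)) := Real.rpow_pos_of_pos hr _
  have h1 : Real.exp (-(t * r ^ (-(d:ℝ)))) ≤ 1 := by
    apply Real.exp_le_one_iff.mpr; nlinarith
  have h2 : r ^ (2 * α - d - d) = r ^ (2 * α) * (r ^ (-(d:ℝ))) ^ 2 := by
    rw [sq, ← Real.rpow_add hr, ← Real.rpow_add hr]; congr 1; ring
  rw [h2, ← mul_assoc]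
  exact mul_le_of_le_one_right (by positivity) h1

lemma hk_ind_nonneg (T : Set ℝ) (hT : T ⊆ Set.Ioi 0) (p r : ℝ) :
    0 ≤ T.indicator (fun r : ℝ => r ^ p) r :=
  Set.indicator_nonneg (fun r hr => Real.rpow_nonneg (le_of_lt (hT hr)) _) r

lemma hk_A1 {d : ℕ} (hd : 1 ≤ d) (x : Euc d) (ρ g : Euc d → ℝ) (hρm : Measurable ρ)
    (hgm : Measurable g) (hρ0 : ∀ y, 0 ≤ ρ y) {r0 M K α : ℝ} (hα : 0 < α) (hM : 0 < M) (hK : 0 < K)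
    (hρM : ∀ y, ‖x - y‖ ≤ r0 → ρ y ≤ M) (hg : ∀ y, ‖x - y‖ ≤ r0 → |g y| ≤ K * ‖x - y‖ ^ α)
    (hG : Integrable (hkG d x ρ g r0)) (hαd : 2 * α < d) :
    ∃ C, 0 ≤ C ∧ ∀ t, 0 < t → Integrable (fun y => ρ y * Real.exp (-(t * ‖x - y‖ ^ (-(d:ℝ)))) *
      (‖x - y‖ ^ (-(d:ℝ)) * g y) ^ 2) ∧
    ∫ y, ρ y * Real.exp (-(t * ‖x - y‖ ^ (-(d:ℝ)))) * (‖x - y‖ ^ (-(d:ℝ)) * g y) ^ 2 ≤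
      C * (t ^ (2 * α / d - 1) + 1) := by
  have hd' : (1:ℝ) ≤ d := by exact_mod_cast hd
  have hD := hkD_pos hd
  have hGi : 0 ≤ ∫ y, hkG d x ρ g r0 y := integral_nonneg (hkG_nonneg hρ0 r0)
  set C1 := M * K ^ 2 * (2 * (hkD d / (2 * α + d)) + hkD d / (d - 2 * α)) with hC1
  have hC1p : 0 ≤ C1 := by
    have : 0 < d - 2 * α := by linarith
    positivity
  refine ⟨C1 + ∫ y, hkG d x ρ g r0 y, by positivity, fun t ht => ?_⟩
  set R := t ^ (1 / (d:ℝ)) with hR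
  have hRpos : 0 < R := by positivity
  obtain ⟨i1, e1⟩ := hk_R1 hd x (R := R) (p := 2 * α + d) hRpos.le (by positivity)
  obtain ⟨i2, e2⟩ := hk_R2 hd x (R := R) (p := 2 * α - d) hRpos (by linarith)
  obtain ⟨hI, hle⟩ := hk_A hd x ρ g hρm hgm hρ0 hM hK hρM hg hG ht
    (fun y => 2 / t ^ 2 * (Set.Ioc 0 R).indicator (fun r : ℝ => r ^ (2 * α + d - d)) ‖x - y‖ +
      (Set.Ioi R).indicator (fun r : ℝ => r ^ (2 * α - d - d)) ‖x - y‖)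
    ((i1.const_mul _).add i2)
    (fun y => add_nonneg (mul_nonneg (by positivity) (hk_ind_nonneg _ (fun r hr => hr.1) _ _))
      (hk_ind_nonneg _ (fun r hr => hRpos.trans hr) _ _))
    (by
      intro y hy _
      rcases le_or_gt ‖x - y‖ R with h | h
      · rw [Set.indicator_of_mem (show ‖x - y‖ ∈ Set.Ioc 0 R from ⟨hy, h⟩),
          Set.indicator_of_notMem (show ‖x - y‖ ∉ Set.Ioi R from not_lt.mpr h), add_zero]
        exact hk_inner hy ht
      · rw [Set.indicator_of_mem (show ‖x - y‖ ∈ Set.Ioi R from h),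
          Set.indicator_of_notMem (show ‖x - y‖ ∉ Set.Ioc 0 R from fun h' => absurd h'.2 (not_le.mpr h)),
          mul_zero, zero_add]
        exact hk_outer hy ht)
  refine ⟨hI, hle.trans ?_⟩
  rw [integral_add (i1.const_mul _) i2, integral_const_mul, e1, e2]
  have hR1 : R ^ (2 * α + d) = t ^ 2 * t ^ (2 * α / d - 1) := by
    rw [hR, ← Real.rpow_mul ht.le, ← Real.rpow_two, ← Real.rpow_add ht]
    congr 1; field_simp; ring
  have hR2 : R ^ (2 * α - d) = t ^ (2 * α / d - 1) := by
    rw [hR, ← Real.rpow_mul ht.le]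
    congr 1; field_simp
  rw [hR1, hR2]
  have hX : 0 ≤ t ^ (2 * α / d - 1) := by positivity
  set X := t ^ (2 * α / d - 1)
  have : M * K ^ 2 * (2 / t ^ 2 * (hkD d * (t ^ 2 * X / (2 * α + d))) +
      hkD d * (X / -(2 * α - d))) = C1 * X := by
    rw [hC1, neg_sub]; field_simp
  rw [this]
  nlinarith [mul_nonneg hGi hX]

lemma hk_A2 {d : ℕ} (hd : 1 ≤ d) (x : Euc d) (ρ g : Euc d → ℝ) (hρm : Measurable ρ)
    (hgm : Measurable g) (hρ0 : ∀ y, 0 ≤ ρ y) {r0 M K α : ℝ} (hr1 : r0 ≤ 1)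
    (hα : 0 < α) (hM : 0 < M) (hK : 0 < K)
    (hρM : ∀ y, ‖x - y‖ ≤ r0 → ρ y ≤ M) (hg : ∀ y, ‖x - y‖ ≤ r0 → |g y| ≤ K * ‖x - y‖ ^ α)
    (hG : Integrable (hkG d x ρ g r0)) (hαd : 2 * α = d) :
    ∃ C, 0 ≤ C ∧ ∀ t, 0 < t → Integrable (fun y => ρ y * Real.exp (-(t * ‖x - y‖ ^ (-(d:ℝ)))) *
      (‖x - y‖ ^ (-(d:ℝ)) * g y) ^ 2) ∧ ∀ q : ℝ, 1 ≤ q →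
    ∫ y, ρ y * Real.exp (-(t * ‖x - y‖ ^ (-(d:ℝ)))) * (‖x - y‖ ^ (-(d:ℝ)) * g y) ^ 2 ≤
      C * (1 + Real.log q + q ^ (-(1/2:ℝ)) * t ^ (-(1/2:ℝ))) := by
  have hd' : (1:ℝ) ≤ d := by exact_mod_cast hd
  have hD := hkD_pos hd
  have hGi : 0 ≤ ∫ y, hkG d x ρ g r0 y := integral_nonneg (hkG_nonneg hρ0 r0)
  set C1 := M * K ^ 2 * (2 * hkD d) with hC1
  have hC1p : 0 ≤ C1 := by positivity
  refine ⟨C1 + ∫ y, hkG d x ρ g r0 y, by positivity, fun t ht => ?_⟩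
  set R := t ^ (1 / (d:ℝ)) with hR
  have hRpos : 0 < R := by positivity
  obtain ⟨i1, e1⟩ := hk_R1 hd x (R := R) (p := 2 * α + d) hRpos.le (by positivity)
  obtain ⟨i2, e2⟩ := hk_R3 hd x (R := R) (R' := max R 1) hRpos (le_max_left _ _)
  obtain ⟨hI, hle⟩ := hk_A hd x ρ g hρm hgm hρ0 hM hK hρM hg hG ht
    (fun y => 2 / t ^ 2 * (Set.Ioc 0 R).indicator (fun r : ℝ => r ^ (2 * α + d - d)) ‖x - y‖ +
      (Set.Ioc R (max R 1)).indicator (fun r : ℝ => r ^ (-(d:ℝ))) ‖x - y‖)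
    ((i1.const_mul _).add i2)
    (fun y => add_nonneg (mul_nonneg (by positivity) (hk_ind_nonneg _ (fun r hr => hr.1) _ _))
      (hk_ind_nonneg _ (fun r hr => hRpos.trans hr.1) _ _))
    (by
      intro y hy hyr
      rcases le_or_gt ‖x - y‖ R with h | h
      · rw [Set.indicator_of_mem (show ‖x - y‖ ∈ Set.Ioc 0 R from ⟨hy, h⟩),
          Set.indicator_of_notMem (show ‖x - y‖ ∉ Set.Ioc R (max R 1) from
            fun h' => absurd h'.1 (not_lt.mpr h)), add_zero]
        exact hk_inner hy ht
      · rw [Set.indicator_of_mem (show ‖x - y‖ ∈ Set.Ioc R (max R 1) from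
            ⟨h, (hyr.trans hr1).trans (le_max_right _ _)⟩),
          Set.indicator_of_notMem (show ‖x - y‖ ∉ Set.Ioc 0 R from fun h' => absurd h'.2 (not_le.mpr h)),
          mul_zero, zero_add]
        have := hk_outer (α := α) (d := d) hy ht
        rwa [show 2 * α - d - d = -(d:ℝ) by linarith] at this)
  refine ⟨hI, fun q hq => hle.trans ?_⟩
  rw [integral_add (i1.const_mul _) i2, integral_const_mul, e1, e2]
  have hq0 : 0 < q := by linarith
  have hR1 : R ^ (2 * α + d) = t ^ 2 := by
    rw [hR, ← Real.rpow_mul ht.le, hαd, ← Real.rpow_two]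
    congr 1; field_simp; norm_num
  have hX : 0 ≤ q ^ (-(1/2:ℝ)) * t ^ (-(1/2:ℝ)) := by positivity
  have hlq : 0 ≤ Real.log q := Real.log_nonneg hq
  have hlog : Real.log (max R 1 / R) ≤ Real.log q + 2 * (q ^ (-(1/2:ℝ)) * t ^ (-(1/2:ℝ))) := by
    rcases le_total 1 R with h | h
    · rw [max_eq_left h, div_self hRpos.ne', Real.log_one]; positivity
    · rw [max_eq_right h, one_div, Real.log_inv, hR, Real.log_rpow ht]
      have ht1 : t ≤ 1 := by
        by_contra hc
        push Not at hc
        exact absurd h (not_le.mpr (Real.one_lt_rpow hc (by positivity)))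
      have hlt : Real.log t ≤ 0 := Real.log_nonpos ht.le ht1
      have h1 : -(1 / (d:ℝ) * Real.log t) ≤ -Real.log t := by
        have : 1 / (d:ℝ) ≤ 1 := by rw [div_le_iff₀ (by linarith)]; linarith
        nlinarith
      have h2 := Real.log_le_rpow_div (x := (q * t)⁻¹) (ε := 1/2) (by positivity) (by norm_num)
      rw [Real.log_inv, Real.log_mul hq0.ne' ht.ne', Real.inv_rpow (by positivity),
        ← Real.rpow_neg (by positivity), Real.mul_rpow hq0.le ht.le] at h2
      have h3 : q ^ (-(1/2:ℝ)) * t ^ (-(1/2:ℝ)) / (1/2) = 2 * (q ^ (-(1/2:ℝ)) * t ^ (-(1/2:ℝ))) := by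
        ring
      linarith
  rw [hR1]
  set X := q ^ (-(1/2:ℝ)) * t ^ (-(1/2:ℝ))
  have h5 : 2 / t ^ 2 * (hkD d * (t ^ 2 / (2 * α + d))) ≤ 2 * hkD d := by
    have : 2 / t ^ 2 * (hkD d * (t ^ 2 / (2 * α + d))) = 2 * hkD d / (2 * α + d) := by
      field_simp
    rw [this]
    exact div_le_self (by positivity) (by linarith)
  have h6 : M * K ^ 2 * (2 / t ^ 2 * (hkD d * (t ^ 2 / (2 * α + d))) +
      hkD d * Real.log (max R 1 / R)) ≤ M * K ^ 2 * (2 * hkD d + hkD d * (Real.log q + 2 * X)) := by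
    gcongr
  have h7 : M * K ^ 2 * (2 * hkD d + hkD d * (Real.log q + 2 * X)) ≤ C1 * (1 + Real.log q + X) := by
    rw [hC1]
    have : 0 ≤ M * K ^ 2 * hkD d * Real.log q := by positivity
    nlinarith
  nlinarith [mul_nonneg hGi hX, mul_nonneg hGi hlq]

lemma hk_A3 {d : ℕ} (hd : 1 ≤ d) (x : Euc d) (ρ g : Euc d → ℝ) (hρm : Measurable ρ)
    (hgm : Measurable g) (hρ0 : ∀ y, 0 ≤ ρ y) {r0 M K α : ℝ} (hr0 : 0 < r0) (hM : 0 < M) (hK : 0 < K)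
    (hρM : ∀ y, ‖x - y‖ ≤ r0 → ρ y ≤ M) (hg : ∀ y, ‖x - y‖ ≤ r0 → |g y| ≤ K * ‖x - y‖ ^ α)
    (hG : Integrable (hkG d x ρ g r0)) (hαd : d < 2 * α) :
    ∃ C, 0 ≤ C ∧ ∀ t, 0 < t → Integrable (fun y => ρ y * Real.exp (-(t * ‖x - y‖ ^ (-(d:ℝ)))) *
      (‖x - y‖ ^ (-(d:ℝ)) * g y) ^ 2) ∧
    ∫ y, ρ y * Real.exp (-(t * ‖x - y‖ ^ (-(d:ℝ)))) * (‖x - y‖ ^ (-(d:ℝ)) * g y) ^ 2 ≤ C := by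
  have hGi : 0 ≤ ∫ y, hkG d x ρ g r0 y := integral_nonneg (hkG_nonneg hρ0 r0)
  obtain ⟨i1, e1⟩ := hk_R1 hd x (R := r0) (p := 2 * α - d) hr0.le (by linarith)
  have hD := hkD_pos hd
  refine ⟨M * K ^ 2 * (hkD d * (r0 ^ (2 * α - d) / (2 * α - d))) + ∫ y, hkG d x ρ g r0 y, ?_,
    fun t ht => ?_⟩
  · have : 0 < 2 * α - d := by linarith
    positivity
  rw [← e1]
  exact hk_A hd x ρ g hρm hgm hρ0 hM hK hρM hg hG ht _ i1
    (fun y => hk_ind_nonneg _ (fun r hr => hr.1) _ _)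
    (by
      intro y hy h
      rw [Set.indicator_of_mem (show ‖x - y‖ ∈ Set.Ioc 0 r0 from ⟨hy, h⟩)]
      exact hk_outer hy ht)

lemma hk_h {d : ℕ} (hd : 1 ≤ d) (x : Euc d) (ρ g : Euc d → ℝ) (hρm : Measurable ρ)
    (hgm : Measurable g) (hρ0 : ∀ y, 0 ≤ ρ y) (hρi : Integrable ρ)
    {r0 M K β : ℝ} (hr0 : 0 < r0) (hβ : 0 < β) (hβd : β < d) (hM : 0 < M) (hK : 0 < K)
    (hρM : ∀ y, ‖x - y‖ ≤ r0 → ρ y ≤ M) (hg : ∀ y, ‖x - y‖ ≤ r0 → |g y| ≤ K * ‖x - y‖ ^ β)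
    (hG : Integrable (hkG d x ρ g r0))
    (hκ : ∫ y, ρ y * (‖x - y‖ ^ (-(d:ℝ)) * g y) = 0) :
    ∃ C, 0 ≤ C ∧ ∀ t, 0 < t → Integrable (fun y => ρ y * Real.exp (-(t * ‖x - y‖ ^ (-(d:ℝ)))) *
      (‖x - y‖ ^ (-(d:ℝ)) * g y)) ∧
    |∫ y, ρ y * Real.exp (-(t * ‖x - y‖ ^ (-(d:ℝ)))) * (‖x - y‖ ^ (-(d:ℝ)) * g y)| ≤
      C * (t ^ (β / d) + t) := by
  have hd' : (1:ℝ) ≤ d := by exact_mod_cast hd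
  have hD := hkD_pos hd
  have hGi : 0 ≤ ∫ y, hkG d x ρ g r0 y := integral_nonneg (hkG_nonneg hρ0 r0)
  have hρii : 0 ≤ ∫ y, ρ y := integral_nonneg hρ0
  have hnear : ∀ y, ‖x - y‖ ≤ r0 → ρ y * |g y| ≤ M * K * ‖x - y‖ ^ β := by
    intro y h
    rw [mul_assoc]
    exact mul_le_mul (hρM y h) (hg y h) (abs_nonneg _) hM.le
  have hfar : ∀ y, ¬ ‖x - y‖ ≤ r0 → ρ y * (‖x - y‖ ^ (-(d:ℝ)) * |g y|) ≤ ρ y + hkG d x ρ g r0 y := by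
    intro y h
    rw [hkG, if_neg h, ← sq_abs, abs_mul, abs_of_nonneg (Real.rpow_nonneg (norm_nonneg _) _)]
    set u := ‖x - y‖ ^ (-(d:ℝ)) * |g y|
    have : u ≤ 1 + u ^ 2 := by nlinarith [sq_nonneg (u - 1)]
    nlinarith [hρ0 y]
  have hI0 : Integrable (fun y => ρ y * (‖x - y‖ ^ (-(d:ℝ)) * g y)) := by
    obtain ⟨i1, -⟩ := hk_R1 hd x (R := r0) (p := β) hr0.le hβ
    refine ((i1.const_mul (M * K)).add (hρi.add hG)).mono'
      (Measurable.aestronglyMeasurable (by fun_prop)) ?_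
    filter_upwards [hk_ae_pos hd x] with y hy
    have hZ : 0 < ‖x - y‖ ^ (-(d:ℝ)) := Real.rpow_pos_of_pos hy _
    rw [Real.norm_eq_abs, abs_mul, abs_mul, abs_of_nonneg (hρ0 y), abs_of_pos hZ]
    simp only [Pi.add_apply]
    have hG0 := hkG_nonneg (x := x) (g := g) hρ0 r0 y
    by_cases h : ‖x - y‖ ≤ r0
    · rw [Set.indicator_of_mem (show ‖x - y‖ ∈ Set.Ioc 0 r0 from ⟨hy, h⟩), sub_eq_add_neg β,
        Real.rpow_add hy]
      have := mul_le_mul_of_nonneg_right (hnear y h) hZ.le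
      have := hρ0 y
      linarith
    · have h1 := hfar y h
      have h2 := mul_nonneg (show 0 ≤ M * K by positivity)
        (hk_ind_nonneg (Set.Ioc 0 r0) (fun r hr => hr.1) (β - d) ‖x - y‖)
      linarith
  set C1 := M * K * (hkD d / β + hkD d / (d - β)) with hC1
  have hC1p : 0 ≤ C1 := by
    have : 0 < d - β := by linarith
    positivity
  set C2 := r0 ^ (-(d:ℝ)) * ((∫ y, ρ y) + ∫ y, hkG d x ρ g r0 y) with hC2
  have hC2p : 0 ≤ C2 := by positivity
  refine ⟨C1 + C2, by positivity, fun t ht => ?_⟩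
  have hexp1 : ∀ y, |Real.exp (-(t * ‖x - y‖ ^ (-(d:ℝ)))) - 1| ≤ 1 ∧
      |Real.exp (-(t * ‖x - y‖ ^ (-(d:ℝ)))) - 1| ≤ t * ‖x - y‖ ^ (-(d:ℝ)) := by
    intro y
    have hZ0 : 0 ≤ ‖x - y‖ ^ (-(d:ℝ)) := Real.rpow_nonneg (norm_nonneg _) _
    have h1 : Real.exp (-(t * ‖x - y‖ ^ (-(d:ℝ)))) ≤ 1 := by
      apply Real.exp_le_one_iff.mpr; nlinarith
    have h2 := Real.exp_nonneg (-(t * ‖x - y‖ ^ (-(d:ℝ))))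
    have h3 := Real.add_one_le_exp (-(t * ‖x - y‖ ^ (-(d:ℝ))))
    rw [abs_of_nonpos (by linarith)]
    constructor <;> linarith
  have hI1 : Integrable (fun y => ρ y * Real.exp (-(t * ‖x - y‖ ^ (-(d:ℝ)))) *
      (‖x - y‖ ^ (-(d:ℝ)) * g y)) := by
    refine hI0.norm.mono' (Measurable.aestronglyMeasurable (by fun_prop))
      (Eventually.of_forall fun y => ?_)
    have hZ0 : 0 ≤ ‖x - y‖ ^ (-(d:ℝ)) := Real.rpow_nonneg (norm_nonneg _) _
    have h1 : Real.exp (-(t * ‖x - y‖ ^ (-(d:ℝ)))) ≤ 1 := by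
      apply Real.exp_le_one_iff.mpr; nlinarith
    rw [norm_mul, norm_mul, norm_mul (ρ y), Real.norm_of_nonneg (Real.exp_nonneg _)]
    exact mul_le_mul_of_nonneg_right (mul_le_of_le_one_right (norm_nonneg _) h1) (norm_nonneg _)
  refine ⟨hI1, ?_⟩
  set R := t ^ (1 / (d:ℝ)) with hR
  have hRpos : 0 < R := by positivity
  obtain ⟨i1, e1⟩ := hk_R1 hd x (R := R) (p := β) hRpos.le hβ
  obtain ⟨i2, e2⟩ := hk_R2 hd x (R := R) (p := β - d) hRpos (by linarith)
  have hsub : ∫ y, ρ y * Real.exp (-(t * ‖x - y‖ ^ (-(d:ℝ)))) * (‖x - y‖ ^ (-(d:ℝ)) * g y) =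
      ∫ y, (Real.exp (-(t * ‖x - y‖ ^ (-(d:ℝ)))) - 1) * (ρ y * (‖x - y‖ ^ (-(d:ℝ)) * g y)) := by
    rw [← sub_zero (∫ y, ρ y * Real.exp (-(t * ‖x - y‖ ^ (-(d:ℝ)))) * (‖x - y‖ ^ (-(d:ℝ)) * g y)),
      ← hκ, ← integral_sub hI1 hI0]
    congr 1; ext y; ring
  have iN := (i1.add (i2.const_mul t)).const_mul (M * K)
  have iF := (hρi.add hG).const_mul (t * r0 ^ (-(d:ℝ)))
  rw [hsub, ← Real.norm_eq_abs]
  refine (norm_integral_le_of_norm_le (iN.add iF) ?_).trans ?_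
  · filter_upwards [hk_ae_pos hd x] with y hy
    have hZ : 0 < ‖x - y‖ ^ (-(d:ℝ)) := Real.rpow_pos_of_pos hy _
    obtain ⟨b1, b2⟩ := hexp1 y
    simp only [Pi.add_apply, Real.norm_eq_abs]
    rw [abs_mul, abs_mul, abs_mul, abs_of_nonneg (hρ0 y), abs_of_pos hZ]
    have hG0 := hkG_nonneg (x := x) (g := g) hρ0 r0 y
    have hn1 := hk_ind_nonneg (Set.Ioc 0 R) (fun r hr => hr.1) (β - d) ‖x - y‖
    have hn2 := hk_ind_nonneg (Set.Ioi R) (fun r hr => hRpos.trans hr) (β - d - d) ‖x - y‖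
    have hu : 0 ≤ ρ y * (‖x - y‖ ^ (-(d:ℝ)) * |g y|) :=
      mul_nonneg (hρ0 y) (mul_nonneg hZ.le (abs_nonneg _))
    by_cases h : ‖x - y‖ ≤ r0
    · have hF0 : 0 ≤ t * r0 ^ (-(d:ℝ)) * (ρ y + hkG d x ρ g r0 y) :=
        mul_nonneg (by positivity) (add_nonneg (hρ0 y) hG0)
      have h1 := mul_le_mul_of_nonneg_right (hnear y h) hZ.le
      have h2 : ‖x - y‖ ^ (β - d) = ‖x - y‖ ^ β * ‖x - y‖ ^ (-(d:ℝ)) := by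
        rw [sub_eq_add_neg β, Real.rpow_add hy]
      have h3 : ‖x - y‖ ^ (β - d - d) = ‖x - y‖ ^ β * ‖x - y‖ ^ (-(d:ℝ)) * ‖x - y‖ ^ (-(d:ℝ)) := by
        rw [sub_eq_add_neg (β - d), Real.rpow_add hy, h2]
      have h1' : ρ y * (‖x - y‖ ^ (-(d:ℝ)) * |g y|) ≤
          M * K * (‖x - y‖ ^ β * ‖x - y‖ ^ (-(d:ℝ))) := by linarith
      rcases le_or_gt ‖x - y‖ R with hh | hh
      · rw [Set.indicator_of_mem (show ‖x - y‖ ∈ Set.Ioc 0 R from ⟨hy, hh⟩),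
          Set.indicator_of_notMem (show ‖x - y‖ ∉ Set.Ioi R from not_lt.mpr hh), mul_zero, add_zero,
          h2]
        have := mul_le_mul b1 h1' hu zero_le_one
        linarith
      · rw [Set.indicator_of_mem (show ‖x - y‖ ∈ Set.Ioi R from hh),
          Set.indicator_of_notMem (show ‖x - y‖ ∉ Set.Ioc 0 R from fun h' => absurd h'.2 (not_le.mpr hh)),
          zero_add, h3]
        have := mul_le_mul b2 h1' hu (by positivity)
        linarith
    · have hN0 : 0 ≤ M * K * ((Set.Ioc 0 R).indicator (fun r : ℝ => r ^ (β - d)) ‖x - y‖ +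
          t * (Set.Ioi R).indicator (fun r : ℝ => r ^ (β - d - d)) ‖x - y‖) := by positivity
      have h4 : ‖x - y‖ ^ (-(d:ℝ)) ≤ r0 ^ (-(d:ℝ)) :=
        Real.rpow_le_rpow_of_nonpos hr0 (not_le.mp h).le (by linarith)
      have h5 := b2.trans (mul_le_mul_of_nonneg_left h4 ht.le)
      have := mul_le_mul h5 (hfar y h) hu (by positivity)
      linarith
  · have e : ∫ y, ((fun y => M * K * ((fun y => (Set.Ioc 0 R).indicator (fun r : ℝ => r ^ (β - d)) ‖x - y‖) + fun y =>
          t * (Set.Ioi R).indicator (fun r : ℝ => r ^ (β - d - d)) ‖x - y‖) y) +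
        fun y => t * r0 ^ (-(d:ℝ)) * (ρ + hkG d x ρ g r0) y) y =
        M * K * (hkD d * (R ^ β / β) + t * (hkD d * (R ^ (β - d) / -(β - d)))) +
        t * r0 ^ (-(d:ℝ)) * ((∫ y, ρ y) + ∫ y, hkG d x ρ g r0 y) := by
      rw [integral_add' iN iF, integral_const_mul, integral_const_mul, integral_add' hρi hG,
        integral_add' i1 (i2.const_mul t), integral_const_mul, e1, e2]
    rw [e]
    have hR1 : R ^ β = t ^ (β / d) := by
      rw [hR, ← Real.rpow_mul ht.le]; congr 1; field_simp
    have hR2 : t * R ^ (β - d) = t ^ (β / d) := by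
      rw [hR, ← Real.rpow_mul ht.le]
      nth_rewrite 1 [← Real.rpow_one t]
      rw [← Real.rpow_add ht]
      congr 1; field_simp; ring
    have hX : 0 ≤ t ^ (β / d) := by positivity
    have e3 : M * K * (hkD d * (R ^ β / β) + t * (hkD d * (R ^ (β - d) / -(β - d)))) =
        C1 * t ^ (β / d) := by
      rw [hC1, hR1, neg_sub, ← hR2]; ring
    rw [e3]
    have e4 : t * r0 ^ (-(d:ℝ)) * ((∫ y, ρ y) + ∫ y, hkG d x ρ g r0 y) = C2 * t := by
      rw [hC2]; ring
    rw [e4]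
    nlinarith [mul_nonneg hC1p ht.le, mul_nonneg hC2p hX]

lemma hk_combine (B : ℕ → ℝ) (A : ℝ → ℝ) (h φ : ℝ → ℝ)
    (hφ0 : ∀ t, 0 < t → 0 ≤ φ t) (hφ1 : ∀ t, 0 < t → φ t ≤ 1)
    (hanti : ∀ a b, 0 < a → a ≤ b → φ b ≤ φ a)
    (hB : ∀ n : ℕ, ENNReal.ofReal (B n) ≤ ∫⁻ t in Set.Ioi (0:ℝ), ENNReal.ofReal (t *
      ((n + 1) * (A t * φ t ^ n) + (n + 1) ^ 2 * (h t ^ 2 * φ t ^ (n - 1)))))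
    (hL : ∀ s : ℝ, 0 < s → ∃ C' : ℝ, 0 ≤ C' ∧ ∀ᶠ n : ℕ in atTop,
      ∫⁻ t in Set.Ioi (0:ℝ), ENNReal.ofReal (t ^ (s - 1) * φ t ^ (n - 1)) ≤
        ENNReal.ofReal (C' * (n * Real.log n) ^ (-s)))
    {Ch b CA s1 s2 : ℝ} (hb : 0 < b) (hs1 : 0 < s1) (hs2 : 0 < s2) (hCA : 0 ≤ CA)
    (hh : ∀ t, 0 < t → |h t| ≤ Ch * (t ^ b + t))
    (e1 e2 : ℕ → ℝ) (he1 : ∀ n, 0 ≤ e1 n) (he2 : ∀ n, 0 ≤ e2 n)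
    (hA0 : ∀ t, 0 < t → 0 ≤ A t)
    (hA : ∀ t, 0 < t → ∀ n : ℕ, 1 ≤ n →
      A t ≤ CA * (e1 n * t ^ (s1 - 2) + e2 n * t ^ (s2 - 2))) :
    ∃ C, 0 ≤ C ∧ ∀ᶠ n : ℕ in atTop, B n ≤ C * (n * e1 n * (n * Real.log n) ^ (-s1) +
      n * e2 n * (n * Real.log n) ^ (-s2) + (n:ℝ) ^ 2 * (n * Real.log n) ^ (-(2 * b + 2)) +
      (n:ℝ) ^ 2 * (n * Real.log n) ^ (-(4:ℝ))) := by
  obtain ⟨C1, hC1, H1⟩ := hL s1 hs1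
  obtain ⟨C2, hC2, H2⟩ := hL s2 hs2
  obtain ⟨C3, hC3, H3⟩ := hL (2 * b + 2) (by positivity)
  obtain ⟨C4, hC4, H4⟩ := hL 4 (by positivity)
  refine ⟨2 * CA * C1 + 2 * CA * C2 + 8 * Ch ^ 2 * C3 + 8 * Ch ^ 2 * C4, by positivity, ?_⟩
  filter_upwards [H1, H2, H3, H4, eventually_ge_atTop 1] with n H1 H2 H3 H4 hn
  have hn1 : (1:ℝ) ≤ n := by exact_mod_cast hn
  have hlog : 0 ≤ Real.log n := Real.log_nonneg hn1
  have hφm : AEMeasurable φ (volume.restrict (Set.Ioi 0)) :=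
    aemeasurable_restrict_of_antitoneOn measurableSet_Ioi (fun a ha b _ hab => hanti a b ha hab)
  have hm : ∀ (k s : ℝ), AEMeasurable (fun t : ℝ => ENNReal.ofReal (k * (t ^ (s - 1) * φ t ^ (n - 1))))
      (volume.restrict (Set.Ioi 0)) := by
    intro k s
    have : AEMeasurable (fun t : ℝ => t ^ (s - 1)) (volume.restrict (Set.Ioi (0:ℝ))) :=
      Measurable.aemeasurable (by fun_prop)
    exact ((this.mul (hφm.pow_const _)).const_mul k).ennreal_ofReal
  have hint : ∀ (k s C : ℝ), 0 ≤ k →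
      ∫⁻ t in Set.Ioi (0:ℝ), ENNReal.ofReal (t ^ (s - 1) * φ t ^ (n - 1)) ≤
        ENNReal.ofReal (C * (n * Real.log n) ^ (-s)) →
      ∫⁻ t in Set.Ioi (0:ℝ), ENNReal.ofReal (k * (t ^ (s - 1) * φ t ^ (n - 1))) ≤
        ENNReal.ofReal (k * (C * (n * Real.log n) ^ (-s))) := by
    intro k s C hk H
    simp_rw [ENNReal.ofReal_mul hk]
    rw [lintegral_const_mul' _ _ ENNReal.ofReal_ne_top]
    gcongr
  set k1 := 2 * n * CA * e1 n with hk1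
  set k2 := 2 * n * CA * e2 n with hk2
  set k3 := 8 * (n:ℝ) ^ 2 * Ch ^ 2 with hk3
  have hk1p : 0 ≤ k1 := mul_nonneg (by positivity) (he1 n)
  have hk2p : 0 ≤ k2 := mul_nonneg (by positivity) (he2 n)
  have hk3p : 0 ≤ k3 := by positivity
  have hpt : ∀ t ∈ Set.Ioi (0:ℝ), ENNReal.ofReal (t *
      ((n + 1) * (A t * φ t ^ n) + (n + 1) ^ 2 * (h t ^ 2 * φ t ^ (n - 1)))) ≤
      ENNReal.ofReal (k1 * (t ^ (s1 - 1) * φ t ^ (n - 1))) +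
      (ENNReal.ofReal (k2 * (t ^ (s2 - 1) * φ t ^ (n - 1))) +
      (ENNReal.ofReal (k3 * (t ^ (2 * b + 2 - 1) * φ t ^ (n - 1))) +
      ENNReal.ofReal (k3 * (t ^ ((4:ℝ) - 1) * φ t ^ (n - 1))))) := by
    intro t ht
    have ht : 0 < t := ht
    have hp0 : 0 ≤ φ t ^ (n - 1) := pow_nonneg (hφ0 t ht) _
    set P := φ t ^ (n - 1) with hP
    have hPn : φ t ^ n ≤ P := pow_le_pow_of_le_one (hφ0 t ht) (hφ1 t ht) (Nat.sub_le _ _)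
    rw [← ENNReal.ofReal_add (by positivity) (by positivity),
      ← ENNReal.ofReal_add (by positivity) (by positivity),
      ← ENNReal.ofReal_add (by positivity) (by positivity)]
    apply ENNReal.ofReal_le_ofReal
    have q1 : t ^ (s1 - 1) = t * t ^ (s1 - 2) := by
      nth_rewrite 2 [← Real.rpow_one t]
      rw [← Real.rpow_add ht]; congr 1; ring
    have q2 : t ^ (s2 - 1) = t * t ^ (s2 - 2) := by
      nth_rewrite 2 [← Real.rpow_one t]
      rw [← Real.rpow_add ht]; congr 1; ring
    have q3 : t ^ (2 * b + 2 - 1) = t * (t ^ b) ^ 2 := by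
      nth_rewrite 2 [← Real.rpow_one t]
      rw [sq, ← Real.rpow_add ht, ← Real.rpow_add ht]; congr 1; ring
    have q4 : t ^ ((4:ℝ) - 1) = t * t ^ 2 := by
      rw [show (4:ℝ) - 1 = ((3:ℕ):ℝ) by norm_num, Real.rpow_natCast]; ring
    rw [q1, q2, q3, q4]
    have r1 : A t * φ t ^ n ≤ CA * (e1 n * t ^ (s1 - 2) + e2 n * t ^ (s2 - 2)) * P :=
      mul_le_mul (hA t ht n hn) hPn (pow_nonneg (hφ0 t ht) _) ((hA0 t ht).trans (hA t ht n hn))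
    have r2 : h t ^ 2 ≤ 2 * Ch ^ 2 * ((t ^ b) ^ 2 + t ^ 2) := by
      have : h t ^ 2 ≤ (Ch * (t ^ b + t)) ^ 2 := by
        rw [← sq_abs]; exact pow_le_pow_left₀ (abs_nonneg _) (hh t ht) 2
      nlinarith [mul_nonneg (sq_nonneg Ch) (sq_nonneg (t ^ b - t))]
    have r3 : ((n:ℝ) + 1) * (A t * φ t ^ n) ≤
        (2 * n) * (CA * (e1 n * t ^ (s1 - 2) + e2 n * t ^ (s2 - 2)) * P) :=
      mul_le_mul (by linarith) r1 (mul_nonneg (hA0 t ht) (pow_nonneg (hφ0 t ht) _)) (by positivity)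
    have r4 : ((n:ℝ) + 1) ^ 2 * (h t ^ 2 * P) ≤
        (4 * n ^ 2) * ((2 * Ch ^ 2 * ((t ^ b) ^ 2 + t ^ 2)) * P) :=
      mul_le_mul (by nlinarith) (mul_le_mul_of_nonneg_right r2 hp0) (by positivity) (by positivity)
    have r5 := mul_le_mul_of_nonneg_left (add_le_add r3 r4) ht.le
    refine r5.trans (le_of_eq ?_)
    rw [hk1, hk2, hk3]; ring
  have hfin := (hB n).trans (setLIntegral_mono' measurableSet_Ioi hpt)
  rw [lintegral_add_left' (hm _ _), lintegral_add_left' (hm _ _), lintegral_add_left' (hm _ _)] at hfin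
  have hX1 : 0 ≤ (n * Real.log n) ^ (-s1) := by positivity
  have hX2 : 0 ≤ (n * Real.log n) ^ (-s2) := by positivity
  have hX3 : 0 ≤ (n * Real.log n) ^ (-(2 * b + 2)) := by positivity
  have hX4 : 0 ≤ (n * Real.log n) ^ (-(4:ℝ)) := by positivity
  have hfin2 := hfin.trans (add_le_add (hint k1 s1 C1 hk1p H1) (add_le_add (hint k2 s2 C2 hk2p H2)
    (add_le_add (hint k3 _ C3 hk3p H3) (hint k3 4 C4 hk3p H4))))
  rw [← ENNReal.ofReal_add (by positivity) (by positivity),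
      ← ENNReal.ofReal_add (by positivity) (by positivity),
      ← ENNReal.ofReal_add (by positivity) (by positivity),
      ENNReal.ofReal_le_ofReal_iff (by positivity)] at hfin2
  refine hfin2.trans ?_
  set X1 := (n * Real.log n) ^ (-s1)
  set X2 := (n * Real.log n) ^ (-s2)
  set X3 := (n * Real.log n) ^ (-(2 * b + 2))
  set X4 := (n * Real.log n) ^ (-(4:ℝ))
  have y1 : 0 ≤ n * e1 n * X1 := mul_nonneg (mul_nonneg (by positivity) (he1 n)) hX1
  have y2 : 0 ≤ n * e2 n * X2 := mul_nonneg (mul_nonneg (by positivity) (he2 n)) hX2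
  have y3 : 0 ≤ (n:ℝ) ^ 2 * X3 := by positivity
  have y4 : 0 ≤ (n:ℝ) ^ 2 * X4 := by positivity
  rw [show k1 * (C1 * X1) = 2 * CA * C1 * (n * e1 n * X1) by rw [hk1]; ring,
    show k2 * (C2 * X2) = 2 * CA * C2 * (n * e2 n * X2) by rw [hk2]; ring,
    show k3 * (C3 * X3) = 8 * Ch ^ 2 * C3 * ((n:ℝ) ^ 2 * X3) by rw [hk3]; ring,
    show k3 * (C4 * X4) = 8 * Ch ^ 2 * C4 * ((n:ℝ) ^ 2 * X4) by rw [hk3]; ring]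
  generalize n * e1 n * X1 = Y1 at *
  generalize n * e2 n * X2 = Y2 at *
  generalize (n:ℝ) ^ 2 * X3 = Y3 at *
  generalize (n:ℝ) ^ 2 * X4 = Y4 at *
  have a1 : 0 ≤ 2 * CA * C1 := by positivity
  have a2 : 0 ≤ 2 * CA * C2 := by positivity
  have a3 : 0 ≤ 8 * Ch ^ 2 * C3 := by positivity
  have a4 : 0 ≤ 8 * Ch ^ 2 * C4 := by positivity
  generalize 2 * CA * C1 = K1 at *
  generalize 2 * CA * C2 = K2 at *
  generalize 8 * Ch ^ 2 * C3 = K3 at *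
  generalize 8 * Ch ^ 2 * C4 = K4 at *
  have : K1 * Y1 ≤ (K1 + K2 + K3 + K4) * Y1 := mul_le_mul_of_nonneg_right (by linarith) y1
  have : K2 * Y2 ≤ (K1 + K2 + K3 + K4) * Y2 := mul_le_mul_of_nonneg_right (by linarith) y2
  have : K3 * Y3 ≤ (K1 + K2 + K3 + K4) * Y3 := mul_le_mul_of_nonneg_right (by linarith) y3
  have : K4 * Y4 ≤ (K1 + K2 + K3 + K4) * Y4 := mul_le_mul_of_nonneg_right (by linarith) y4
  linarith

lemma hk_log_gain {n ℓ p : ℝ} (hn : 0 < n) (hℓ : 1 ≤ ℓ) :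
    n ^ 2 * (n * ℓ) ^ (-(p + 1)) ≤ n * (n * ℓ) ^ (-p) := by
  have hL : 0 < n * ℓ := by positivity
  have h1 : (n * ℓ) ^ (-p) = (n * ℓ) * (n * ℓ) ^ (-(p + 1)) := by
    nth_rewrite 2 [← Real.rpow_one (n * ℓ)]
    rw [← Real.rpow_add hL]; congr 1; ring
  rw [h1]
  have h2 : 0 ≤ n ^ 2 * (n * ℓ) ^ (-(p + 1)) := by positivity
  nlinarith

lemma hk_far {d : ℕ} (hd : 1 ≤ d) (x : Euc d) (ρ f : Euc d → ℝ) (hρm : Measurable ρ)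
    (hfm : Measurable f) (hρ0 : ∀ y, 0 ≤ ρ y) (hρi : Integrable ρ)
    (hf : Integrable (fun y => ρ y * f y ^ 2 / (1 + ‖y‖ ^ (2 * (d : ℝ))))) {r0 : ℝ} (hr0 : 0 < r0) :
    Integrable (hkG d x ρ (fun y => f y - f x) r0) := by
  have hd' : (1:ℝ) ≤ d := by exact_mod_cast hd
  set C1 := r0 ^ (-(2 * (d:ℝ))) + (‖x‖ / r0 + 1) ^ (2 * (d:ℝ)) with hC1
  have hC1p : 0 ≤ C1 := by positivity
  have hm : Measurable (hkG d x ρ (fun y => f y - f x) r0) := by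
    unfold hkG
    exact Measurable.ite (measurableSet_le (by fun_prop) measurable_const) measurable_const
      (by fun_prop)
  refine ((hf.const_mul (2 * C1)).add (hρi.const_mul (2 * r0 ^ (-(2 * (d:ℝ))) * f x ^ 2))).mono'
    hm.aestronglyMeasurable (Eventually.of_forall fun y => ?_)
  rw [Real.norm_of_nonneg (hkG_nonneg hρ0 r0 y)]
  simp only [Pi.add_apply]
  have hden : 0 < 1 + ‖y‖ ^ (2 * (d:ℝ)) := by positivity
  have hq : 0 ≤ ρ y * f y ^ 2 / (1 + ‖y‖ ^ (2 * (d : ℝ))) :=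
    div_nonneg (mul_nonneg (hρ0 y) (sq_nonneg _)) hden.le
  have hp : 0 ≤ 2 * r0 ^ (-(2 * (d:ℝ))) * f x ^ 2 * ρ y := mul_nonneg (by positivity) (hρ0 y)
  unfold hkG
  split_ifs with h
  · exact add_nonneg (mul_nonneg (by positivity) hq) hp
  · push Not at h
    have hr : 0 < ‖x - y‖ := hr0.trans h
    set r := ‖x - y‖ with hrdef
    have hZ2 : (r ^ (-(d:ℝ))) ^ 2 = r ^ (-(2 * (d:ℝ))) := by
      rw [sq, ← Real.rpow_add hr]; congr 1; ring
    have hZr0 : r ^ (-(2 * (d:ℝ))) ≤ r0 ^ (-(2 * (d:ℝ))) :=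
      Real.rpow_le_rpow_of_nonpos hr0 h.le (by linarith)
    have hy : ‖y‖ ≤ (‖x‖ / r0 + 1) * r := by
      have h1 : ‖y‖ ≤ ‖x‖ + r := by
        have := norm_sub_le x (x - y)
        simpa using this
      have h2 : ‖x‖ ≤ ‖x‖ / r0 * r := by
        rw [div_mul_eq_mul_div, le_div_iff₀ hr0]
        exact mul_le_mul_of_nonneg_left h.le (norm_nonneg _)
      linarith
    have hyp : ‖y‖ ^ (2 * (d:ℝ)) ≤ (‖x‖ / r0 + 1) ^ (2 * (d:ℝ)) * r ^ (2 * (d:ℝ)) := by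
      rw [← Real.mul_rpow (by positivity) hr.le]
      exact Real.rpow_le_rpow (norm_nonneg _) hy (by positivity)
    have hone : r ^ (-(2 * (d:ℝ))) * r ^ (2 * (d:ℝ)) = 1 := by
      rw [← Real.rpow_add hr]; simp
    have hZpos : 0 < r ^ (-(2 * (d:ℝ))) := Real.rpow_pos_of_pos hr _
    have hZden : r ^ (-(2 * (d:ℝ))) * (1 + ‖y‖ ^ (2 * (d:ℝ))) ≤ C1 := by
      have h3 := mul_le_mul_of_nonneg_left hyp hZpos.le
      have h4 : r ^ (-(2 * (d:ℝ))) * ((‖x‖ / r0 + 1) ^ (2 * (d:ℝ)) * r ^ (2 * (d:ℝ))) =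
          (‖x‖ / r0 + 1) ^ (2 * (d:ℝ)) := by
        rw [mul_left_comm, hone, mul_one]
      rw [hC1, mul_add, mul_one]; linarith
    have hZle : r ^ (-(2 * (d:ℝ))) * (ρ y * f y ^ 2) ≤
        C1 * (ρ y * f y ^ 2 / (1 + ‖y‖ ^ (2 * (d : ℝ)))) := by
      have h5 := mul_le_mul_of_nonneg_right hZden hq
      rwa [mul_assoc, mul_div_cancel₀ _ hden.ne'] at h5
    rw [mul_pow, hZ2]
    have h6 : (f y - f x) ^ 2 ≤ 2 * f y ^ 2 + 2 * f x ^ 2 := by nlinarith [sq_nonneg (f y + f x)]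
    have h7 := mul_le_mul_of_nonneg_left h6 (mul_nonneg (hρ0 y) hZpos.le)
    have h8 := mul_le_mul_of_nonneg_left hZr0 (mul_nonneg (hρ0 y) (sq_nonneg (f x)))
    linarith


lemma hk_core {d : ℕ} (hd : 1 ≤ d) (x : Euc d) (ρ f : Euc d → ℝ) (hρm : Measurable ρ)
    (hfm : Measurable f) (hρ0 : ∀ y, 0 ≤ ρ y) (hρ1 : ∫ y, ρ y = 1)
    (hρ_var : Integrable (fun y => ρ y * ‖y‖ ^ 2))
    (hκ : (∫ y : Euc d, ρ (x + y) * (f (x + y) - f x) / ‖y‖ ^ (d : ℝ)) = 0)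
    {r0 m M K β : ℝ} (hr0 : 0 < r0) (hr1 : r0 ≤ 1) (hβ : 0 < β) (hβd : β < d)
    (hm : 0 < m) (hM : 0 < M) (hK : 0 < K)
    (hρl : ∀ y, ‖x - y‖ ≤ r0 → m ≤ ρ y)
    (hρM : ∀ y, ‖x - y‖ ≤ r0 → ρ y ≤ M)
    (hg : ∀ y, ‖x - y‖ ≤ r0 → |f y - f x| ≤ K * ‖x - y‖ ^ β)
    (hG : Integrable (hkG d x ρ (fun y => f y - f x) r0))
    {CA s1 s2 : ℝ} (hCA : 0 ≤ CA) (hs1 : 0 < s1) (hs2 : 0 < s2) (e1 e2 : ℕ → ℝ)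
    (he1 : ∀ n, 0 ≤ e1 n) (he2 : ∀ n, 0 ≤ e2 n)
    (hA : ∀ t, 0 < t → Integrable (fun y => ρ y * Real.exp (-(t * ‖x - y‖ ^ (-(d:ℝ)))) *
        (‖x - y‖ ^ (-(d:ℝ)) * (f y - f x)) ^ 2) ∧ ∀ n : ℕ, 1 ≤ n →
      ∫ y, ρ y * Real.exp (-(t * ‖x - y‖ ^ (-(d:ℝ)))) *
        (‖x - y‖ ^ (-(d:ℝ)) * (f y - f x)) ^ 2 ≤
        CA * (e1 n * t ^ (s1 - 2) + e2 n * t ^ (s2 - 2))) :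
    ∃ C, 0 ≤ C ∧ ∀ᶠ n : ℕ in atTop, ‖hilbertBias d n x ρ f‖ ≤
      C * (n * e1 n * (n * Real.log n) ^ (-s1) +
      n * e2 n * (n * Real.log n) ^ (-s2) + (n:ℝ) ^ 2 * (n * Real.log n) ^ (-(2 * (β / d) + 2)) +
      (n:ℝ) ^ 2 * (n * Real.log n) ^ (-(4:ℝ))) := by
  have hd' : (1:ℝ) ≤ d := by exact_mod_cast hd
  have hρi : Integrable ρ := integrable_of_integral_eq_one hρ1
  have hv : Integrable (fun y => ρ y * ‖x - y‖ ^ 2) := by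
    refine ((hρi.const_mul (2 * ‖x‖ ^ 2)).add (hρ_var.const_mul 2)).mono'
      (Measurable.aestronglyMeasurable (by fun_prop)) (Eventually.of_forall fun y => ?_)
    rw [Real.norm_of_nonneg (mul_nonneg (hρ0 y) (sq_nonneg _))]
    simp only [Pi.add_apply]
    have h1 : ‖x - y‖ ^ 2 ≤ 2 * ‖x‖ ^ 2 + 2 * ‖y‖ ^ 2 := by
      have := norm_sub_le x y
      nlinarith [sq_nonneg (‖x‖ - ‖y‖), norm_nonneg (x - y), norm_nonneg x, norm_nonneg y]
    nlinarith [mul_le_mul_of_nonneg_left h1 (hρ0 y)]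
  have hκ' : ∫ y, ρ y * (‖x - y‖ ^ (-(d:ℝ)) * (f y - f x)) = 0 := by
    rw [← hκ, ← integral_add_left_eq_self _ x]
    refine integral_congr_ae (Eventually.of_forall fun y => ?_)
    have : ‖x - (x + y)‖ = ‖y‖ := by rw [sub_add_cancel_left, norm_neg]
    simp only [this]
    rw [Real.rpow_neg (norm_nonneg _)]
    ring
  have hgm : Measurable (fun y => f y - f x) := by fun_prop
  obtain ⟨Ch, hCh, hh⟩ := hk_h hd x ρ (fun y => f y - f x) hρm hgm hρ0 hρi hr0 hβ hβd hM hK hρM hg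
    hG hκ'
  obtain ⟨c, t0, hc, ht0, hsmall⟩ := hk_phi_small hd x ρ hρ0 hρi hρ1 hr0 hr1 hm hρl
  have hZ0 : ∀ y : Euc d, 0 ≤ ‖x - y‖ ^ (-(d:ℝ)) := fun y => Real.rpow_nonneg (norm_nonneg _) _
  have hφ0 : ∀ t : ℝ, 0 < t → 0 ≤ ∫ y, ρ y * Real.exp (-(t * ‖x - y‖ ^ (-(d:ℝ)))) := fun t _ =>
    integral_nonneg fun y => mul_nonneg (hρ0 y) (Real.exp_pos _).le
  have hφ1 : ∀ t : ℝ, 0 < t → ∫ y, ρ y * Real.exp (-(t * ‖x - y‖ ^ (-(d:ℝ)))) ≤ 1 := by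
    intro t ht
    rw [← hρ1]
    refine integral_mono (hk_phi_int x ρ hρ0 hρi ht) hρi fun y => ?_
    have : Real.exp (-(t * ‖x - y‖ ^ (-(d:ℝ)))) ≤ 1 := by
      rw [Real.exp_le_one_iff]
      have := mul_nonneg ht.le (hZ0 y)
      linarith
    exact mul_le_of_le_one_right (hρ0 y) this
  have hanti : ∀ a b : ℝ, 0 < a → a ≤ b → ∫ y, ρ y * Real.exp (-(b * ‖x - y‖ ^ (-(d:ℝ)))) ≤
      ∫ y, ρ y * Real.exp (-(a * ‖x - y‖ ^ (-(d:ℝ)))) := by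
    intro a b ha hab
    refine integral_mono (hk_phi_int x ρ hρ0 hρi (ha.trans_le hab)) (hk_phi_int x ρ hρ0 hρi ha)
      fun y => ?_
    have : Real.exp (-(b * ‖x - y‖ ^ (-(d:ℝ)))) ≤ Real.exp (-(a * ‖x - y‖ ^ (-(d:ℝ)))) := by
      rw [Real.exp_le_exp]
      have := mul_le_mul_of_nonneg_right hab (hZ0 y)
      linarith
    exact mul_le_mul_of_nonneg_left this (hρ0 y)
  have hbias : ∀ n, hilbertBias d n x ρ f = ∫ xs : Fin (n + 1) → Euc d,
      ((∑ i, ‖x - xs i‖ ^ (-(d:ℝ)) * (f (xs i) - f x)) / ∑ i, ‖x - xs i‖ ^ (-(d:ℝ))) ^ 2 *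
        ∏ i, ρ (xs i) := by
    intro n
    unfold hilbertBias hilbertWeight
    simp only [Finset.sum_div, div_mul_eq_mul_div]
  have hpos : ∀ n, 0 ≤ hilbertBias d n x ρ f := fun n =>
    integral_nonneg fun xs => mul_nonneg (sq_nonneg _) (Finset.prod_nonneg fun i _ => hρ0 _)
  have key := hk_combine (fun n => hilbertBias d n x ρ f)
    (fun t => ∫ y, ρ y * Real.exp (-(t * ‖x - y‖ ^ (-(d:ℝ)))) *
        (‖x - y‖ ^ (-(d:ℝ)) * (f y - f x)) ^ 2)
    (fun t => ∫ y, ρ y * Real.exp (-(t * ‖x - y‖ ^ (-(d:ℝ)))) *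
        (‖x - y‖ ^ (-(d:ℝ)) * (f y - f x)))
    (fun t => ∫ y, ρ y * Real.exp (-(t * ‖x - y‖ ^ (-(d:ℝ))))) hφ0 hφ1 hanti
    (fun n => by
      rw [hbias n]
      exact hk_bias_le n ρ (fun y => ‖x - y‖ ^ (-(d:ℝ))) (fun y => f y - f x) hρm (by fun_prop)
        hgm hρ0 hZ0 (fun t ht => hk_phi_int x ρ hρ0 hρi ht) (fun t ht => (hh t ht).1)
        (fun t ht => (hA t ht).1))
    (fun s hs => hk_laplace _ hφ0 hφ1 hanti (γ := 2 / d) (by positivity) hs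
      (fun t ht => hk_phi_decay hd x ρ hρ0 hρi hv ht) hc ht0 hsmall)
    (b := β / d) (by positivity) hs1 hs2 hCA (fun t ht => (hh t ht).2) e1 e2 he1 he2
    (fun t _ => integral_nonneg fun y => mul_nonneg (mul_nonneg (hρ0 y) (Real.exp_pos _).le)
      (sq_nonneg _))
    (fun t ht n hn => (hA t ht).2 n hn)
  obtain ⟨C, hC, H⟩ := key
  refine ⟨C, hC, ?_⟩
  filter_upwards [H] with n hn
  rw [Real.norm_of_nonneg (hpos n)]
  exact hn

lemma hk_nbhd {d : ℕ} (x : Euc d) (ρ f : Euc d → ℝ) (hx : x ∈ interior {y | 0 < ρ y})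
    (hρ_cont : ContinuousAt ρ x) (αx Kx δx : ℝ) (hδx : 0 < δx)
    (hf_holder : ∀ x', 0 < ρ x' → ‖x - x'‖ ≤ δx → |f x - f x'| ≤ Kx * ‖x - x'‖ ^ αx) :
    ∃ r0 m M : ℝ, 0 < r0 ∧ r0 ≤ 1 ∧ 0 < m ∧ 0 < M ∧ (∀ y, ‖x - y‖ ≤ r0 → m ≤ ρ y) ∧
      (∀ y, ‖x - y‖ ≤ r0 → ρ y ≤ M) ∧
      (∀ y, ‖x - y‖ ≤ r0 → |f y - f x| ≤ Kx * ‖x - y‖ ^ αx) := by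
  have hx2 : x ∈ {y | 0 < ρ y} := interior_subset hx
  have hρx : 0 < ρ x := hx2
  obtain ⟨ε, hε, H⟩ := Metric.continuousAt_iff.1 hρ_cont (ρ x / 2) (by positivity)
  have H' : ∀ y, ‖x - y‖ ≤ min (min (ε / 2) δx) 1 → |ρ y - ρ x| < ρ x / 2 := by
    intro y hy
    rw [← Real.dist_eq]
    apply H
    rw [dist_eq_norm, norm_sub_rev]
    have := hy.trans ((min_le_left _ _).trans (min_le_left _ _))
    linarith
  refine ⟨min (min (ε / 2) δx) 1, ρ x / 2, 2 * ρ x, by positivity, min_le_right _ _, by positivity,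
    by positivity, fun y hy => ?_, fun y hy => ?_, fun y hy => ?_⟩
  · have := (abs_lt.1 (H' y hy)).1; linarith
  · have := (abs_lt.1 (H' y hy)).2; linarith
  · rw [abs_sub_comm]
    refine hf_holder y ?_ (hy.trans ((min_le_left _ _).trans (min_le_right _ _)))
    have := (abs_lt.1 (H' y hy)).1; linarith

open Asymptotics in
/-- under the growth and local Hölder conditions for `f`, if
`κ(x) = ∫ ρ(x+y)·(f(x+y)−f(x))/‖y‖^d dy = 0`, then the bias term satisfies
`B(x) = O(n^{−2α/d}·(ln n)^{−1−2α/d})` if `d > 2α`, `B(x) = O(n^{−1}·(ln n)^{−1})` if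
`d = 2α`, and `B(x) = O(n^{−1}·(ln n)^{−2})` if `d < 2α`. -/
theorem hilbert_bias_bigO_kappa_zero
    (d : ℕ) (hd : 1 ≤ d)
    (ρ : Euc d → ℝ) (hρ_meas : Measurable ρ) (hρ_nonneg : ∀ y, 0 ≤ ρ y)
    (hρ_prob : (∫ y, ρ y) = 1)
    (hρ_var : Integrable (fun y => ρ y * ‖y‖ ^ 2))
    (x : Euc d) (hx : x ∈ interior {y | 0 < ρ y}) (hρ_cont : ContinuousAt ρ x)
    (f : Euc d → ℝ) (hf_meas : Measurable f)
    (hf_growth : Integrable (fun y => ρ y * f y ^ 2 / (1 + ‖y‖ ^ (2 * (d : ℝ)))))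
    (αx Kx δx : ℝ) (hαx : 0 < αx) (hKx : 0 < Kx) (hδx : 0 < δx)
    (hf_holder : ∀ x', 0 < ρ x' → ‖x - x'‖ ≤ δx → |f x - f x'| ≤ Kx * ‖x - x'‖ ^ αx)
    (hκ : (∫ y : Euc d, ρ (x + y) * (f (x + y) - f x) / ‖y‖ ^ (d : ℝ)) = 0) :
    ((2 * αx < (d : ℝ)) →
      (fun n : ℕ => hilbertBias d n x ρ f) =O[atTop]
        fun n : ℕ => (n : ℝ) ^ (-(2 * αx / (d : ℝ))) *
          Real.log n ^ (-(1 + 2 * αx / (d : ℝ)))) ∧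
    (((d : ℝ) = 2 * αx) →
      (fun n : ℕ => hilbertBias d n x ρ f) =O[atTop]
        fun n : ℕ => ((n : ℝ) * Real.log n)⁻¹) ∧
    (((d : ℝ) < 2 * αx) →
      (fun n : ℕ => hilbertBias d n x ρ f) =O[atTop]
        fun n : ℕ => ((n : ℝ) * Real.log n ^ 2)⁻¹) := by
  have hd' : (1:ℝ) ≤ d := by exact_mod_cast hd
  have hd0 : (d:ℝ) ≠ 0 := by positivity
  have hρi : Integrable ρ := integrable_of_integral_eq_one hρ_prob
  obtain ⟨r0, m, M, hr0, hr1, hm, hM, hρl, hρM, hg⟩ :=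
    hk_nbhd x ρ f hx hρ_cont αx Kx δx hδx hf_holder
  have hG := hk_far hd x ρ f hρ_meas hf_meas hρ_nonneg hρi hf_growth hr0
  have hgm : Measurable (fun y => f y - f x) := by fun_prop
  have hev : ∀ᶠ n : ℕ in atTop, (1:ℝ) ≤ n ∧ 1 ≤ Real.log n ∧ 1 ≤ (n:ℝ) * Real.log n := by
    filter_upwards [eventually_ge_atTop 1, (Real.tendsto_log_atTop.comp
      tendsto_natCast_atTop_atTop).eventually_ge_atTop (1:ℝ)] with n h1 h2
    have h1' : (1:ℝ) ≤ n := by exact_mod_cast h1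
    exact ⟨h1', h2, one_le_mul_of_one_le_of_one_le h1' h2⟩
  refine ⟨fun hlt => ?_, fun heq => ?_, fun hlt => ?_⟩
  · obtain ⟨CA, hCA, hA⟩ := hk_A1 hd x ρ (fun y => f y - f x) hρ_meas hgm hρ_nonneg hαx hM hKx hρM
      hg hG hlt
    have ha0 : 0 < 2 * αx / (d:ℝ) := by positivity
    have ha : 2 * αx / (d:ℝ) < 1 := by rw [div_lt_one (by linarith)]; exact hlt
    obtain ⟨C, hC, H⟩ := hk_core hd x ρ f hρ_meas hf_meas hρ_nonneg hρ_prob hρ_var hκ hr0 hr1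
      hαx (by linarith) hm hM hKx hρl hρM hg hG hCA (s1 := 2 * αx / d + 1) (s2 := 2)
      (by positivity) (by positivity) (fun _ => 1) (fun _ => 1) (fun _ => zero_le_one)
      (fun _ => zero_le_one) (fun t ht => ⟨(hA t ht).1, fun n _ => by
        refine (hA t ht).2.trans (le_of_eq ?_)
        rw [sub_self, Real.rpow_zero, show 2 * αx / (d:ℝ) + 1 - 2 = 2 * αx / d - 1 by ring]
        ring⟩)
    refine IsBigO.of_bound (C * 4) ?_
    filter_upwards [H, hev] with n hn ⟨hn1, hl1, hL1⟩
    have hn0 : (0:ℝ) < n := by linarith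
    have hl0 : 0 < Real.log n := by linarith
    refine hn.trans ?_
    rw [Real.norm_of_nonneg (by positivity), mul_assoc C]
    have e : (n:ℝ) ^ (-(2 * αx / (d : ℝ))) * Real.log n ^ (-(1 + 2 * αx / (d : ℝ))) =
        n * (n * Real.log n) ^ (-(2 * αx / (d:ℝ) + 1)) := by
      rw [Real.mul_rpow hn0.le hl0.le, ← mul_assoc,
        show -(2 * αx / (d:ℝ) + 1) = -(2 * αx / (d:ℝ)) - 1 by ring, Real.rpow_sub_one hn0.ne',
        mul_div_cancel₀ _ hn0.ne', show -(1 + 2 * αx / (d:ℝ)) = -(2 * αx / (d:ℝ)) - 1 by ring]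
    rw [e]
    refine mul_le_mul_of_nonneg_left ?_ hC
    have h2 : ((n:ℝ) * Real.log n) ^ (-(2:ℝ)) ≤ (n * Real.log n) ^ (-(2 * αx / (d:ℝ) + 1)) :=
      Real.rpow_le_rpow_of_exponent_le hL1 (by linarith)
    have h3 := hk_log_gain (p := 2 * αx / (d:ℝ) + 1) hn0 hl1
    rw [show 2 * αx / (d:ℝ) + 1 + 1 = 2 * (αx / d) + 2 by ring] at h3
    have h4 : ((n:ℝ) * Real.log n) ^ (-(4:ℝ)) ≤ (n * Real.log n) ^ (-(2 * (αx / (d:ℝ)) + 2)) :=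
      Real.rpow_le_rpow_of_exponent_le hL1 (by
        rw [show 2 * (αx / (d:ℝ)) = 2 * αx / d by ring]; linarith)
    have h2' := mul_le_mul_of_nonneg_left h2 hn0.le
    have h4' := mul_le_mul_of_nonneg_left h4 (sq_nonneg (n:ℝ))
    linarith
  · obtain ⟨CA, hCA, hA⟩ := hk_A2 hd x ρ (fun y => f y - f x) hρ_meas hgm hρ_nonneg hr1 hαx hM hKx
      hρM hg hG heq.symm
    obtain ⟨C, hC, H⟩ := hk_core hd x ρ f hρ_meas hf_meas hρ_nonneg hρ_prob hρ_var hκ hr0 hr1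
      hαx (by linarith) hm hM hKx hρl hρM hg hG hCA (s1 := 2) (s2 := 3 / 2)
      (by positivity) (by positivity) (fun n => 1 + Real.log n) (fun n => (n:ℝ) ^ (-(1 / 2 : ℝ)))
      (fun n => add_nonneg zero_le_one (Real.log_natCast_nonneg n))
      (fun n => by positivity) (fun t ht => ⟨(hA t ht).1, fun n hn => by
        refine ((hA t ht).2 n (by exact_mod_cast hn)).trans (le_of_eq ?_)
        rw [sub_self, Real.rpow_zero, show (3 / 2 : ℝ) - 2 = -(1 / 2) by ring]
        ring⟩)
    refine IsBigO.of_bound (C * 5) ?_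
    filter_upwards [H, hev] with n hn ⟨hn1, hl1, hL1⟩
    have hn0 : (0:ℝ) < n := by linarith
    have hl0 : 0 < Real.log n := by linarith
    refine hn.trans ?_
    rw [Real.norm_of_nonneg (by positivity), mul_assoc C]
    refine mul_le_mul_of_nonneg_left ?_ hC
    rw [show 2 * (αx / (d:ℝ)) + 2 = 2 + 1 by rw [heq]; field_simp; norm_num]
    have h3 := hk_log_gain (p := 2) hn0 hl1
    have h4 : ((n:ℝ) * Real.log n) ^ (-(4:ℝ)) ≤ (n * Real.log n) ^ (-((2:ℝ) + 1)) :=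
      Real.rpow_le_rpow_of_exponent_le hL1 (by norm_num)
    have h4' := mul_le_mul_of_nonneg_left h4 (sq_nonneg (n:ℝ))
    have h2 : ((n:ℝ) * Real.log n) ^ (-(2:ℝ)) = ((n:ℝ) * Real.log n)⁻¹ * (n * Real.log n)⁻¹ := by
      rw [Real.rpow_neg (by positivity), Real.rpow_two, sq, mul_inv]
    have hinv : (0:ℝ) < ((n:ℝ) * Real.log n)⁻¹ := by positivity
    have h5 : (n:ℝ) * Real.log n * (n * Real.log n) ^ (-(2:ℝ)) = ((n:ℝ) * Real.log n)⁻¹ := by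
      rw [h2]; field_simp
    have h6 : (n:ℝ) * (n * Real.log n) ^ (-(2:ℝ)) ≤ ((n:ℝ) * Real.log n)⁻¹ := by
      rw [← h5]
      refine mul_le_mul_of_nonneg_right ?_ (by positivity)
      exact le_mul_of_one_le_right hn0.le hl1
    have h7 : (n:ℝ) * (n:ℝ) ^ (-(1 / 2 : ℝ)) * (n * Real.log n) ^ (-(3 / 2 : ℝ)) ≤
        ((n:ℝ) * Real.log n)⁻¹ := by
      have a1 : (n:ℝ) * (n:ℝ) ^ (-(1 / 2 : ℝ)) = (n:ℝ) ^ (1 / 2 : ℝ) := by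
        rw [← Real.rpow_one_add' hn0.le (by norm_num)]; norm_num
      have a2 : ((n:ℝ) * Real.log n)⁻¹ =
          (n * Real.log n) ^ (1 / 2 : ℝ) * (n * Real.log n) ^ (-(3 / 2 : ℝ)) := by
        rw [← Real.rpow_add (by positivity), ← Real.rpow_neg_one]; norm_num
      rw [a1, a2]
      refine mul_le_mul_of_nonneg_right ?_ (by positivity)
      exact Real.rpow_le_rpow hn0.le (le_mul_of_one_le_right hn0.le hl1) (by norm_num)
    have h8 : (n:ℝ) * (1 + Real.log n) * (n * Real.log n) ^ (-(2:ℝ)) ≤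
        2 * ((n:ℝ) * Real.log n)⁻¹ := by
      calc _ = (n:ℝ) * (n * Real.log n) ^ (-(2:ℝ)) +
            (n:ℝ) * Real.log n * (n * Real.log n) ^ (-(2:ℝ)) := by ring
        _ ≤ _ := by rw [h5]; linarith
    have h9 := add_le_add (add_le_add (add_le_add h8 h7) (h3.trans h6)) (h4'.trans (h3.trans h6))
    exact h9.trans (le_of_eq (by ring))
  · obtain ⟨CA, hCA, hA⟩ := hk_A3 hd x ρ (fun y => f y - f x) hρ_meas hgm hρ_nonneg hr0 hM hKx
      hρM hg hG hlt
    have hg' : ∀ y, ‖x - y‖ ≤ r0 → |f y - f x| ≤ Kx * ‖x - y‖ ^ ((d:ℝ) / 2) := by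
      intro y hy
      refine (hg y hy).trans (mul_le_mul_of_nonneg_left ?_ hKx.le)
      exact Real.rpow_le_rpow_of_exponent_ge' (norm_nonneg _) (hy.trans hr1) (by positivity)
        (by linarith)
    obtain ⟨C, hC, H⟩ := hk_core hd x ρ f hρ_meas hf_meas hρ_nonneg hρ_prob hρ_var hκ hr0 hr1
      (β := (d:ℝ) / 2) (by positivity) (by linarith) hm hM hKx hρl hρM hg' hG hCA (s1 := 2)
      (s2 := 2) (by positivity) (by positivity) (fun n => 1) (fun n => 0)
      (fun _ => zero_le_one) (fun _ => le_rfl) (fun t ht => ⟨(hA t ht).1, fun n hn => by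
        refine ((hA t ht).2).trans (le_of_eq ?_)
        rw [sub_self, Real.rpow_zero]
        ring⟩)
    refine IsBigO.of_bound (C * 3) ?_
    filter_upwards [H, hev] with n hn ⟨hn1, hl1, hL1⟩
    have hn0 : (0:ℝ) < n := by linarith
    have hl0 : 0 < Real.log n := by linarith
    refine hn.trans ?_
    rw [Real.norm_of_nonneg (by positivity), mul_assoc C]
    refine mul_le_mul_of_nonneg_left ?_ hC
    rw [show 2 * ((d:ℝ) / 2 / (d:ℝ)) + 2 = 2 + 1 by field_simp; norm_num]
    have h3 := hk_log_gain (p := 2) hn0 hl1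
    have h4 : ((n:ℝ) * Real.log n) ^ (-(4:ℝ)) ≤ (n * Real.log n) ^ (-((2:ℝ) + 1)) :=
      Real.rpow_le_rpow_of_exponent_le hL1 (by norm_num)
    have h4' := mul_le_mul_of_nonneg_left h4 (sq_nonneg (n:ℝ))
    have h5 : (n:ℝ) * (n * Real.log n) ^ (-(2:ℝ)) = ((n:ℝ) * Real.log n ^ 2)⁻¹ := by
      rw [Real.rpow_neg (by positivity), Real.rpow_two]; field_simp
    rw [← h5]
    linarith

end
end

section
/- Consider binary classification: (X_i,Y_i) i.i.d. in ℝ^d × {0,1} with X_i of density ρ (a probability density on ℝ^d with finite variance) and f(x) = P(Y=1|X=x). Fix x in the interior of the support of ρ, assume σ(x) > 0 and that ρ, σ, and f are continuous at x, where σ²(x) = f(x)(1−f(x)). Let F(x) = θ(f(x)−1/2) be the Bayes classifier and F̂(x) = θ(f̂(x)−1/2) the plugin classifier built from the Hilbert kernel estimator f̂. Then for every ε > 0 there exists N such that for all n ≥ N, 0 ≤ E[R(F̂(x))] − R(F(x)) ≤ 2(1+ε)·σ(x)/√(ln n), where R denotes the pointwise risk under zero-one loss. -/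
open MeasureTheory Filter

noncomputable section

/-- The Hilbert kernel regression estimator `f̂(x) = Σ_i w_i(x)·Y_i` evaluated on a sample
of `n+1` data pairs `(X_i, Y_i)`. -/
def hilbertEstimator (d n : ℕ) (x : Euc d) (ps : Fin (n + 1) → Euc d × ℝ) : ℝ :=
  ∑ i : Fin (n + 1), hilbertWeight d n x (fun j => (ps j).1) i * (ps i).2

open ProbabilityTheory in
lemma cheb_aux {Ω : Type*} [MeasurableSpace Ω] (μ : Measure Ω) [IsProbabilityMeasure μ]
    (Z : Ω → ℝ) (hZ : MemLp Z 2 μ) (M B : ℝ) (hM : 0 < M) (hMZ : M ≤ ∫ ω, Z ω ∂μ)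
    (hB : ∫ ω, Z ω ^ 2 ∂μ ≤ B) (m : ℕ) (hm : 0 < m) :
    (Measure.pi fun _ : Fin m => μ).real {ω | ∑ i, Z (ω i) ≤ 0} ≤ B / (m * M ^ 2) := by
  have hm' : (0 : ℝ) < m := by exact_mod_cast hm
  set P := Measure.pi fun _ : Fin m => μ with hP
  have hL : ∀ i : Fin m, MemLp (fun ω : Fin m → Ω => Z (ω i)) 2 P := fun i =>
    hZ.comp_measurePreserving (measurePreserving_eval _ i)
  have hS : MemLp (∑ i, fun ω : Fin m → Ω => Z (ω i)) 2 P := memLp_finsetSum' _ fun i _ => hL i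
  have hmean : ∫ ω, (∑ i, fun ω : Fin m → Ω => Z (ω i)) ω ∂P = m * ∫ ω, Z ω ∂μ := by
    simp only [Finset.sum_apply]
    rw [integral_finsetSum _ fun i _ => (hL i).integrable (by norm_num)]
    have : ∀ i : Fin m, ∫ ω, Z (ω i) ∂P = ∫ ω, Z ω ∂μ := fun i =>
      integral_comp_eval (μ := fun _ : Fin m => μ) (i := i) hZ.aestronglyMeasurable
    simp [this]
  have hvar : variance (∑ i, fun ω : Fin m → Ω => Z (ω i)) P ≤ m * B := by
    rw [hP, variance_sum_pi (X := fun _ => Z) (μ := fun _ : Fin m => μ) fun i => hZ]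
    simp only [Finset.sum_const, Finset.card_univ, Fintype.card_fin, nsmul_eq_mul]
    refine mul_le_mul_of_nonneg_left (le_trans (variance_le_expectation_sq hZ.aestronglyMeasurable) ?_) hm'.le
    simpa using hB
  have hc : 0 < m * M := by positivity
  have h1 := meas_ge_le_variance_div_sq hS hc
  have hB0 : 0 ≤ B := le_trans (integral_nonneg fun _ => sq_nonneg _) hB
  calc P.real {ω | ∑ i, Z (ω i) ≤ 0} 
      ≤ P.real {ω | m * M ≤ |(∑ i, fun ω : Fin m → Ω => Z (ω i)) ω - ∫ ω, (∑ i, fun ω : Fin m → Ω => Z (ω i)) ω ∂P|} := by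
        apply measureReal_mono _ (measure_ne_top _ _)
        intro ω hω
        simp only [Set.mem_ofPred_eq] at hω ⊢
        rw [hmean, Finset.sum_apply, abs_sub_comm]
        refine le_trans ?_ (le_abs_self _)
        nlinarith
    _ ≤ variance (∑ i, fun ω : Fin m → Ω => Z (ω i)) P / (m * M) ^ 2 := by
        rw [measureReal_def]
        exact ENNReal.toReal_le_of_le_ofReal (div_nonneg (variance_nonneg _ _) (sq_nonneg _)) h1
    _ ≤ (m * B) / (m * M) ^ 2 := by gcongr
    _ = B / (m * M ^ 2) := by field_simp

lemma union_aux {Ω : Type*} [MeasurableSpace Ω] (μ : Measure Ω) [IsProbabilityMeasure μ]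
    (A : Set Ω) (hA : MeasurableSet A) (m : ℕ) :
    (Measure.pi fun _ : Fin m => μ).real {ω | ∃ i, ω i ∈ A} ≤ m * μ.real A := by
  have : {ω : Fin m → Ω | ∃ i, ω i ∈ A} = ⋃ i, (Function.eval i) ⁻¹' A := by ext; simp
  rw [this]
  refine (measureReal_iUnion_fintype_le _).trans ?_
  have : ∀ i : Fin m, (Measure.pi fun _ : Fin m => μ).real ((Function.eval i) ⁻¹' A) = μ.real A := by
    intro i
    rw [(measurePreserving_eval (fun _ : Fin m => μ) i).measureReal_preimage hA.nullMeasurableSet]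
  simp [this]

lemma transfer_aux (d : ℕ) (ρ : Euc d → ℝ)
    (hρ_meas : Measurable ρ) (hρ_nonneg : ∀ y, 0 ≤ ρ y)
    (μ : Measure (Euc d × ℝ))
    (hmarg : μ.map Prod.fst = volume.withDensity (fun y => ENNReal.ofReal (ρ y)))
    (h : Euc d → ℝ) (hh : Measurable h) : ∫ p, h p.1 ∂μ = ∫ y, h y * ρ y := by
  rw [← integral_map (φ := Prod.fst) measurable_fst.aemeasurable hh.aestronglyMeasurable, hmarg,
    integral_withDensity_eq_integral_toReal_smul (by fun_prop) (by simp)]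
  congr 1; ext y
  rw [ENNReal.toReal_ofReal (hρ_nonneg y), smul_eq_mul, mul_comm]

lemma cond_aux (d : ℕ) (ρ f : Euc d → ℝ)
    (hρ_meas : Measurable ρ) (hρ_nonneg : ∀ y, 0 ≤ ρ y)
    (hf_meas : Measurable f) (hf01 : ∀ y, f y ∈ Set.Icc (0:ℝ) 1)
    (μ : Measure (Euc d × ℝ)) [IsProbabilityMeasure μ]
    (hY01 : ∀ᵐ p ∂μ, p.2 = 0 ∨ p.2 = 1)
    (hmarg : μ.map Prod.fst = volume.withDensity (fun y => ENNReal.ofReal (ρ y)))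
    (hreg : ∀ s : Set (Euc d), MeasurableSet s →
      ∫ p in Prod.fst ⁻¹' s, p.2 ∂μ = ∫ y in s, f y * ρ y)
    (h : Euc d → ℝ) (hh : Measurable h) (C : ℝ) (hC : ∀ y, |h y| ≤ C) :
    ∫ p, h p.1 * p.2 ∂μ = ∫ y, h y * f y * ρ y := by
  have hYint : Integrable (fun p : Euc d × ℝ => p.2) μ := by
    refine Integrable.of_bound measurable_snd.aestronglyMeasurable 1 ?_
    filter_upwards [hY01] with p hp
    rcases hp with hp | hp <;> simp [hp]
  have hfint : Integrable (fun p : Euc d × ℝ => f p.1) μ := by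
    refine Integrable.of_bound (hf_meas.comp measurable_fst).aestronglyMeasurable 1 ?_
    refine Eventually.of_forall fun p => ?_
    rw [Real.norm_eq_abs, abs_of_nonneg (hf01 _).1]; exact (hf01 _).2
  have hm : MeasurableSpace.comap (Prod.fst : Euc d × ℝ → Euc d) inferInstance ≤
      (inferInstance : MeasurableSpace (Euc d × ℝ)) :=
    measurable_fst.comap_le
  have hfst : Measurable[MeasurableSpace.comap (Prod.fst : Euc d × ℝ → Euc d) inferInstance]
      (Prod.fst : Euc d × ℝ → Euc d) := comap_measurable _
  have key : (fun p : Euc d × ℝ => f p.1) =ᵐ[μ]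
      μ[(fun p : Euc d × ℝ => p.2) | MeasurableSpace.comap (Prod.fst : Euc d × ℝ → Euc d) inferInstance] := by
    refine ae_eq_condExp_of_forall_setIntegral_eq hm hYint (fun s _ _ => hfint.integrableOn) ?_
      ((hf_meas.comp hfst).stronglyMeasurable.aestronglyMeasurable)
    rintro _ ⟨s, hs, rfl⟩ _
    rw [hreg s hs, ← integral_indicator hs, ← integral_indicator (measurable_fst hs)]
    have := transfer_aux d ρ hρ_meas hρ_nonneg μ hmarg (s.indicator f) (hf_meas.indicator hs)
    convert! this using 2
    ext y
    by_cases hy : y ∈ s <;> simp [hy]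
  have h2 := condExp_stronglyMeasurable_mul_of_bound hm (μ := μ) (f := fun p : Euc d × ℝ => h p.1)
    (hh.comp hfst).stronglyMeasurable hYint C (Eventually.of_forall fun p => hC _)
  have h3 := integral_condExp (μ := μ) hm (f := (fun p : Euc d × ℝ => h p.1) * (fun p : Euc d × ℝ => p.2))
  calc _ = ∫ p, ((fun p : Euc d × ℝ => h p.1) * (fun p : Euc d × ℝ => p.2)) p ∂μ := rfl
    _ = ∫ p, h p.1 * f p.1 ∂μ := by
      rw [← h3]
      refine integral_congr_ae ?_
      filter_upwards [h2, key] with p h2 h3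
      rw [h2]; simp [← h3]
    _ = _ := transfer_aux d ρ hρ_meas hρ_nonneg μ hmarg (fun y => h y * f y) (hh.mul hf_meas)

/-- unit ball volume -/
def vb (d : ℕ) : ℝ := (volume : Measure (Euc d)).real (Metric.ball 0 1)

lemma vb_pos (d : ℕ) : 0 < vb d :=
  ENNReal.toReal_pos (Metric.measure_ball_pos _ _ one_pos).ne' measure_ball_lt_top.ne

lemma euc_nontrivial (d : ℕ) (hd : 1 ≤ d) : Nontrivial (Euc d) := by
  have : Nonempty (Fin d) := ⟨⟨0, hd⟩⟩
  infer_instance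

lemma radial_aux (d : ℕ) (hd : 1 ≤ d) (x : Euc d) (φ : ℝ → ℝ) :
    ∫ y : Euc d, φ ‖x - y‖ = d * (vb d * ∫ t in Set.Ioi (0:ℝ), t ^ (d - 1) * φ t) := by
  have := euc_nontrivial d hd
  rw [integral_sub_left_eq_self (fun y : Euc d => φ ‖y‖) volume x,
    integral_fun_norm_addHaar]
  simp [vb]

lemma radial_log (d : ℕ) (hd : 1 ≤ d) (x : Euc d) (a r : ℝ) (ha : 0 < a) (har : a ≤ r) :
    ∫ y : Euc d, (Set.Ico a r).indicator (fun t => t ^ (-(d:ℝ))) ‖x - y‖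
      = d * vb d * Real.log (r / a) := by
  rw [radial_aux d hd, mul_assoc]
  congr 2
  have h1 : ∀ t ∈ Set.Ioi (0:ℝ), t ^ (d - 1) * (Set.Ico a r).indicator (fun t => t ^ (-(d:ℝ))) t
      = (Set.Ico a r).indicator (fun t => t⁻¹) t := by
    intro t ht
    have ht : 0 < t := ht
    by_cases h : t ∈ Set.Ico a r
    · simp only [h, Set.indicator_of_mem]
      rw [← Real.rpow_natCast, ← Real.rpow_add ht, ← Real.rpow_neg_one]
      congr 1; rw [Nat.cast_sub hd]; push_cast; ring
    · simp [h]
  rw [setIntegral_congr_fun measurableSet_Ioi h1, setIntegral_indicator measurableSet_Ico]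
  have : Set.Ioi (0:ℝ) ∩ Set.Ico a r = Set.Ico a r := by
    ext t; simp; intro h _; linarith
  rw [this, integral_Ico_eq_integral_Ioc, ← intervalIntegral.integral_of_le har,
    integral_inv_of_pos ha (ha.trans_le har)]

lemma radial_sq_aux (d : ℕ) (hd : 1 ≤ d) (a : ℝ) (ha : 0 < a) : ∀ t ∈ Set.Ioi (0:ℝ), t ^ (d - 1) * (Set.Ici a).indicator (fun t => (t ^ (-(d:ℝ)))^2) t
      = (Set.Ici a).indicator (fun t => t ^ (-(d:ℝ) - 1)) t := by
  intro t ht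
  have ht : 0 < t := ht
  by_cases h : t ∈ Set.Ici a
  · simp only [h, Set.indicator_of_mem]
    rw [← Real.rpow_natCast, ← Real.rpow_natCast, ← Real.rpow_mul ht.le, ← Real.rpow_add ht]
    congr 1; rw [Nat.cast_sub hd]; push_cast; ring
  · simp [h]

lemma radial_sq (d : ℕ) (hd : 1 ≤ d) (x : Euc d) (a : ℝ) (ha : 0 < a) :
    ∫ y : Euc d, (Set.Ici a).indicator (fun t => (t ^ (-(d:ℝ)))^2) ‖x - y‖
      = vb d * a ^ (-(d:ℝ)) := by
  have hd' : (0:ℝ) < d := by exact_mod_cast hd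
  rw [radial_aux d hd]
  rw [setIntegral_congr_fun measurableSet_Ioi (radial_sq_aux d hd a ha), setIntegral_indicator measurableSet_Ici]
  have : Set.Ioi (0:ℝ) ∩ Set.Ici a = Set.Ici a := by
    ext t; simp; intro h; linarith
  rw [this, integral_Ici_eq_integral_Ioi, integral_Ioi_rpow_of_lt (by linarith) ha]
  have : -(d:ℝ) - 1 + 1 = -d := by ring
  rw [this]; field_simp

lemma radial_sq_int (d : ℕ) (hd : 1 ≤ d) (x : Euc d) (a : ℝ) (ha : 0 < a) :
    Integrable fun y : Euc d => (Set.Ici a).indicator (fun t => (t ^ (-(d:ℝ)))^2) ‖x - y‖ := by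
  have hd' : (0:ℝ) < d := by exact_mod_cast hd
  have := euc_nontrivial d hd
  have : Integrable fun y : Euc d => (Set.Ici a).indicator (fun t => (t ^ (-(d:ℝ)))^2) ‖y‖ := by
    rw [integrable_fun_norm_addHaar volume (f := (Set.Ici a).indicator (fun t => (t ^ (-(d:ℝ)))^2))]
    simp only [finrank_euclideanSpace_fin, smul_eq_mul]
    rw [integrableOn_congr_fun (radial_sq_aux d hd a ha) measurableSet_Ioi, IntegrableOn, integrable_indicator_iff measurableSet_Ici]
    have h1 : IntegrableOn (fun t : ℝ => t ^ (-(d:ℝ) - 1)) (Set.Ici a) := by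
      rw [integrableOn_Ici_iff_integrableOn_Ioi]
      exact integrableOn_Ioi_rpow_of_lt (by linarith) ha
    exact h1.mono_measure Measure.restrict_le_self
  exact this.comp_sub_left x

/-- truncated kernel -/
def gk (d : ℕ) (x : Euc d) (a : ℝ) (y : Euc d) : ℝ :=
  (Set.Ici a).indicator (fun t => t ^ (-(d:ℝ))) ‖x - y‖

lemma gk_meas (d : ℕ) (x : Euc d) (a : ℝ) : Measurable (gk d x a) := by
  have h : Measurable ((Set.Ici a).indicator (fun t : ℝ => t ^ (-(d:ℝ)))) :=
    Measurable.indicator (by fun_prop) measurableSet_Ici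
  exact h.comp (by fun_prop : Measurable fun y : Euc d => ‖x - y‖)

lemma gk_nonneg (d : ℕ) (x : Euc d) (a : ℝ) (y : Euc d) : 0 ≤ gk d x a y := by
  unfold gk
  by_cases h : ‖x - y‖ ∈ Set.Ici a
  · rw [Set.indicator_of_mem h]; positivity
  · rw [Set.indicator_of_notMem h]

lemma gk_le (d : ℕ) (x : Euc d) (a b : ℝ) (hb : 0 < b) (y : Euc d)
    (hy : b ≤ ‖x - y‖ ∨ b ≤ a) : gk d x a y ≤ b ^ (-(d:ℝ)) := by
  unfold gk
  by_cases h : ‖x - y‖ ∈ Set.Ici a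
  · rw [Set.indicator_of_mem h]
    have : a ≤ ‖x - y‖ := h
    refine Real.rpow_le_rpow_of_nonpos hb ?_ (by simp)
    rcases hy with hy | hy <;> linarith
  · rw [Set.indicator_of_notMem h]; positivity

lemma ρint (d : ℕ) (ρ : Euc d → ℝ) (hρ_prob : (∫ y, ρ y) = 1) : Integrable ρ := by
  by_contra h
  rw [integral_undef h] at hρ_prob; norm_num at hρ_prob

lemma sq_aux (d : ℕ) (hd : 1 ≤ d) (ρ : Euc d → ℝ)
    (hρ_meas : Measurable ρ) (hρ_nonneg : ∀ y, 0 ≤ ρ y)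
    (hρ_prob : (∫ y, ρ y) = 1)
    (μ : Measure (Euc d × ℝ)) [IsProbabilityMeasure μ]
    (hY01 : ∀ᵐ p ∂μ, p.2 = 0 ∨ p.2 = 1)
    (hmarg : μ.map Prod.fst = volume.withDensity (fun y => ENNReal.ofReal (ρ y)))
    (x : Euc d) (s ρ1 a r : ℝ) (hs : s = 1 ∨ s = -1) (hr : 0 < r) (ha : 0 < a) (hρ1 : 0 ≤ ρ1)
    (hnear : ∀ y, ‖x - y‖ < r → ρ y ≤ ρ1) :
    ∫ p, (s * gk d x a p.1 * (p.2 - 1/2)) ^ 2 ∂μ ≤ ρ1 * (vb d * a ^ (-(d:ℝ))) + (r ^ (-(d:ℝ))) ^ 2 := by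
  have h1 : ∫ p, (s * gk d x a p.1 * (p.2 - 1/2)) ^ 2 ∂μ = ∫ p, (gk d x a p.1)^2 / 4 ∂μ := by
    refine integral_congr_ae ?_
    filter_upwards [hY01] with p hp
    rcases hp with hp | hp <;> rcases hs with hs | hs <;> simp only [hp, hs] <;> ring
  rw [h1, transfer_aux d ρ hρ_meas hρ_nonneg μ hmarg (fun y => (gk d x a y)^2/4)
    (by have := gk_meas d x a; fun_prop)]
  have hI := radial_sq_int d hd x a ha
  have hsq : ∀ y, (Set.Ici a).indicator (fun t => (t ^ (-(d:ℝ)))^2) ‖x - y‖ = gk d x a y ^ 2 := by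
    intro y; unfold gk
    by_cases h : ‖x - y‖ ∈ Set.Ici a
    · simp only [Set.indicator_of_mem h]
    · simp only [Set.indicator_of_notMem h]; norm_num
  rw [← radial_sq d hd x a ha]
  simp only [hsq] at hI ⊢
  have hρi := ρint d ρ hρ_prob
  calc _ ≤ ∫ y, (ρ1 * gk d x a y ^ 2 + (r ^ (-(d:ℝ))) ^ 2 * ρ y) := by
        refine integral_mono_of_nonneg (Eventually.of_forall fun y => ?_)
          ((hI.const_mul _).add (hρi.const_mul _)) (Eventually.of_forall fun y => ?_)
        · have := hρ_nonneg y; simp only [Pi.zero_apply]; positivity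
        · have h0 := gk_nonneg d x a y
          have h5 := hρ_nonneg y
          simp only
          by_cases hy : ‖x - y‖ < r
          · have h3 := hnear y hy
            have h4 : gk d x a y ^ 2 * ρ y ≤ gk d x a y ^ 2 * ρ1 := by gcongr
            have : 0 ≤ (r ^ (-(d:ℝ))) ^ 2 * ρ y := by positivity
            have : 0 ≤ gk d x a y ^ 2 * ρ1 := by positivity
            nlinarith
          · have h3 := gk_le d x a r hr y (Or.inl (not_lt.1 hy))
            have h4 : gk d x a y ^ 2 * ρ y ≤ (r ^ (-(d:ℝ))) ^ 2 * ρ y := by gcongr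
            have : 0 ≤ gk d x a y ^ 2 * ρ1 := by positivity
            have : 0 ≤ gk d x a y ^ 2 * ρ y := by positivity
            nlinarith
    _ = _ := by
      rw [integral_add (hI.const_mul _) (hρi.const_mul _), integral_const_mul, integral_const_mul,
        hρ_prob, mul_one]

lemma ball_aux (d : ℕ) (ρ : Euc d → ℝ)
    (hρ_prob : (∫ y, ρ y) = 1)
    (μ : Measure (Euc d × ℝ)) [IsProbabilityMeasure μ]
    (hmarg : μ.map Prod.fst = volume.withDensity (fun y => ENNReal.ofReal (ρ y)))
    (x : Euc d) (ρ1 a r : ℝ) (ha : 0 < a) (har : a ≤ r) (hρ1 : 0 ≤ ρ1)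
    (hnear : ∀ y, ‖x - y‖ < r → ρ y ≤ ρ1) :
    μ.real {p | ‖x - p.1‖ < a} ≤ ρ1 * (vb d * a ^ d) := by
  have h1 : {p : Euc d × ℝ | ‖x - p.1‖ < a} = Prod.fst ⁻¹' (Metric.ball x a) := by
    ext p; simp [dist_eq_norm, norm_sub_rev]
  rw [h1, measureReal_def, ← Measure.map_apply measurable_fst measurableSet_ball, hmarg,
    withDensity_apply _ measurableSet_ball]
  have h2 : ∫⁻ y in Metric.ball x a, ENNReal.ofReal (ρ y) ≤ ENNReal.ofReal ρ1 * volume (Metric.ball x a) := by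
    rw [← setLIntegral_const]
    refine setLIntegral_mono measurable_const fun y hy => ENNReal.ofReal_le_ofReal (hnear y ?_)
    rw [Metric.mem_ball, dist_eq_norm, norm_sub_rev] at hy
    linarith
  have hfin : ENNReal.ofReal ρ1 * volume (Metric.ball x a) ≠ ⊤ :=
    ENNReal.mul_ne_top ENNReal.ofReal_ne_top measure_ball_lt_top.ne
  refine (ENNReal.toReal_mono hfin h2).trans ?_
  rw [ENNReal.toReal_mul, ENNReal.toReal_ofReal hρ1, Measure.addHaar_ball_of_pos _ _ ha, ENNReal.toReal_mul,
    ENNReal.toReal_ofReal (by positivity), finrank_euclideanSpace_fin]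
  rw [vb, measureReal_def, mul_comm (a ^ d)]

lemma mean_aux (d : ℕ) (hd : 1 ≤ d) (ρ f : Euc d → ℝ)
    (hρ_meas : Measurable ρ) (hρ_nonneg : ∀ y, 0 ≤ ρ y)
    (hρ_prob : (∫ y, ρ y) = 1)
    (hf_meas : Measurable f) (hf01 : ∀ y, f y ∈ Set.Icc (0:ℝ) 1)
    (μ : Measure (Euc d × ℝ)) [IsProbabilityMeasure μ]
    (hY01 : ∀ᵐ p ∂μ, p.2 = 0 ∨ p.2 = 1)
    (hmarg : μ.map Prod.fst = volume.withDensity (fun y => ENNReal.ofReal (ρ y)))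
    (hreg : ∀ s : Set (Euc d), MeasurableSet s →
      ∫ p in Prod.fst ⁻¹' s, p.2 ∂μ = ∫ y in s, f y * ρ y)
    (x : Euc d) (s δ ρ0 a r : ℝ) (hs : s = 1 ∨ s = -1) (hδ : 0 ≤ δ) (ha : 0 < a) (har : a ≤ r)
    (hρ0 : 0 ≤ ρ0)
    (hnear : ∀ y, ‖x - y‖ < r → ρ0 ≤ ρ y ∧ δ ≤ s * (f y - 1/2)) :
    δ * ρ0 * (d * vb d * Real.log (r / a)) - r ^ (-(d:ℝ)) ≤
      ∫ p, (s * gk d x a p.1 * (p.2 - 1/2)) ∂μ := by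
  have hr : 0 < r := ha.trans_le har
  have hgm := gk_meas d x a
  have hgb : ∀ y, |gk d x a y| ≤ a ^ (-(d:ℝ)) := fun y => by
    rw [abs_of_nonneg (gk_nonneg d x a y)]; exact gk_le d x a a ha y (Or.inr le_rfl)
  have hρi := ρint d ρ hρ_prob
  have hgi : Integrable (fun p : Euc d × ℝ => gk d x a p.1) μ :=
    Integrable.of_bound (hgm.comp measurable_fst).aestronglyMeasurable _ (Eventually.of_forall fun p => hgb _)
  have hgyi : Integrable (fun p : Euc d × ℝ => gk d x a p.1 * p.2) μ := by
    refine Integrable.of_bound ((hgm.comp measurable_fst).mul measurable_snd).aestronglyMeasurable (a ^ (-(d:ℝ))) ?_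
    filter_upwards [hY01] with p hp
    have := hgb p.1
    rcases hp with hp | hp
    · simp [hp]; positivity
    · simpa [hp] using this
  have hgρ : Integrable (fun y => gk d x a y * ρ y) :=
    hρi.bdd_mul hgm.aestronglyMeasurable (c := a ^ (-(d:ℝ))) (Eventually.of_forall hgb)
  have hgfρ : Integrable (fun y => gk d x a y * f y * ρ y) := by
    refine hρi.bdd_mul (hgm.mul hf_meas).aestronglyMeasurable (c := a ^ (-(d:ℝ)) * 1) (Eventually.of_forall fun y => ?_)
    rw [norm_mul]
    refine mul_le_mul (hgb y) ?_ (norm_nonneg _) (by positivity)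
    rw [Real.norm_eq_abs, abs_of_nonneg (hf01 _).1]; exact (hf01 _).2
  have e1 : ∫ p, (s * gk d x a p.1 * (p.2 - 1/2)) ∂μ = ∫ y, s * (gk d x a y * f y * ρ y - (1/2) * (gk d x a y * ρ y)) := by
    rw [integral_const_mul, integral_sub hgfρ (hgρ.const_mul _), integral_const_mul,
      ← cond_aux d ρ f hρ_meas hρ_nonneg hf_meas hf01 μ hY01 hmarg hreg _ hgm _ hgb,
      ← transfer_aux d ρ hρ_meas hρ_nonneg μ hmarg _ hgm, ← integral_const_mul,
      ← integral_sub hgyi (hgi.const_mul _), ← integral_const_mul]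
    congr 1; ext p; ring
  rw [e1, ← radial_log d hd x a r ha har]
  have hIm : Measurable fun y : Euc d => (Set.Ico a r).indicator (fun t => t ^ (-(d:ℝ))) ‖x - y‖ := by
    have h : Measurable ((Set.Ico a r).indicator (fun t : ℝ => t ^ (-(d:ℝ)))) :=
      Measurable.indicator (by fun_prop) measurableSet_Ico
    exact h.comp (by fun_prop : Measurable fun y : Euc d => ‖x - y‖)
  have hIle : ∀ y : Euc d, (Set.Ico a r).indicator (fun t => t ^ (-(d:ℝ))) ‖x - y‖ =
      if ‖x - y‖ < r then gk d x a y else 0 := by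
    intro y
    unfold gk
    by_cases h1 : ‖x - y‖ < r <;> by_cases h2 : a ≤ ‖x - y‖ <;> simp [Set.indicator, h1, h2]
  have hI : Integrable fun y : Euc d => (Set.Ico a r).indicator (fun t => t ^ (-(d:ℝ))) ‖x - y‖ := by
    have hb : IntegrableOn (fun _ : Euc d => a ^ (-(d:ℝ))) (Metric.ball x r) :=
      integrableOn_const measure_ball_lt_top.ne
    rw [← integrable_indicator_iff measurableSet_ball] at hb
    refine hb.mono' hIm.aestronglyMeasurable (Eventually.of_forall fun y => ?_)
    rw [hIle y]
    by_cases hy : ‖x - y‖ < r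
    · rw [if_pos hy, Set.indicator_of_mem (by rwa [Metric.mem_ball, dist_eq_norm, norm_sub_rev])]
      exact hgb y
    · rw [if_neg hy, norm_zero]
      exact Set.indicator_nonneg (fun _ _ => by positivity) _
  rw [← integral_const_mul]
  have e2 : r ^ (-(d:ℝ)) = ∫ y, r ^ (-(d:ℝ)) * ρ y := by rw [integral_const_mul, hρ_prob, mul_one]
  rw [e2, ← integral_sub (hI.const_mul _) (hρi.const_mul _)]
  refine integral_mono ((hI.const_mul _).sub (hρi.const_mul _)) ((hgfρ.sub (hgρ.const_mul _)).const_mul _) fun y => ?_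
  simp only [hIle]
  have h0 := gk_nonneg d x a y
  have h5 := hρ_nonneg y
  have hr' : 0 ≤ r ^ (-(d:ℝ)) * ρ y := by positivity
  have e3 : s * (gk d x a y * f y * ρ y - 1 / 2 * (gk d x a y * ρ y)) = gk d x a y * ((s * (f y - 1/2)) * ρ y) := by ring
  rw [e3]
  by_cases hy : ‖x - y‖ < r
  · obtain ⟨h1, h2⟩ := hnear y hy
    rw [if_pos hy]
    have : δ * ρ0 ≤ (s * (f y - 1/2)) * ρ y := mul_le_mul h2 h1 hρ0 (hδ.trans h2)
    have := mul_le_mul_of_nonneg_left this h0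
    linarith
  · rw [if_neg hy, mul_zero, zero_sub]
    have h3 := gk_le d x a r hr y (Or.inl (not_lt.1 hy))
    have h4 : gk d x a y * ρ y ≤ r ^ (-(d:ℝ)) * ρ y := by gcongr
    have h6 : -1 ≤ s * (f y - 1/2) := by
      have := hf01 y
      rcases hs with hs | hs <;> rw [hs] <;> linarith [this.1, this.2]
    have h7 := mul_le_mul_of_nonneg_left h6 (mul_nonneg h0 h5)
    linarith

lemma est_meas (d n : ℕ) (x : Euc d) : Measurable (hilbertEstimator d n x) := by
  unfold hilbertEstimator hilbertWeight
  fun_prop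

lemma det_aux (d n : ℕ) (x : Euc d) (ps : Fin (n + 1) → Euc d × ℝ) (s a : ℝ) (ha : 0 < a)
    (hps : ∀ i, a ≤ ‖x - (ps i).1‖) (hw : s * (hilbertEstimator d n x ps - 1/2) ≤ 0) :
    ∑ i, s * gk d x a (ps i).1 * ((ps i).2 - 1/2) ≤ 0 := by
  have hg : ∀ i, gk d x a (ps i).1 = ‖x - (ps i).1‖ ^ (-(d:ℝ)) := fun i => by
    unfold gk; rw [Set.indicator_of_mem]; exact hps i
  simp only [hg]
  set T := ∑ j : Fin (n + 1), ‖x - (ps j).1‖ ^ (-(d : ℝ)) with hT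
  have hTpos : 0 < T := Finset.sum_pos (fun i _ => Real.rpow_pos_of_pos (ha.trans_le (hps i)) _) Finset.univ_nonempty
  have e : hilbertEstimator d n x ps = (∑ i, ‖x - (ps i).1‖ ^ (-(d : ℝ)) * (ps i).2) / T := by
    unfold hilbertEstimator hilbertWeight
    rw [Finset.sum_div]
    exact Finset.sum_congr rfl fun i _ => by rw [← hT]; ring
  have e2 : ∑ i, s * ‖x - (ps i).1‖ ^ (-(d : ℝ)) * ((ps i).2 - 1/2) =
      T * (s * (hilbertEstimator d n x ps - 1/2)) := by
    rw [e]
    have : T * (s * ((∑ i, ‖x - (ps i).1‖ ^ (-(d : ℝ)) * (ps i).2) / T - 1/2)) =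
      s * ((∑ i, ‖x - (ps i).1‖ ^ (-(d : ℝ)) * (ps i).2) - T * (1/2)) := by field_simp
    rw [this, hT, Finset.sum_mul, ← Finset.sum_sub_distrib, Finset.mul_sum]
    exact Finset.sum_congr rfl fun i _ => by ring
  rw [e2]
  exact mul_nonpos_of_nonneg_of_nonpos hTpos.le hw

lemma prob_aux (d : ℕ) (hd : 1 ≤ d) (ρ f : Euc d → ℝ)
    (hρ_meas : Measurable ρ) (hρ_nonneg : ∀ y, 0 ≤ ρ y)
    (hρ_prob : (∫ y, ρ y) = 1)
    (hf_meas : Measurable f) (hf01 : ∀ y, f y ∈ Set.Icc (0:ℝ) 1)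
    (μ : Measure (Euc d × ℝ)) [IsProbabilityMeasure μ]
    (hY01 : ∀ᵐ p ∂μ, p.2 = 0 ∨ p.2 = 1)
    (hmarg : μ.map Prod.fst = volume.withDensity (fun y => ENNReal.ofReal (ρ y)))
    (hreg : ∀ s : Set (Euc d), MeasurableSet s →
      ∫ p in Prod.fst ⁻¹' s, p.2 ∂μ = ∫ y in s, f y * ρ y)
    (x : Euc d) (s δ ρ0 ρ1 r : ℝ) (hs : s = 1 ∨ s = -1) (hδ : 0 < δ) (hr : 0 < r)
    (hρ0 : 0 < ρ0) (hρ1 : 0 < ρ1)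
    (hnear : ∀ y, ‖x - y‖ < r → ρ0 ≤ ρ y ∧ ρ y ≤ ρ1 ∧ δ ≤ s * (f y - 1/2)) :
    ∃ C : ℝ, ∀ᶠ n : ℕ in atTop, (Measure.pi fun _ : Fin (n + 1) => μ).real
      {ps | s * (hilbertEstimator d n x ps - 1/2) ≤ 0} ≤ C / Real.log n := by
  have hv := vb_pos d
  have hd' : (0:ℝ) < d := by exact_mod_cast hd
  set R := r ^ (-(d:ℝ)) with hR
  have hRpos : 0 < R := by positivity
  set c := δ * ρ0 * vb d with hc
  have hcpos : 0 < c := by positivity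
  refine ⟨ρ1 * vb d + (ρ1 * vb d + R ^ 2) / (c / 2) ^ 2, ?_⟩
  have hlog : Tendsto (fun n : ℕ => Real.log n) atTop atTop :=
    Real.tendsto_log_atTop.comp tendsto_natCast_atTop_atTop
  filter_upwards [hlog.eventually_ge_atTop 1, hlog.eventually_ge_atTop R,
    hlog.eventually_ge_atTop (2 * (R / c - d * Real.log r)), eventually_ge_atTop 1] with n hL1 hLR hLc hn
  set L := Real.log n with hL
  have hLpos : 0 < L := by linarith
  set m : ℝ := ((n + 1 : ℕ) : ℝ) with hm
  have hm1 : 1 ≤ m := by rw [hm]; push_cast; linarith [Nat.cast_nonneg (α := ℝ) n]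
  have hmpos : 0 < m := by linarith
  have hmL : 0 < m * L := by positivity
  set a := (m * L) ^ (-(1 / (d:ℝ))) with ha
  have hapos : 0 < a := by positivity
  have had : a ^ d = (m * L)⁻¹ := by
    rw [ha, ← Real.rpow_natCast, ← Real.rpow_mul hmL.le, ← Real.rpow_neg_one]
    congr 1; field_simp
  have had' : a ^ (-(d:ℝ)) = m * L := by
    rw [Real.rpow_neg hapos.le, Real.rpow_natCast, had, inv_inv]
  have har : a ≤ r := by
    by_contra h
    push Not at h
    have h1 : a ^ (-(d:ℝ)) < R := Real.rpow_lt_rpow_of_neg hr h (by linarith)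
    rw [had'] at h1
    nlinarith
  have hlogm : L ≤ Real.log m := by
    rw [hL]; refine Real.log_le_log (by exact_mod_cast hn) ?_
    rw [hm]; push_cast; linarith
  have hloga : d * Real.log (r / a) = d * Real.log r + (Real.log m + Real.log L) := by
    rw [Real.log_div hr.ne' hapos.ne', ha, Real.log_rpow hmL, Real.log_mul hmpos.ne' hLpos.ne']
    field_simp; ring
  have hlogL : 0 ≤ Real.log L := Real.log_nonneg hL1
  have hball := ball_aux d ρ hρ_prob μ hmarg x ρ1 a r hapos har hρ1.le fun y hy => (hnear y hy).2.1
  have hsq := sq_aux d hd ρ hρ_meas hρ_nonneg hρ_prob μ hY01 hmarg x s ρ1 a r hs hr hapos hρ1.le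
    fun y hy => (hnear y hy).2.1
  have hmean := mean_aux d hd ρ f hρ_meas hρ_nonneg hρ_prob hf_meas hf01 μ hY01 hmarg hreg x s δ ρ0 a r
    hs hδ.le hapos har hρ0.le fun y hy => ⟨(hnear y hy).1, (hnear y hy).2.2⟩
  have hmean' : c / 2 * L ≤ ∫ p, (s * gk d x a p.1 * (p.2 - 1/2)) ∂μ := by
    refine le_trans ?_ hmean
    have e : δ * ρ0 * (d * vb d * Real.log (r / a)) = c * (d * Real.log (r / a)) := by rw [hc]; ring
    rw [e, hloga, ← hR]
    have h1 : c * (2 * (R / c - d * Real.log r)) ≤ c * L := mul_le_mul_of_nonneg_left hLc hcpos.le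
    have h2 : c * (2 * (R / c - d * Real.log r)) = 2 * R - 2 * (c * (d * Real.log r)) := by field_simp
    have h3 : c * L ≤ c * (Real.log m + Real.log L) := mul_le_mul_of_nonneg_left (by linarith) hcpos.le
    linarith
  have hgm := gk_meas d x a
  have hZ : MemLp (fun p : Euc d × ℝ => s * gk d x a p.1 * (p.2 - 1/2)) 2 μ := by
    refine MemLp.of_bound (C := a ^ (-(d:ℝ))) ?_ ?_
    · exact (((hgm.comp measurable_fst).const_mul s).mul (measurable_snd.sub_const _)).aestronglyMeasurable
    · filter_upwards [hY01] with p hp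
      have h0 := gk_nonneg d x a p.1
      have h1 := gk_le d x a a hapos p.1 (Or.inr le_rfl)
      rw [Real.norm_eq_abs, abs_le]
      rcases hp with hp | hp <;> rcases hs with hs | hs <;> rw [hp, hs] <;> constructor <;> linarith
  have hch := cheb_aux μ _ hZ (c / 2 * L) _ (by positivity) hmean' hsq (n + 1) (Nat.succ_pos _)
  have hun := union_aux μ {p : Euc d × ℝ | ‖x - p.1‖ < a}
    (measurableSet_lt (by fun_prop) measurable_const) (n + 1)
  rw [← hm] at hch hun
  rw [had'] at hch
  rw [had] at hball
  have hsub : {ps : Fin (n + 1) → Euc d × ℝ | s * (hilbertEstimator d n x ps - 1/2) ≤ 0} ⊆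
      {ps | ∃ i, ps i ∈ {p : Euc d × ℝ | ‖x - p.1‖ < a}} ∪
      {ps | ∑ i, s * gk d x a (ps i).1 * ((ps i).2 - 1/2) ≤ 0} := by
    intro ps hps
    by_cases h : ∃ i, ps i ∈ {p : Euc d × ℝ | ‖x - p.1‖ < a}
    · exact Or.inl h
    · right
      push Not at h
      exact det_aux d n x ps s a hapos (fun i => not_lt.1 (h i)) hps
  calc _ ≤ _ := measureReal_mono hsub (measure_ne_top _ _)
    _ ≤ _ := measureReal_union_le _ _
    _ ≤ m * (ρ1 * (vb d * (m * L)⁻¹)) + (ρ1 * (vb d * (m * L)) + R ^ 2) / (m * (c / 2 * L) ^ 2) :=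
      add_le_add (hun.trans (by gcongr)) hch
    _ ≤ m * (ρ1 * (vb d * (m * L)⁻¹)) + ((ρ1 * vb d + R ^ 2) * (m * L)) / (m * (c / 2 * L) ^ 2) := by
      have : 1 ≤ m * L := by nlinarith
      gcongr
      nlinarith [sq_nonneg R]
    _ = _ := by field_simp

/-- binary classification with i.i.d. pairs `(X_i,Y_i) ~ μ`, `Y ∈ {0,1}`,
`X`-marginal of density `ρ` and `f(x) = P(Y=1|X=x)`, with `σ²(x) = f(x)(1−f(x))`.
If `x` is in the interior of the support of `ρ`, `σ(x) > 0`, and `ρ`, `σ`, `f` are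
continuous at `x`, then for every `ε > 0` there is `N` such that for all `n ≥ N` the excess
risk of the plugin classifier `F̂ = θ(f̂−1/2)` satisfies
`0 ≤ E[R(F̂(x))] − R(F(x)) ≤ 2(1+ε)·σ(x)/√(ln n)`, where
`E[R(F̂(x))] = E[if f̂(x) ≥ 1/2 then 1−f(x) else f(x)]` and `R(F(x)) = min(f(x), 1−f(x))`. -/
theorem hilbert_plugin_classifier_rate
    (d : ℕ) (hd : 1 ≤ d)
    (ρ f σ : Euc d → ℝ)
    (hρ_meas : Measurable ρ) (hρ_nonneg : ∀ y, 0 ≤ ρ y)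
    (hρ_prob : (∫ y, ρ y) = 1)
    (hρ_var : Integrable (fun y => ρ y * ‖y‖ ^ 2))
    (hf_meas : Measurable f) (hσ_meas : Measurable σ)
    (μ : Measure (Euc d × ℝ)) [IsProbabilityMeasure μ]
    (hY01 : ∀ᵐ p ∂μ, p.2 = 0 ∨ p.2 = 1)
    (hmarg : μ.map Prod.fst = volume.withDensity (fun y => ENNReal.ofReal (ρ y)))
    (hreg : ∀ s : Set (Euc d), MeasurableSet s →
      ∫ p in Prod.fst ⁻¹' s, p.2 ∂μ = ∫ y in s, f y * ρ y)
    (hσ_nonneg : ∀ y, 0 ≤ σ y) (hσ_def : ∀ y, σ y ^ 2 = f y * (1 - f y))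
    (x : Euc d) (hx : x ∈ interior {y | 0 < ρ y}) (hσx : 0 < σ x)
    (hρ_cont : ContinuousAt ρ x) (hσ_cont : ContinuousAt σ x) (hf_cont : ContinuousAt f x) :
    ∀ ε > (0 : ℝ), ∃ N : ℕ, ∀ n ≥ N,
      0 ≤ (∫ ps : Fin (n + 1) → Euc d × ℝ,
            (if (1 : ℝ) / 2 ≤ hilbertEstimator d n x ps then 1 - f x else f x)
            ∂Measure.pi fun _ => μ) - min (f x) (1 - f x) ∧
      (∫ ps : Fin (n + 1) → Euc d × ℝ,
            (if (1 : ℝ) / 2 ≤ hilbertEstimator d n x ps then 1 - f x else f x)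
            ∂Measure.pi fun _ => μ) - min (f x) (1 - f x) ≤
        2 * (1 + ε) * σ x / Real.sqrt (Real.log n) := by
  have hf01 : ∀ y, f y ∈ Set.Icc (0:ℝ) 1 := by
    intro y
    have := hσ_def y
    have h2 := sq_nonneg (σ y)
    constructor <;> nlinarith
  have hρx : 0 < ρ x := by
    have h : x ∈ {y | 0 < ρ y} := interior_subset hx
    exact h
  intro ε hε
  set e := |2 * f x - 1| with he
  have he0 : 0 ≤ e := abs_nonneg _
  -- key eventual bound
  have key : ∃ C : ℝ, ∀ᶠ n : ℕ in atTop, (∫ ps : Fin (n + 1) → Euc d × ℝ,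
      (if (1 : ℝ) / 2 ≤ hilbertEstimator d n x ps then 1 - f x else f x)
            ∂Measure.pi fun _ => μ) - min (f x) (1 - f x) ≤ C / Real.log n := by
    by_cases hfx : f x = 1/2
    · refine ⟨0, Eventually.of_forall fun n => ?_⟩
      have : ∀ n, ∫ ps : Fin (n + 1) → Euc d × ℝ,
        (if (1 : ℝ) / 2 ≤ hilbertEstimator d n x ps then 1 - f x else f x)
            ∂(Measure.pi fun _ => μ) = 1/2 := by
        intro n
        rw [hfx]
        have h2 : (1:ℝ) - 1/2 = 1/2 := by norm_num
        simp only [h2, ite_self, integral_const, probReal_univ, smul_eq_mul, one_mul]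
      rw [this, hfx]; norm_num
    · obtain ⟨s, hs, hsf⟩ : ∃ s : ℝ, (s = 1 ∨ s = -1) ∧ 0 < s * (f x - 1/2) := by
        rcases lt_or_gt_of_ne hfx with h | h
        · exact ⟨-1, Or.inr rfl, by linarith⟩
        · exact ⟨1, Or.inl rfl, by linarith⟩
      have hev : ∀ᶠ y in nhds x, ρ x / 2 < ρ y ∧ ρ y < 2 * ρ x ∧ s * (f x - 1/2) / 2 < s * (f y - 1/2) := by
        have hcf : ContinuousAt (fun y => s * (f y - 1/2)) x :=
          continuousAt_const.mul (hf_cont.sub continuousAt_const)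
        exact (hρ_cont.eventually_const_lt (by linarith)).and
          ((hρ_cont.eventually_lt_const (by linarith)).and (hcf.eventually_const_lt (by linarith)))
      obtain ⟨r, hr, hball⟩ := Metric.eventually_nhds_iff.1 hev
      obtain ⟨C, hC⟩ := prob_aux d hd ρ f hρ_meas hρ_nonneg hρ_prob hf_meas hf01 μ hY01 hmarg hreg x s
        (s * (f x - 1/2) / 2) (ρ x / 2) (2 * ρ x) r hs (by linarith) hr (by linarith) (by linarith)
        (fun y hy => by
          have := @hball y (by rwa [dist_eq_norm, norm_sub_rev])
          exact ⟨this.1.le, this.2.1.le, this.2.2.le⟩)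
      refine ⟨C, ?_⟩
      filter_upwards [hC] with n hn
      refine le_trans ?_ hn
      have hem := est_meas d n x
      have hW : MeasurableSet {ps | s * (hilbertEstimator d n x ps - 1/2) ≤ 0} :=
        measurableSet_le (by fun_prop) measurable_const
      have hint : Integrable (fun ps : Fin (n + 1) → Euc d × ℝ =>
        (if (1 : ℝ) / 2 ≤ hilbertEstimator d n x ps then 1 - f x else f x)) (Measure.pi fun _ => μ) := by
        refine Integrable.of_bound (C := 1) (Measurable.ite (measurableSet_le measurable_const hem)
          measurable_const measurable_const).aestronglyMeasurable (Eventually.of_forall fun ps => ?_)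
        have := hf01 x
        rw [Real.norm_eq_abs, abs_le]
        split_ifs <;> constructor <;> linarith [this.1, this.2]
      have hmin : min (f x) (1 - f x) = ∫ ps : Fin (n + 1) → Euc d × ℝ, min (f x) (1 - f x)
          ∂Measure.pi fun _ => μ := by simp
      rw [hmin, ← integral_sub hint (integrable_const _), ← integral_indicator_one hW]
      refine integral_mono (hint.sub (integrable_const _))
        ((integrable_const (1:ℝ)).indicator hW) fun ps => ?_
      have h01 := hf01 x
      simp only [Set.indicator, Set.mem_ofPred_eq, Pi.one_apply]
      rcases hs with hs | hs <;> subst hs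
      · have : min (f x) (1 - f x) = 1 - f x := min_eq_right (by linarith)
        rw [this]
        split_ifs <;> linarith [h01.1, h01.2]
      · have : min (f x) (1 - f x) = f x := min_eq_left (by linarith)
        rw [this]
        split_ifs <;> linarith [h01.1, h01.2]
  obtain ⟨C, hC⟩ := key
  have hlog : Tendsto (fun n : ℕ => Real.log n) atTop atTop :=
    Real.tendsto_log_atTop.comp tendsto_natCast_atTop_atTop
  have hsq : Tendsto (fun n : ℕ => Real.sqrt (Real.log n)) atTop atTop :=
    Real.tendsto_sqrt_atTop.comp hlog
  have hfin := hC.and ((hlog.eventually_ge_atTop 1).and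
    (hsq.eventually_ge_atTop (C / (2 * (1 + ε) * σ x))))
  obtain ⟨N, hN⟩ := eventually_atTop.1 hfin
  refine ⟨N, fun n hn => ⟨?_, ?_⟩⟩
  · have hint : Integrable (fun ps : Fin (n + 1) → Euc d × ℝ =>
        (if (1 : ℝ) / 2 ≤ hilbertEstimator d n x ps then 1 - f x else f x)) (Measure.pi fun _ => μ) := by
      refine Integrable.of_bound (C := 1) (Measurable.ite (measurableSet_le measurable_const (est_meas d n x))
        measurable_const measurable_const).aestronglyMeasurable (Eventually.of_forall fun ps => ?_)
      have := hf01 x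
      rw [Real.norm_eq_abs, abs_le]
      split_ifs <;> constructor <;> linarith [this.1, this.2]
    have hmin : min (f x) (1 - f x) = ∫ ps : Fin (n + 1) → Euc d × ℝ, min (f x) (1 - f x)
          ∂Measure.pi fun _ => μ := by simp
    rw [hmin, sub_nonneg]
    refine integral_mono (integrable_const _) hint fun ps => ?_
    simp only
    split_ifs
    · exact min_le_right _ _
    · exact min_le_left _ _
  · obtain ⟨h1, h2, h3⟩ := hN n hn
    refine h1.trans ?_
    have hS : 0 < Real.sqrt (Real.log n) := Real.sqrt_pos.2 (by linarith)
    have hK : 0 < 2 * (1 + ε) * σ x := by positivity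
    rw [div_le_iff₀ hK] at h3
    have hLS : Real.log n = Real.sqrt (Real.log n) * Real.sqrt (Real.log n) :=
      (Real.mul_self_sqrt (by linarith)).symm
    calc C / Real.log n = C / (Real.sqrt (Real.log n) * Real.sqrt (Real.log n)) := by rw [← hLS]
      _ ≤ (Real.sqrt (Real.log n) * (2 * (1 + ε) * σ x)) / (Real.sqrt (Real.log n) * Real.sqrt (Real.log n)) := by gcongr
      _ = _ := by field_simp

end
end

section
/- Let d ≥ 1, let ρ be a probability density on ℝ^d with finite variance and support Ω with closure Ω̄ ≠ ℝ^d. Fix x ∉ Ω̄ and assume the growth condition ∫ ρ(y)·|f(y)|/(1+‖y‖^d) d^d y < ∞. Then the expectation of the Hilbert kernel estimator converges: f̂_∞(x) := lim_{n→∞} E[f̂(x)] = (∫ ρ(y)·f(y)·‖x−y‖^{−d} d^d y) / (∫ ρ(y)·‖x−y‖^{−d} d^d y), and the function f̂_∞ is continuous at every point x ∉ Ω̄. -/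
open MeasureTheory Filter

noncomputable section

/-- The expectation `E[f̂(x)] = E[Σ_i w_i(x)·f(X_i)]` of the Hilbert kernel regression
estimator (the `Y`-averages having been taken via the regression function `f`),
expressed as an integral against the product density `∏ ρ(x_i)`. -/
def hilbertEstExp (d n : ℕ) (x : Euc d) (ρ f : Euc d → ℝ) : ℝ :=
  ∫ xs : Fin (n + 1) → Euc d,
    (∑ i : Fin (n + 1), hilbertWeight d n x xs i * f (xs i)) *
      ∏ i : Fin (n + 1), ρ (xs i)

/-- The large-sample extrapolation function of the Hilbert kernel regression scheme,
`f̂_∞(z) = (∫ ρ(y)·f(y)·‖z−y‖^{−d} dy) / (∫ ρ(y)·‖z−y‖^{−d} dy)`. -/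
def hilbertExtrapolation (d : ℕ) (ρ f : Euc d → ℝ) (z : Euc d) : ℝ :=
  (∫ y : Euc d, ρ y * f y * ‖z - y‖ ^ (-(d : ℝ))) /
    ∫ y : Euc d, ρ y * ‖z - y‖ ^ (-(d : ℝ))

lemma hk_pi_withDensity {E : Type*} [MeasureSpace E] [SigmaFinite (volume : Measure E)]
    (ρ : E → ℝ) (h0 : ∀ y, 0 ≤ ρ y) (hi : Integrable ρ) (n : ℕ)
    [SigmaFinite ((volume : Measure E).withDensity (fun y => ENNReal.ofReal (ρ y)))] :
    Measure.pi (fun _ : Fin n => (volume : Measure E).withDensity (fun y => ENNReal.ofReal (ρ y)))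
      = (volume : Measure (Fin n → E)).withDensity
          (fun xs => ENNReal.ofReal (∏ i, ρ (xs i))) := by
  refine Measure.pi_eq fun s hs => ?_
  rw [withDensity_apply _ (MeasurableSet.univ_pi hs), ← lintegral_indicator (MeasurableSet.univ_pi hs)]
  have e1 : ∀ xs : Fin n → E, (Set.univ.pi s).indicator
      (fun xs => ENNReal.ofReal (∏ i, ρ (xs i))) xs
      = ENNReal.ofReal (∏ i, (s i).indicator ρ (xs i)) := by
    intro xs
    by_cases h : xs ∈ Set.univ.pi s
    · rw [Set.indicator_of_mem h]
      congr 1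
      refine Finset.prod_congr rfl fun i _ => ?_
      rw [Set.indicator_of_mem (h i trivial)]
    · rw [Set.indicator_of_notMem h]
      simp only [Set.mem_pi, Set.mem_univ, true_imp_iff, not_forall] at h
      obtain ⟨i, hi⟩ := h
      rw [Finset.prod_eq_zero (Finset.mem_univ i) (Set.indicator_of_notMem hi _)]
      simp
  simp_rw [e1]
  rw [volume_pi]
  have hii : ∀ i, Integrable ((s i).indicator ρ) := fun i => hi.indicator (hs i)
  have hpos : ∀ i y, 0 ≤ (s i).indicator ρ y := fun i y => Set.indicator_nonneg (fun y _ => h0 y) y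
  rw [← ofReal_integral_eq_lintegral_ofReal
    (Integrable.fintype_prod_dep (f := fun i => (s i).indicator ρ) hii)
    (Eventually.of_forall fun xs => Finset.prod_nonneg fun i _ => hpos i _),
    integral_fintype_prod_eq_prod (fun i => (s i).indicator ρ),
    ENNReal.ofReal_prod_of_nonneg (fun i _ => integral_nonneg (hpos i))]
  refine Finset.prod_congr rfl fun i _ => ?_
  rw [withDensity_apply _ (hs i), integral_indicator (hs i),
    ofReal_integral_eq_lintegral_ofReal hi.integrableOn (Eventually.of_forall h0)]

section core
variable {E : Type*} [MeasurableSpace E] (ν : Measure E) [IsProbabilityMeasure ν]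
  (K h f : E → ℝ)

/-- second negative moment -/
lemma hk_negmoment (hKm : Measurable K) (d : ℕ) (hh : ∀ y, 0 < h y) (hK : ∀ y, 0 < K y)
    (hKh : ∀ y, K y ^ 2 * h y ^ d = 1) (hhi : Integrable h ν) (hhm : Measurable h)
    (n : ℕ) (hn : 1 ≤ n) (hnd : d ≤ n) :
    Integrable (fun xs : Fin n → E => ((n : ℝ) / ∑ j, K (xs j)) ^ 2) (Measure.pi fun _ => ν) ∧
    ∫ xs : Fin n → E, ((n : ℝ) / ∑ j, K (xs j)) ^ 2 ∂(Measure.pi fun _ => ν)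
      ≤ Real.exp (d * (∫ y, h y ∂ν - 1)) := by
  have hn0 : (0 : ℝ) < n := by exact_mod_cast hn
  have hθ1 : (d : ℝ) / n ≤ 1 := by rw [div_le_one hn0]; exact_mod_cast hnd
  have hθ0 : 0 ≤ (d : ℝ) / n := by positivity
  have hbern : ∀ y, h y ^ ((d : ℝ) / n) ≤ 1 + (d : ℝ) / n * (h y - 1) := by
    intro y
    have := rpow_one_add_le_one_add_mul_self (s := h y - 1) (by linarith [hh y]) hθ0 hθ1
    simpa using this
  have hbi : Integrable (fun y => 1 + (d : ℝ) / n * (h y - 1)) ν :=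
    (integrable_const _).add ((hhi.sub (integrable_const _)).const_mul _)
  have hi1 : Integrable (fun y => h y ^ ((d : ℝ) / n)) ν := by
    refine hbi.mono' (hhm.pow_const _).aestronglyMeasurable (Eventually.of_forall fun y => ?_)
    rw [Real.norm_of_nonneg (Real.rpow_nonneg (hh y).le _)]
    exact hbern y
  have hint : ∫ y, h y ^ ((d : ℝ) / n) ∂ν ≤ Real.exp ((d : ℝ) / n * (∫ y, h y ∂ν - 1)) := by
    calc _ ≤ ∫ y, (1 + (d : ℝ) / n * (h y - 1)) ∂ν := integral_mono hi1 hbi hbern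
      _ = 1 + (d : ℝ) / n * (∫ y, h y ∂ν - 1) := by
        have e2 : Integrable (fun y => (d : ℝ) / n * (h y - 1)) ν :=
          (hhi.sub (integrable_const _)).const_mul _
        rw [integral_add (integrable_const _) e2,
          integral_const_mul, integral_sub hhi (integrable_const _)]
        simp
      _ ≤ _ := by rw [add_comm]; exact Real.add_one_le_exp _
  have hpt : ∀ xs : Fin n → E,
      ((n : ℝ) / ∑ j, K (xs j)) ^ 2 ≤ ∏ j, h (xs j) ^ ((d : ℝ) / n) := by
    intro xs
    have : Nonempty (Fin n) := ⟨⟨0, hn⟩⟩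
    have hS : 0 < ∑ j, K (xs j) := Finset.sum_pos (fun j _ => hK _) Finset.univ_nonempty
    have ag := Real.geom_mean_le_arith_mean_weighted Finset.univ (fun _ : Fin n => (n : ℝ)⁻¹)
      (fun j => K (xs j)) (fun _ _ => by positivity) (by simp [hn0.ne']) (fun j _ => (hK _).le)
    rw [← Finset.mul_sum] at ag
    have hP : 0 < ∏ j, K (xs j) ^ ((n : ℝ)⁻¹) :=
      Finset.prod_pos fun j _ => Real.rpow_pos_of_pos (hK _) _
    have hone : (∏ j, K (xs j) ^ ((n : ℝ)⁻¹)) ^ 2 * ∏ j, h (xs j) ^ ((d : ℝ) / n) = 1 := by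
      rw [← Finset.prod_pow, ← Finset.prod_mul_distrib]
      refine Finset.prod_eq_one fun j _ => ?_
      rw [div_eq_mul_inv, Real.rpow_mul (hh _).le, Real.rpow_natCast, ← Real.rpow_natCast,
        ← Real.rpow_mul (hK _).le, mul_comm (n : ℝ)⁻¹, Real.rpow_mul (hK _).le,
        Real.rpow_natCast, ← Real.mul_rpow (by positivity) (pow_nonneg (hh _).le _), hKh,
        Real.one_rpow]
    have hQ : 0 ≤ ∏ j, h (xs j) ^ ((d : ℝ) / n) :=
      Finset.prod_nonneg fun j _ => Real.rpow_nonneg (hh _).le _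
    calc ((n : ℝ) / ∑ j, K (xs j)) ^ 2
        = ((n : ℝ) / ∑ j, K (xs j)) ^ 2 * ((∏ j, K (xs j) ^ ((n : ℝ)⁻¹)) ^ 2 * ∏ j, h (xs j) ^ ((d : ℝ) / n)) := by rw [hone, mul_one]
      _ ≤ ((n : ℝ) / ∑ j, K (xs j)) ^ 2 * (((n : ℝ)⁻¹ * ∑ j, K (xs j)) ^ 2 * ∏ j, h (xs j) ^ ((d : ℝ) / n)) := by
        gcongr
      _ = _ := by field_simp
  have hI : Integrable (fun xs : Fin n → E => ∏ j, h (xs j) ^ ((d : ℝ) / n))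
      (Measure.pi fun _ => ν) :=
    Integrable.fintype_prod (f := fun _ y => h y ^ ((d : ℝ) / n)) (fun _ => hi1)
  have hI2 : Integrable (fun xs : Fin n → E => ((n : ℝ) / ∑ j, K (xs j)) ^ 2)
      (Measure.pi fun _ => ν) := by
    refine hI.mono' (Measurable.aestronglyMeasurable (by fun_prop))
      (Eventually.of_forall fun xs => ?_)
    rw [Real.norm_of_nonneg (sq_nonneg _)]
    exact hpt xs
  refine ⟨hI2, (integral_mono hI2 hI hpt).trans ?_⟩
  rw [integral_fintype_prod_eq_pow (fun y => h y ^ ((d : ℝ) / n)), Fintype.card_fin]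
  calc _ ≤ Real.exp ((d : ℝ) / n * (∫ y, h y ∂ν - 1)) ^ n := by
        gcongr
        exact integral_nonneg fun y => Real.rpow_nonneg (hh _).le _
    _ = _ := by
        rw [← Real.exp_nat_mul]; congr 1; field_simp

lemma hk_var (hKm : Measurable K) (hK : ∀ y, 0 < K y) (B : ℝ) (hB : ∀ y, K y ≤ B)
    (n : ℕ) :
    Integrable (fun xs : Fin n → E => (∑ j, K (xs j) - n * ∫ y, K y ∂ν) ^ 2)
      (Measure.pi fun _ => ν) ∧
    ∫ xs : Fin n → E, (∑ j, K (xs j) - n * ∫ y, K y ∂ν) ^ 2 ∂(Measure.pi fun _ => ν)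
      = n * ProbabilityTheory.variance K ν := by
  have hL : MemLp K 2 ν := MemLp.of_bound hKm.aestronglyMeasurable B
    (Eventually.of_forall fun y => by rw [Real.norm_of_nonneg (hK y).le]; exact hB y)
  have hKi : Integrable K ν := hL.integrable (by norm_num)
  have hLi : ∀ i : Fin n, MemLp (fun xs : Fin n → E => K (xs i)) 2 (Measure.pi fun _ => ν) :=
    fun i => hL.comp_measurePreserving (measurePreserving_eval _ i)
  have hLS : MemLp (∑ i, fun xs : Fin n → E => K (xs i)) 2 (Measure.pi fun _ => ν) :=
    memLp_finsetSum' _ fun i _ => hLi i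
  have hmean : ∫ xs : Fin n → E, (∑ i, fun xs : Fin n → E => K (xs i)) xs
      ∂(Measure.pi fun _ => ν) = n * ∫ y, K y ∂ν := by
    simp only [Finset.sum_apply]
    rw [integral_finsetSum _ fun i _ => (hLi i).integrable (by norm_num)]
    simp_rw [integral_comp_eval (μ := fun _ : Fin n => ν) hKm.aestronglyMeasurable]
    simp
  have hv := ProbabilityTheory.variance_sum_pi (ι := Fin n) (μ := fun _ => ν)
    (X := fun _ => K) (fun _ => hL)
  rw [ProbabilityTheory.variance_eq_integral hLS.aemeasurable, hmean] at hv
  simp only [Finset.sum_apply, Finset.sum_const, Finset.card_univ, Fintype.card_fin,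
    nsmul_eq_mul] at hv
  refine ⟨?_, hv⟩
  have := (hLS.sub (memLp_const (n * ∫ y, K y ∂ν))).integrable_sq
  simpa using this


lemma hk_W (hKm : Measurable K) (d : ℕ) (hh : ∀ y, 0 < h y) (hK : ∀ y, 0 < K y)
    (hKh : ∀ y, K y ^ 2 * h y ^ d = 1) (hhi : Integrable h ν) (hhm : Measurable h)
    (B : ℝ) (hB0 : 0 ≤ B) (hB : ∀ y, K y ≤ B)
    (n : ℕ) (hn : 1 ≤ n) (hnd : d ≤ n) :
    Integrable (fun xs : Fin n → E => (B + |∑ j, K (xs j) - n * ∫ y, K y ∂ν|) / ∑ j, K (xs j))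
      (Measure.pi fun _ => ν) ∧
    ∫ xs : Fin n → E, (B + |∑ j, K (xs j) - n * ∫ y, K y ∂ν|) / ∑ j, K (xs j)
        ∂(Measure.pi fun _ => ν)
      ≤ B / √n ^ 2 * (1 + Real.exp (d * (∫ y, h y ∂ν - 1))) +
        (ProbabilityTheory.variance K ν / √n + Real.exp (d * (∫ y, h y ∂ν - 1)) / √n) := by
  obtain ⟨hu, hu'⟩ := hk_negmoment ν K h hKm d hh hK hKh hhi hhm n hn hnd
  obtain ⟨hv, hv'⟩ := hk_var ν K hKm hK B hB n
  set m := ∫ y, K y ∂ν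
  have hn0 : (0 : ℝ) < n := by exact_mod_cast hn
  have hs : 0 < √(n : ℝ) := Real.sqrt_pos.2 hn0
  have hs2 : √(n : ℝ) ^ 2 = n := Real.sq_sqrt hn0.le
  set s := √(n : ℝ)
  have hDi : Integrable (fun xs : Fin n → E => B / s ^ 2 * (1 + ((n : ℝ) / ∑ j, K (xs j)) ^ 2) +
      ((∑ j, K (xs j) - n * m) ^ 2 / s ^ 3 + ((n : ℝ) / ∑ j, K (xs j)) ^ 2 / s))
      (Measure.pi fun _ => ν) :=
    (((integrable_const _).add hu).const_mul _).add ((hv.div_const _).add (hu.div_const _))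
  have hpt : ∀ xs : Fin n → E, (B + |∑ j, K (xs j) - n * m|) / ∑ j, K (xs j) ≤
      B / s ^ 2 * (1 + ((n : ℝ) / ∑ j, K (xs j)) ^ 2) +
      ((∑ j, K (xs j) - n * m) ^ 2 / s ^ 3 + ((n : ℝ) / ∑ j, K (xs j)) ^ 2 / s) := by
    intro xs
    have : Nonempty (Fin n) := ⟨⟨0, hn⟩⟩
    have hS : 0 < ∑ j, K (xs j) := Finset.sum_pos (fun j _ => hK _) Finset.univ_nonempty
    set T := ∑ j, K (xs j)
    set u := (n : ℝ) / T with hu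
    have e1 : (B + |T - n * m|) / T = B / s ^ 2 * u + (|T - n * m| / s ^ 2) * u := by
      rw [hu, ← hs2]; field_simp
    rw [e1]
    have e2 : u ≤ 1 + u ^ 2 := by nlinarith [sq_nonneg (u - 1)]
    have e3 : (|T - n * m| / s ^ 2) * u ≤ (T - n * m) ^ 2 / s ^ 3 + u ^ 2 / s := by
      rw [← sq_abs (T - n * m)]
      set a := |T - n * m|
      have : a ^ 2 / s ^ 3 + u ^ 2 / s - (a / s ^ 2) * u
          = ((a / s - u / 2) ^ 2 + 3 / 4 * u ^ 2) / s := by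
        field_simp; ring
      have h2 : 0 ≤ ((a / s - u / 2) ^ 2 + 3 / 4 * u ^ 2) / s := by positivity
      linarith
    gcongr
  have hWi : Integrable (fun xs : Fin n → E => (B + |∑ j, K (xs j) - n * m|) / ∑ j, K (xs j))
      (Measure.pi fun _ => ν) := by
    refine hDi.mono' (Measurable.aestronglyMeasurable (by fun_prop))
      (Eventually.of_forall fun xs => ?_)
    rw [Real.norm_of_nonneg (div_nonneg (by positivity) (Finset.sum_nonneg fun j _ => (hK _).le))]
    exact hpt xs
  refine ⟨hWi, (integral_mono hWi hDi hpt).trans ?_⟩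
  have i1 : Integrable (fun xs : Fin n → E => B / s ^ 2 * (1 + ((n : ℝ) / ∑ j, K (xs j)) ^ 2))
      (Measure.pi fun _ => ν) := ((integrable_const _).add hu).const_mul _
  have i2 : Integrable (fun xs : Fin n → E => (∑ j, K (xs j) - n * m) ^ 2 / s ^ 3)
      (Measure.pi fun _ => ν) := hv.div_const _
  have i3 : Integrable (fun xs : Fin n → E => ((n : ℝ) / ∑ j, K (xs j)) ^ 2 / s)
      (Measure.pi fun _ => ν) := hu.div_const _
  have i23 : Integrable (fun xs : Fin n → E => (∑ j, K (xs j) - n * m) ^ 2 / s ^ 3 +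
      ((n : ℝ) / ∑ j, K (xs j)) ^ 2 / s) (Measure.pi fun _ => ν) := i2.add i3
  rw [integral_add i1 i23, integral_add i2 i3, integral_const_mul,
    integral_add (integrable_const _) hu, integral_div, integral_div, hv']
  have e : n * ProbabilityTheory.variance K ν / s ^ 3 = ProbabilityTheory.variance K ν / s := by
    rw [← hs2]; field_simp
  rw [e]
  simp only [integral_const, probReal_univ, one_smul]
  gcongr

lemma hk_core_bound (hKm : Measurable K) (hfm : Measurable f)
    (d : ℕ) (hh : ∀ y, 0 < h y) (hK : ∀ y, 0 < K y)
    (hKh : ∀ y, K y ^ 2 * h y ^ d = 1) (hhi : Integrable h ν) (hhm : Measurable h)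
    (B : ℝ) (hB0 : 0 ≤ B) (hB : ∀ y, K y ≤ B) (hg : Integrable (fun y => K y * f y) ν)
    (hm : 0 < ∫ y, K y ∂ν)
    (n : ℕ) (hn : 1 ≤ n) (hnd : d ≤ n) :
    |∫ xs : Fin (n + 1) → E, (∑ i, K (xs i) / (∑ j, K (xs j)) * f (xs i))
        ∂(Measure.pi fun _ => ν) - (∫ y, K y * f y ∂ν) / ∫ y, K y ∂ν| ≤
      (∫ y, |K y * f y| ∂ν) / (∫ y, K y ∂ν) * (B / √n ^ 2 * (1 + Real.exp (d * (∫ y, h y ∂ν - 1))) +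
        (ProbabilityTheory.variance K ν / √n + Real.exp (d * (∫ y, h y ∂ν - 1)) / √n)) := by
  obtain ⟨hWi, hW'⟩ := hk_W ν K h hKm d hh hK hKh hhi hhm B hB0 hB n hn hnd
  set m := ∫ y, K y ∂ν with hmdef
  set W : (Fin n → E) → ℝ := fun xs => (B + |∑ j, K (xs j) - n * m|) / ∑ j, K (xs j) with hWdef
  set P : Measure (Fin (n + 1) → E) := Measure.pi fun _ => ν with hP
  have hmB : m ≤ B := by
    have hKi : Integrable K ν := Integrable.of_bound hKm.aestronglyMeasurable B
      (Eventually.of_forall fun y => by rw [Real.norm_of_nonneg (hK y).le]; exact hB y)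
    calc m ≤ ∫ _, B ∂ν := integral_mono hKi (integrable_const _) hB
      _ = B := by simp
  have hgW : ∀ i : Fin (n + 1),
      Integrable (fun xs : Fin (n + 1) → E => |K (xs i) * f (xs i)| * W (fun j => xs (i.succAbove j))) P ∧
      ∫ xs : Fin (n + 1) → E, |K (xs i) * f (xs i)| * W (fun j => xs (i.succAbove j)) ∂P
        = (∫ y, |K y * f y| ∂ν) * ∫ ys, W ys ∂(Measure.pi fun _ => ν) := by
    intro i
    have mp := measurePreserving_piFinSuccAbove (fun _ : Fin (n + 1) => ν) i
    have hpr : Integrable (fun z : E × (Fin n → E) => |K z.1 * f z.1| * W z.2)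
        (ν.prod (Measure.pi fun _ => ν)) := Integrable.mul_prod hg.abs hWi
    refine ⟨mp.integrable_comp_of_integrable hpr, ?_⟩
    rw [← integral_prod_mul (fun y => |K y * f y|) W]
    exact mp.integral_comp' (fun z : E × (Fin n → E) => |K z.1 * f z.1| * W z.2)
  set D : Fin (n + 1) → (Fin (n + 1) → E) → ℝ := fun i xs =>
    K (xs i) * f (xs i) * ((∑ j, K (xs j))⁻¹ - ((n + 1) * m)⁻¹) with hD
  have hDb : ∀ i xs, |D i xs| ≤
      |K (xs i) * f (xs i)| * W (fun j => xs (i.succAbove j)) / ((n + 1) * m) := by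
    intro i xs
    have : Nonempty (Fin n) := ⟨⟨0, hn⟩⟩
    have hT : 0 < ∑ j, K (xs (i.succAbove j)) :=
      Finset.sum_pos (fun j _ => hK _) Finset.univ_nonempty
    simp only [hD, hWdef]
    rw [Fin.sum_univ_succAbove _ i, abs_mul, mul_div_assoc]
    refine mul_le_mul_of_nonneg_left ?_ (abs_nonneg _)
    set T := ∑ j, K (xs (i.succAbove j))
    have hk := hK (xs i)
    have hkB := hB (xs i)
    set k := K (xs i)
    have hn1 : (0 : ℝ) < n + 1 := by positivity
    rw [inv_sub_inv (by positivity) (by positivity), abs_div, abs_of_pos (a := (k + T) * _) (by positivity),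
      div_div]
    have hnum : |(n + 1) * m - (k + T)| ≤ B + |T - n * m| := by
      have e : (n + 1) * m - (k + T) = (m - k) + (n * m - T) := by ring
      rw [e, abs_sub_comm T]
      refine (abs_add_le _ _).trans (add_le_add_left ?_ _)
      rw [abs_le]; constructor <;> linarith
    gcongr
    linarith
  have hDi : ∀ i, Integrable (D i) P := by
    intro i
    refine ((hgW i).1.div_const ((n + 1) * m)).mono'
      (Measurable.aestronglyMeasurable (by fun_prop)) (Eventually.of_forall fun xs => ?_)
    exact hDb i xs
  have hgi : ∀ i : Fin (n + 1), Integrable (fun xs : Fin (n + 1) → E => K (xs i) * f (xs i)) P :=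
    fun i => integrable_comp_eval (μ := fun _ : Fin (n + 1) => ν) (i := i) hg
  have hgint : ∀ i : Fin (n + 1), ∫ xs : Fin (n + 1) → E, K (xs i) * f (xs i) ∂P
      = ∫ y, K y * f y ∂ν := fun i =>
    integral_comp_eval (μ := fun _ : Fin (n + 1) => ν) (i := i) hg.aestronglyMeasurable
  have hn1 : (0 : ℝ) < n + 1 := by positivity
  have hsplit : ∫ xs : Fin (n + 1) → E, (∑ i, K (xs i) / (∑ j, K (xs j)) * f (xs i)) ∂P
      - (∫ y, K y * f y ∂ν) / m = ∑ i, ∫ xs, D i xs ∂P := by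
    have e1 : ∀ xs : Fin (n + 1) → E, (∑ i, K (xs i) / (∑ j, K (xs j)) * f (xs i))
        = ∑ i, (D i xs + K (xs i) * f (xs i) * ((n + 1) * m)⁻¹) := by
      intro xs
      refine Finset.sum_congr rfl fun i _ => ?_
      simp only [hD]; ring
    simp_rw [e1]
    have e3 : ∀ i : Fin (n + 1), Integrable
        (fun xs => D i xs + K (xs i) * f (xs i) * ((n + 1) * m)⁻¹) P :=
      fun i => (hDi i).add ((hgi i).mul_const _)
    rw [integral_finsetSum _ fun i _ => e3 i]
    have e2 : ∀ i : Fin (n + 1), ∫ xs, (D i xs + K (xs i) * f (xs i) * ((n + 1) * m)⁻¹) ∂P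
        = ∫ xs, D i xs ∂P + (∫ y, K y * f y ∂ν) * ((n + 1) * m)⁻¹ := by
      intro i
      rw [integral_add (hDi i) ((hgi i).mul_const _), integral_mul_const, hgint]
    simp_rw [e2]
    rw [Finset.sum_add_distrib]
    simp only [Finset.sum_const, Finset.card_univ, Fintype.card_fin, nsmul_eq_mul]
    push_cast
    field_simp
    ring
  rw [hsplit]
  calc |∑ i, ∫ xs, D i xs ∂P| ≤ ∑ i, |∫ xs, D i xs ∂P| := Finset.abs_sum_le_sum_abs _ _
    _ ≤ ∑ i : Fin (n + 1), (∫ y, |K y * f y| ∂ν) * (∫ ys, W ys ∂(Measure.pi fun _ => ν)) / ((n + 1) * m) := by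
      refine Finset.sum_le_sum fun i _ => ?_
      refine abs_integral_le_integral_abs.trans ?_
      rw [← (hgW i).2, ← integral_div]
      exact integral_mono (hDi i).abs ((hgW i).1.div_const _) (hDb i)
    _ = (∫ y, |K y * f y| ∂ν) / m * ∫ ys, W ys ∂(Measure.pi fun _ => ν) := by
      simp only [Finset.sum_const, Finset.card_univ, Fintype.card_fin, nsmul_eq_mul]
      push_cast
      field_simp
    _ ≤ _ := by
      refine mul_le_mul_of_nonneg_left hW' (div_nonneg (integral_nonneg fun y => abs_nonneg _) hm.le)

lemma hk_core_s16 (hKm : Measurable K) (hfm : Measurable f)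
    (d : ℕ) (hh : ∀ y, 0 < h y) (hK : ∀ y, 0 < K y)
    (hKh : ∀ y, K y ^ 2 * h y ^ d = 1) (hhi : Integrable h ν) (hhm : Measurable h)
    (B : ℝ) (hB0 : 0 ≤ B) (hB : ∀ y, K y ≤ B) (hg : Integrable (fun y => K y * f y) ν)
    (hm : 0 < ∫ y, K y ∂ν) :
    Tendsto (fun n : ℕ => ∫ xs : Fin (n + 1) → E, (∑ i, K (xs i) / (∑ j, K (xs j)) * f (xs i))
        ∂(Measure.pi fun _ => ν)) atTop (nhds ((∫ y, K y * f y ∂ν) / ∫ y, K y ∂ν)) := by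
  rw [tendsto_iff_dist_tendsto_zero]
  have hs : Tendsto (fun n : ℕ => √(n : ℝ)) atTop atTop :=
    Real.tendsto_sqrt_atTop.comp tendsto_natCast_atTop_atTop
  have hs2 : Tendsto (fun n : ℕ => √(n : ℝ) ^ 2) atTop atTop :=
    (tendsto_pow_atTop two_ne_zero).comp hs
  have hlim := (((hs2.const_div_atTop B).mul_const (1 + Real.exp (d * (∫ y, h y ∂ν - 1)))).add
    ((hs.const_div_atTop (ProbabilityTheory.variance K ν)).add
      (hs.const_div_atTop (Real.exp (d * (∫ y, h y ∂ν - 1)))))).const_mul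
      ((∫ y, |K y * f y| ∂ν) / (∫ y, K y ∂ν))
  simp only [zero_mul, add_zero, mul_zero] at hlim
  refine squeeze_zero' (Eventually.of_forall fun n => dist_nonneg) ?_ hlim
  filter_upwards [eventually_ge_atTop (max 1 d)] with n hn
  rw [Real.dist_eq]
  exact hk_core_bound ν K h f hKm hfm d hh hK hKh hhi hhm B hB0 hB hg hm n
    (le_of_max_le_left hn) (le_of_max_le_right hn)

end core

lemma hk_integral_wd {E : Type*} [MeasureSpace E] (ρ : E → ℝ) (hm : Measurable ρ)
    (h0 : ∀ y, 0 ≤ ρ y) (g : E → ℝ) :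
    ∫ y, g y ∂((volume : Measure E).withDensity (fun y => ENNReal.ofReal (ρ y)))
      = ∫ y, ρ y * g y := by
  rw [integral_withDensity_eq_integral_toReal_smul hm.ennreal_ofReal
    (Eventually.of_forall fun y => ENNReal.ofReal_lt_top)]
  simp [ENNReal.toReal_ofReal (h0 _)]

lemma hk_integrable_wd {E : Type*} [MeasureSpace E] (ρ : E → ℝ) (hm : Measurable ρ)
    (h0 : ∀ y, 0 ≤ ρ y) (g : E → ℝ) (hg : Integrable (fun y => ρ y * g y)) :
    Integrable g ((volume : Measure E).withDensity (fun y => ENNReal.ofReal (ρ y))) := by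
  rw [integrable_withDensity_iff_integrable_smul' hm.ennreal_ofReal
    (Eventually.of_forall fun y => ENNReal.ofReal_lt_top)]
  simpa [ENNReal.toReal_ofReal (h0 _)] using hg

lemma hk_bound (d : ℕ) (S : Set (Euc d)) (z : Euc d) (hz : z ∉ closure S) :
    ∃ r > 0, ∃ C : ℝ, 0 ≤ C ∧ ∀ z' ∈ Metric.ball z r, ∀ y ∈ S, 0 < ‖z' - y‖ ∧
      ‖z' - y‖ ^ (-(d : ℝ)) ≤ C / (1 + ‖y‖ ^ (d : ℝ)) := by
  rw [Metric.mem_closure_iff] at hz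
  push Not at hz
  obtain ⟨ε, hε, hS⟩ := hz
  set c : ℝ := (1 + ‖z‖ + ε / 2) / (ε / 2) + 1 with hc
  have hc0 : 0 < c := by positivity
  refine ⟨ε / 2, by positivity, 2 * c ^ d, by positivity, fun z' hz' y hy => ?_⟩
  have h1 : ε / 2 ≤ ‖z' - y‖ := by
    have := hS y hy
    have h2 := dist_triangle z z' y
    rw [Metric.mem_ball, dist_comm] at hz'
    rw [← dist_eq_norm]; linarith
  have hpos : 0 < ‖z' - y‖ := by linarith
  refine ⟨hpos, ?_⟩
  have h3 : 1 + ‖y‖ ≤ c * ‖z' - y‖ := by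
    have a1 : ‖y‖ ≤ ‖z‖ + ε / 2 + ‖z' - y‖ := by
      have b1 : ‖y‖ ≤ ‖z'‖ + ‖z' - y‖ := by
        have := norm_sub_le z' (z' - y)
        simpa using this
      have b2 : ‖z'‖ ≤ ‖z‖ + ‖z' - z‖ := by
        have := norm_add_le z (z' - z)
        simpa using this
      rw [Metric.mem_ball, dist_eq_norm] at hz'
      linarith
    have a2 : (1 + ‖z‖ + ε / 2) ≤ (1 + ‖z‖ + ε / 2) / (ε / 2) * ‖z' - y‖ := by
      calc (1 + ‖z‖ + ε / 2) = (1 + ‖z‖ + ε / 2) / (ε / 2) * (ε / 2) := by field_simp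
        _ ≤ _ := by gcongr
    rw [hc, add_mul, one_mul]; linarith
  rw [Real.rpow_neg hpos.le, Real.rpow_natCast, Real.rpow_natCast, inv_eq_one_div,
    div_le_div_iff₀ (by positivity) (by positivity), one_mul, mul_assoc, ← mul_pow]
  have h4 : (1 + ‖y‖) ^ d ≤ (c * ‖z' - y‖) ^ d := by gcongr
  have h5 : (1 : ℝ) ≤ (1 + ‖y‖) ^ d := one_le_pow₀ (by linarith [norm_nonneg y])
  have h6 : ‖y‖ ^ d ≤ (1 + ‖y‖) ^ d := by gcongr; linarith
  linarith

/-- kernel modified off the support -/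
def hkK (d : ℕ) (ρ : Euc d → ℝ) (z : Euc d) (y : Euc d) : ℝ :=
  open scoped Classical in if 0 < ρ y then ‖z - y‖ ^ (-(d : ℝ)) else 1

/-- squared distance modified off the support -/
def hkh (d : ℕ) (ρ : Euc d → ℝ) (z : Euc d) (y : Euc d) : ℝ :=
  open scoped Classical in if 0 < ρ y then ‖z - y‖ ^ 2 else 1

lemma hkK_mul (d : ℕ) (ρ : Euc d → ℝ) (h0 : ∀ y, 0 ≤ ρ y) (z y : Euc d) :
    ρ y * hkK d ρ z y = ρ y * ‖z - y‖ ^ (-(d : ℝ)) := by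
  unfold hkK
  split_ifs with h
  · rfl
  · rw [le_antisymm (not_lt.1 h) (h0 y)]; simp

lemma hkh_mul (d : ℕ) (ρ : Euc d → ℝ) (h0 : ∀ y, 0 ≤ ρ y) (z y : Euc d) :
    ρ y * hkh d ρ z y = ρ y * ‖z - y‖ ^ 2 := by
  unfold hkh
  split_ifs with h
  · rfl
  · rw [le_antisymm (not_lt.1 h) (h0 y)]; simp

lemma hkK_meas (d : ℕ) (ρ : Euc d → ℝ) (hm : Measurable ρ) (z : Euc d) :
    Measurable (hkK d ρ z) := by
  unfold hkK
  exact Measurable.ite (measurableSet_lt measurable_const hm) (by fun_prop) measurable_const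

lemma hkh_meas (d : ℕ) (ρ : Euc d → ℝ) (hm : Measurable ρ) (z : Euc d) :
    Measurable (hkh d ρ z) := by
  unfold hkh
  exact Measurable.ite (measurableSet_lt measurable_const hm) (by fun_prop) measurable_const

lemma hk_facts (d : ℕ) (ρ : Euc d → ℝ) (z : Euc d) (hz : z ∉ closure {y | 0 < ρ y}) :
    (∀ y, 0 < hkK d ρ z y) ∧ (∀ y, 0 < hkh d ρ z y) ∧
    (∀ y, hkK d ρ z y ^ 2 * hkh d ρ z y ^ d = 1) ∧ ∃ B, 0 ≤ B ∧ ∀ y, hkK d ρ z y ≤ B := by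
  obtain ⟨r, hr, C, hC, hb⟩ := hk_bound d _ z hz
  have hb' : ∀ y, 0 < ρ y → _ := fun y hy => hb z (Metric.mem_ball_self hr) y hy
  refine ⟨fun y => ?_, fun y => ?_, fun y => ?_, max C 1, by positivity, fun y => ?_⟩
  · unfold hkK; split_ifs with h
    · exact Real.rpow_pos_of_pos (hb' y h).1 _
    · exact one_pos
  · unfold hkh; split_ifs with h
    · have := (hb' y h).1
      positivity
    · exact one_pos
  · unfold hkK hkh; split_ifs with h
    · have := (hb' y h).1
      rw [Real.rpow_neg this.le, Real.rpow_natCast]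
      field_simp
      rw [← pow_mul, ← pow_mul, mul_comm]
    · simp
  · unfold hkK; split_ifs with h
    · refine (hb' y h).2.trans ((div_le_self hC ?_).trans (le_max_left _ _))
      have := Real.rpow_nonneg (norm_nonneg y) (d : ℝ)
      linarith
    · exact le_max_right _ _

lemma hk_contAt (d : ℕ) (ρ g : Euc d → ℝ) (h0 : ∀ y, 0 ≤ ρ y) (hm : Measurable ρ)
    (hgm : Measurable g)
    (hg : Integrable (fun y => ρ y * |g y| / (1 + ‖y‖ ^ (d : ℝ))))
    (z : Euc d) (hz : z ∉ closure {y | 0 < ρ y}) :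
    Integrable (fun y => ρ y * g y * ‖z - y‖ ^ (-(d : ℝ))) ∧
    ContinuousAt (fun z : Euc d => ∫ y : Euc d, ρ y * g y * ‖z - y‖ ^ (-(d : ℝ))) z := by
  obtain ⟨r, hr, C, hC, hb⟩ := hk_bound d _ z hz
  have hmeas : ∀ z' : Euc d, AEStronglyMeasurable (fun y => ρ y * g y * ‖z' - y‖ ^ (-(d : ℝ)))
      volume := fun z' => Measurable.aestronglyMeasurable (by fun_prop)
  have hbd : ∀ z' ∈ Metric.ball z r, ∀ y, ‖ρ y * g y * ‖z' - y‖ ^ (-(d : ℝ))‖ ≤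
      C * (ρ y * |g y| / (1 + ‖y‖ ^ (d : ℝ))) := by
    intro z' hz' y
    rcases (h0 y).eq_or_lt with h | h
    · simp [← h]
    · have := (hb z' hz' y h).2
      rw [norm_mul, norm_mul, Real.norm_of_nonneg (h0 y), Real.norm_eq_abs (g y),
        Real.norm_of_nonneg (Real.rpow_nonneg (norm_nonneg _) _)]
      calc _ ≤ ρ y * |g y| * (C / (1 + ‖y‖ ^ (d : ℝ))) :=
            mul_le_mul_of_nonneg_left this (mul_nonneg h.le (abs_nonneg _))
        _ = _ := by ring
  refine ⟨(hg.const_mul C).mono' (hmeas z) (Eventually.of_forall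
    (hbd z (Metric.mem_ball_self hr))), ?_⟩
  refine continuousAt_of_dominated (Eventually.of_forall hmeas)
    (bound := fun y => C * (ρ y * |g y| / (1 + ‖y‖ ^ (d : ℝ)))) ?_ (hg.const_mul C) ?_
  · filter_upwards [Metric.ball_mem_nhds z hr] with z' hz'
    exact Eventually.of_forall (hbd z' hz')
  · refine Eventually.of_forall fun y => ?_
    rcases (h0 y).eq_or_lt with h | h
    · simp only [← h, zero_mul]; exact continuousAt_const
    · have := (hb z (Metric.mem_ball_self hr) y h).1
      refine continuousAt_const.mul (ContinuousAt.rpow_const ?_ (Or.inl this.ne'))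
      fun_prop

/-- for `x` outside the closed support of `ρ`, under the growth condition
`∫ ρ(y)·|f(y)|/(1+‖y‖^d) dy < ∞`, the expectation of the Hilbert kernel estimator converges
to `f̂_∞(x) = (∫ ρ(y)·f(y)·‖x−y‖^{−d} dy)/(∫ ρ(y)·‖x−y‖^{−d} dy)` as `n → ∞`, and `f̂_∞` is
continuous at every point outside the closed support. -/
theorem hilbert_extrapolation_limit
    (d : ℕ) (hd : 1 ≤ d)
    (ρ : Euc d → ℝ) (hρ_meas : Measurable ρ) (hρ_nonneg : ∀ y, 0 ≤ ρ y)
    (hρ_prob : (∫ y, ρ y) = 1)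
    (hρ_var : Integrable (fun y => ρ y * ‖y‖ ^ 2))
    (f : Euc d → ℝ) (hf_meas : Measurable f)
    (hf_growth : Integrable (fun y => ρ y * |f y| / (1 + ‖y‖ ^ (d : ℝ))))
    (x : Euc d) (hx : x ∉ closure {y | 0 < ρ y}) :
    Tendsto (fun n : ℕ => hilbertEstExp d n x ρ f) atTop
      (nhds (hilbertExtrapolation d ρ f x)) ∧
    ∀ z : Euc d, z ∉ closure {y | 0 < ρ y} →
      ContinuousAt (hilbertExtrapolation d ρ f) z := by
  have hρi : Integrable ρ := by
    by_contra hc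
    rw [integral_undef hc] at hρ_prob
    exact zero_ne_one hρ_prob
  set ν := (volume : Measure (Euc d)).withDensity (fun y => ENNReal.ofReal (ρ y)) with hν
  have hprob : IsProbabilityMeasure ν := by
    constructor
    rw [hν, withDensity_apply _ MeasurableSet.univ, setLIntegral_univ,
      ← ofReal_integral_eq_lintegral_ofReal hρi (Eventually.of_forall hρ_nonneg), hρ_prob]
    simp
  have hKint : ∀ z, ∫ y, hkK d ρ z y ∂ν = ∫ y : Euc d, ρ y * ‖z - y‖ ^ (-(d : ℝ)) := by
    intro z
    rw [hk_integral_wd ρ hρ_meas hρ_nonneg]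
    simp_rw [hkK_mul d ρ hρ_nonneg]
  have hpos : ∀ z, z ∉ closure {y | 0 < ρ y} → 0 < ∫ y, hkK d ρ z y ∂ν := by
    intro z hz
    obtain ⟨hK, -, -, B, hB0, hB⟩ := hk_facts d ρ z hz
    have hKi : Integrable (hkK d ρ z) ν :=
      Integrable.of_bound (hkK_meas d ρ hρ_meas z).aestronglyMeasurable B
      (Eventually.of_forall fun y => by rw [Real.norm_of_nonneg (hK y).le]; exact hB y)
    rw [integral_pos_iff_support_of_nonneg (fun y => (hK y).le) hKi]
    have : Function.support (hkK d ρ z) = Set.univ := by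
      ext y; simp [(hK y).ne']
    rw [this, measure_univ]
    exact one_pos
  constructor
  · obtain ⟨hK, hh, hKh, B, hB0, hB⟩ := hk_facts d ρ x hx
    have hhi : Integrable (hkh d ρ x) ν := by
      refine hk_integrable_wd ρ hρ_meas hρ_nonneg _ ?_
      simp_rw [hkh_mul d ρ hρ_nonneg]
      have hdom : Integrable (fun y => 2 * ‖x‖ ^ 2 * ρ y + 2 * (ρ y * ‖y‖ ^ 2)) :=
        (hρi.const_mul _).add (hρ_var.const_mul _)
      refine hdom.mono' (Measurable.aestronglyMeasurable (by fun_prop))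
        (Eventually.of_forall fun y => ?_)
      have h0 := hρ_nonneg y
      rw [Real.norm_of_nonneg (by positivity)]
      have h1 : ‖x - y‖ ^ 2 ≤ 2 * ‖x‖ ^ 2 + 2 * ‖y‖ ^ 2 := by
        have : ‖x - y‖ ^ 2 ≤ (‖x‖ + ‖y‖) ^ 2 := by
          gcongr; exact norm_sub_le x y
        nlinarith [sq_nonneg (‖x‖ - ‖y‖)]
      nlinarith [mul_le_mul_of_nonneg_left h1 h0]
    have e0 : ∀ y, ρ y * (hkK d ρ x y * f y) = ρ y * f y * ‖x - y‖ ^ (-(d : ℝ)) := by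
      intro y
      rw [← mul_assoc, hkK_mul d ρ hρ_nonneg]; ring
    have hg : Integrable (fun y => hkK d ρ x y * f y) ν := by
      refine hk_integrable_wd ρ hρ_meas hρ_nonneg _ ?_
      simp_rw [e0]
      exact (hk_contAt d ρ f hρ_nonneg hρ_meas hf_meas hf_growth x hx).1
    have key := hk_core_s16 ν (hkK d ρ x) (hkh d ρ x) f (hkK_meas d ρ hρ_meas x) hf_meas d hh hK hKh
      hhi (hkh_meas d ρ hρ_meas x) B hB0 hB hg (hpos x hx)
    have elim : (∫ y, hkK d ρ x y * f y ∂ν) / ∫ y, hkK d ρ x y ∂ν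
        = hilbertExtrapolation d ρ f x := by
      rw [hKint, hk_integral_wd ρ hρ_meas hρ_nonneg]
      simp_rw [e0]
      rfl
    rw [elim] at key
    refine key.congr fun n => ?_
    rw [hν, hk_pi_withDensity ρ hρ_nonneg hρi,
      hk_integral_wd (fun xs : Fin (n + 1) → Euc d => ∏ i, ρ (xs i)) (by fun_prop)
        (fun xs => Finset.prod_nonneg fun i _ => hρ_nonneg _)]
    unfold hilbertEstExp
    refine integral_congr_ae (Eventually.of_forall fun xs => ?_)
    simp only
    by_cases hz : ∃ i, ρ (xs i) = 0
    · obtain ⟨i, hi⟩ := hz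
      rw [Finset.prod_eq_zero (Finset.mem_univ i) hi]; simp
    · push Not at hz
      have eK : ∀ i, hkK d ρ x (xs i) = ‖x - xs i‖ ^ (-(d : ℝ)) := by
        intro i
        unfold hkK
        rw [if_pos (lt_of_le_of_ne (hρ_nonneg _) (hz i).symm)]
      simp_rw [eK]
      rw [mul_comm]
      rfl
  · intro z hz
    have c1 := (hk_contAt d ρ f hρ_nonneg hρ_meas hf_meas hf_growth z hz).2
    have hg1 : Integrable (fun y => ρ y * |(fun _ : Euc d => (1 : ℝ)) y| / (1 + ‖y‖ ^ (d : ℝ))) := by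
      refine hρi.mono' (Measurable.aestronglyMeasurable (by fun_prop))
        (Eventually.of_forall fun y => ?_)
      have h1 := Real.rpow_nonneg (norm_nonneg y) (d : ℝ)
      have h0 := hρ_nonneg y
      simp only [abs_one, mul_one]
      rw [Real.norm_of_nonneg (by positivity)]
      exact div_le_self h0 (by linarith)
    have c2 := (hk_contAt d ρ (fun _ => 1) hρ_nonneg hρ_meas measurable_const hg1 z hz).2
    simp only [mul_one] at c2
    unfold hilbertExtrapolation
    refine c1.div c2 ?_
    rw [← hKint]
    exact (hpos z hz).ne'

end
end
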